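/- Let U and V be two relatively compact subanalytic open subsets of ℝⁿ. Then there exist a positive integer N and a constant C > 0 such that for all x ∈ ℝⁿ: dist(x, ℝⁿ \ (U ∪ V))^N ≤ C · (dist(x, ℝⁿ \ U) + dist(x, ℝⁿ \ V)). -/

import Mathlib

open scoped Topology
open Set

/-- A subset of a real normed space is *semianalytic* if, locally, it is a finite union of
finite intersections of zero sets and positivity sets of real-analytic functions. -/
def Semianalytic {E : Type*} [NormedAddCommGroup E] [NormedSpace ℝ E] (A : Set E) : Prop :=
  ∀ x : E, ∃ U ∈ 𝓝 x, ∃ (p q : ℕ) (f g : Fin p → Fin q → E → ℝ),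
    (∀ i j, AnalyticOnNhd ℝ (f i j) U) ∧ (∀ i j, AnalyticOnNhd ℝ (g i j) U) ∧
    A ∩ U = (⋃ i, ⋂ j, {y | f i j y = 0} ∩ {y | 0 < g i j y}) ∩ U

/-- A subset of a real normed space is *subanalytic* if, locally, it is the projection of a
relatively compact semianalytic subset of a product with some `ℝ^m`. -/
def Subanalytic {E : Type*} [NormedAddCommGroup E] [NormedSpace ℝ E] (A : Set E) : Prop :=
  ∀ x : E, ∃ U ∈ 𝓝 x, ∃ (m : ℕ) (B : Set (E × (Fin m → ℝ))),
    Semianalytic B ∧ IsCompact (closure B) ∧ A ∩ U = (Prod.fst '' B) ∩ U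

open scoped Topology
open Set

namespace LojQE

section Tarski
open Polynomial

/-- left sign condition -/
def LS (g : ℝ → ℝ) : WithBot ℝ → SignType → Prop
  | ⊥, s => s ≠ 0 ∧ ∀ M : ℝ, ∃ t < M, SignType.sign (g t) = s
  | (a : ℝ), s => SignType.sign (g a) = s

/-- right sign condition -/
def RS (g : ℝ → ℝ) : WithTop ℝ → SignType → Prop
  | ⊤, s => s ≠ 0 ∧ ∀ M : ℝ, ∃ t > M, SignType.sign (g t) = s
  | (a : ℝ), s => SignType.sign (g a) = s

def JJ (a : WithBot ℝ) (b : WithTop ℝ) : Set ℝ := {t : ℝ | a < (t : WithBot ℝ) ∧ (t : WithTop ℝ) < b}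

lemma JJ_Ioo {a b} {s t : ℝ} (hs : s ∈ JJ a b) (ht : t ∈ JJ a b) : Ioo s t ⊆ JJ a b := by
  intro u hu
  exact ⟨hs.1.trans (WithBot.coe_lt_coe.2 hu.1), (WithTop.coe_lt_coe.2 hu.2).trans ht.2⟩

lemma sgn_interval_mono (g : ℝ → ℝ) (hg : Continuous g) (a : WithBot ℝ) (b : WithTop ℝ)
    (hne : (JJ a b).Nonempty)
    (hm : ∀ s t, s < t → Ioo s t ⊆ JJ a b → g s < g t) (sa sb : SignType)
    (ha : LS g a sa) (hb : RS g b sb) :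
    (sa = - sb ∧ sa ≠ 0 ∧ ∃ ξ ∈ JJ a b, g ξ = 0 ∧
      (∀ t ∈ JJ a b, t < ξ → SignType.sign (g t) = sa) ∧
      (∀ t ∈ JJ a b, ξ < t → SignType.sign (g t) = sb)) ∨
    (¬ (sa = - sb ∧ sa ≠ 0) ∧ ∀ t ∈ JJ a b, SignType.sign (g t) = if sa ≠ 0 then sa else sb) := by
  have hL1 : sa = 0 ∨ sa = 1 → ∀ t ∈ JJ a b, 0 < g t := by
    intro h t ht
    induction a with
    | bot =>
      obtain ⟨h0, h1⟩ := ha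
      obtain ⟨u, hu, hu'⟩ := h1 t
      have : sa = 1 := by tauto
      rw [this, sign_eq_one_iff] at hu'
      have := hm u t hu (fun v hv => ⟨WithBot.bot_lt_coe _, (WithTop.coe_lt_coe.2 hv.2).trans ht.2⟩)
      linarith
    | coe a =>
      have h1 : SignType.sign (g a) = sa := ha
      have : 0 ≤ g a := by
        rcases h with h | h
        · rw [h, sign_eq_zero_iff] at h1; exact h1.ge
        · rw [h, sign_eq_one_iff] at h1; exact h1.le
      have := hm a t (WithBot.coe_lt_coe.1 ht.1) (fun v hv => ⟨WithBot.coe_lt_coe.2 hv.1, (WithTop.coe_lt_coe.2 hv.2).trans ht.2⟩)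
      linarith
  have hR1 : sb = 0 ∨ sb = -1 → ∀ t ∈ JJ a b, g t < 0 := by
    intro h t ht
    induction b with
    | top =>
      obtain ⟨h0, h1⟩ := hb
      obtain ⟨u, hu, hu'⟩ := h1 t
      have : sb = -1 := by tauto
      rw [this, sign_eq_neg_one_iff] at hu'
      have := hm t u hu (fun v hv => ⟨ht.1.trans (WithBot.coe_lt_coe.2 hv.1), WithTop.coe_lt_top _⟩)
      linarith
    | coe b =>
      have h1 : SignType.sign (g b) = sb := hb
      have : g b ≤ 0 := by
        rcases h with h | h
        · rw [h, sign_eq_zero_iff] at h1; exact h1.le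
        · rw [h, sign_eq_neg_one_iff] at h1; exact h1.le
      have := hm t b (WithTop.coe_lt_coe.1 ht.2) (fun v hv => ⟨ht.1.trans (WithBot.coe_lt_coe.2 hv.1), WithTop.coe_lt_coe.2 hv.2⟩)
      linarith
  have hL2 : sa = -1 → ∃ t ∈ JJ a b, g t < 0 := by
    intro h
    obtain ⟨t, ht⟩ := hne
    induction a with
    | bot =>
      obtain ⟨u, hu, hu'⟩ := ha.2 t
      rw [h, sign_eq_neg_one_iff] at hu'
      exact ⟨u, ⟨WithBot.bot_lt_coe _, (WithTop.coe_lt_coe.2 hu).trans ht.2⟩, hu'⟩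
    | coe a =>
      have h1 : SignType.sign (g a) = sa := ha
      rw [h, sign_eq_neg_one_iff] at h1
      have h2 : ∀ᶠ u in 𝓝[>] a, g u < 0 :=
        (hg.continuousAt.eventually_lt continuousAt_const h1).filter_mono nhdsWithin_le_nhds
      have h3 : ∀ᶠ u in 𝓝[>] a, u ∈ Ioo a t := Ioo_mem_nhdsGT (WithBot.coe_lt_coe.1 ht.1)
      obtain ⟨u, hu, hu'⟩ := (h2.and h3).exists
      exact ⟨u, ⟨WithBot.coe_lt_coe.2 hu'.1, (WithTop.coe_lt_coe.2 hu'.2).trans ht.2⟩, hu⟩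
  have hR2 : sb = 1 → ∃ t ∈ JJ a b, 0 < g t := by
    intro h
    obtain ⟨t, ht⟩ := hne
    induction b with
    | top =>
      obtain ⟨u, hu, hu'⟩ := hb.2 t
      rw [h, sign_eq_one_iff] at hu'
      exact ⟨u, ⟨ht.1.trans (WithBot.coe_lt_coe.2 hu), WithTop.coe_lt_top _⟩, hu'⟩
    | coe b =>
      have h1 : SignType.sign (g b) = sb := hb
      rw [h, sign_eq_one_iff] at h1
      have h2 : ∀ᶠ u in 𝓝[<] b, 0 < g u :=
        (continuousAt_const.eventually_lt hg.continuousAt h1).filter_mono nhdsWithin_le_nhds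
      have h3 : ∀ᶠ u in 𝓝[<] b, u ∈ Ioo t b := Ioo_mem_nhdsLT (WithTop.coe_lt_coe.1 ht.2)
      obtain ⟨u, hu, hu'⟩ := (h2.and h3).exists
      exact ⟨u, ⟨ht.1.trans (WithBot.coe_lt_coe.2 hu'.1), WithTop.coe_lt_coe.2 hu'.2⟩, hu⟩
  obtain ⟨t0, ht0⟩ := hne
  have key : ∀ s : SignType, s = 0 ∨ s = 1 ∨ s = -1 := by decide
  rcases key sa with h | h | h <;> rcases key sb with h' | h' | h'
  · have := hL1 (Or.inl h) t0 ht0; have := hR1 (Or.inl h') t0 ht0; linarith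
  · right; subst h h'
    refine ⟨by decide, fun t ht => ?_⟩
    simp only [ne_eq, not_true_eq_false, if_false]
    exact sign_eq_one_iff.2 (hL1 (Or.inl rfl) t ht)
  · have := hL1 (Or.inl h) t0 ht0; have := hR1 (Or.inr h') t0 ht0; linarith
  · have := hL1 (Or.inr h) t0 ht0; have := hR1 (Or.inl h') t0 ht0; linarith
  · right; subst h h'
    refine ⟨by decide, fun t ht => ?_⟩
    simpa using sign_eq_one_iff.2 (hL1 (Or.inr rfl) t ht)
  · have := hL1 (Or.inr h) t0 ht0; have := hR1 (Or.inr h') t0 ht0; linarith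
  · right; subst h h'
    refine ⟨by decide, fun t ht => ?_⟩
    simpa using sign_eq_neg_one_iff.2 (hR1 (Or.inl rfl) t ht)
  · left; subst h h'
    refine ⟨rfl, by decide, ?_⟩
    obtain ⟨u, hu, hu'⟩ := hL2 rfl
    obtain ⟨v, hv, hv'⟩ := hR2 rfl
    have huv : u < v := by
      by_contra hcon
      rcases eq_or_lt_of_le (not_lt.1 hcon) with h1 | h1
      · subst h1; linarith
      · have := hm v u h1 (JJ_Ioo hv hu); linarith
    obtain ⟨ξ, hξ, hξ0⟩ := intermediate_value_Ioo huv.le hg.continuousOn ⟨hu', hv'⟩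
    have hξJ := JJ_Ioo hu hv hξ
    refine ⟨ξ, hξJ, hξ0, fun t ht htξ => ?_, fun t ht htξ => ?_⟩
    · rw [sign_eq_neg_one_iff, ← hξ0]; exact hm _ _ htξ (JJ_Ioo ht hξJ)
    · rw [sign_eq_one_iff, ← hξ0]; exact hm _ _ htξ (JJ_Ioo hξJ ht)
  · right; subst h h'
    refine ⟨by decide, fun t ht => ?_⟩
    simpa using sign_eq_neg_one_iff.2 (hR1 (Or.inr rfl) t ht)

lemma sgn_interval (g : ℝ → ℝ) (hg : Continuous g) (a : WithBot ℝ) (b : WithTop ℝ)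
    (hne : (JJ a b).Nonempty)
    (hm : (∀ s t, s < t → Ioo s t ⊆ JJ a b → g s < g t) ∨ (∀ s t, s < t → Ioo s t ⊆ JJ a b → g t < g s))
    (sa sb : SignType)
    (ha : LS g a sa) (hb : RS g b sb) :
    (sa = - sb ∧ sa ≠ 0 ∧ ∃ ξ ∈ JJ a b, g ξ = 0 ∧
      (∀ t ∈ JJ a b, t < ξ → SignType.sign (g t) = sa) ∧
      (∀ t ∈ JJ a b, ξ < t → SignType.sign (g t) = sb)) ∨
    (¬ (sa = - sb ∧ sa ≠ 0) ∧ ∀ t ∈ JJ a b, SignType.sign (g t) = if sa ≠ 0 then sa else sb) := by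
  have hz : ∀ s : SignType, -s = 0 ↔ s = 0 := by decide
  rcases hm with hm | hm
  · exact sgn_interval_mono g hg a b hne hm sa sb ha hb
  · have := sgn_interval_mono (fun t => - g t) hg.neg a b hne (fun s t h h' => neg_lt_neg (hm s t h h')) (-sa) (-sb)
      (by cases a with
          | bot => exact ⟨by simpa [hz] using (show sa ≠ 0 from ha.1), fun M => by simpa [Left.sign_neg] using ha.2 M⟩
          | coe a => have h1 : SignType.sign (g a) = sa := ha
                     simp [LS, Left.sign_neg, h1])
      (by cases b with
          | top => exact ⟨by simpa [hz] using (show sb ≠ 0 from hb.1), fun M => by simpa [Left.sign_neg] using hb.2 M⟩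
          | coe a => have h1 : SignType.sign (g a) = sb := hb
                     simp [RS, Left.sign_neg, h1])
    simp only [Left.sign_neg, neg_inj, neg_eq_zero, ne_eq, hz] at this
    rcases this with h | h
    · left; exact h
    · right; refine ⟨h.1, fun t ht => ?_⟩
      have := h.2 t ht
      split_ifs at this ⊢ <;> simpa using this


variable {A : Type} [CommRing A]

def Agr (x : A →+* ℝ) (ps : Set A[X]) (t : ℝ) (σ : A[X] → SignType) : Prop :=
  ∀ p ∈ ps, SignType.sign (p.eval₂ x t) = σ p

def Rt (ps : Set A[X]) (τ : A[X] → SignType) : Prop :=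
  ∃ q ∈ ps, 0 < q.natDegree ∧ τ (C q.leadingCoeff) ≠ 0 ∧ τ q = 0

def RR (x : A →+* ℝ) (ps : Set A[X]) : WithBot ℝ → List (A[X] → SignType) → Prop
  | _, [] => False
  | a, [σ] => ∀ t ∈ JJ a ⊤, Agr x ps t σ
  | a, σ :: τ :: rest => ∃ ξ : ℝ, a < (ξ : WithBot ℝ) ∧ (∀ t ∈ JJ a ξ, Agr x ps t σ) ∧
      Agr x ps ξ τ ∧ Rt ps τ ∧ RR x ps ξ rest

lemma prem_exists (q : A[X]) (hq : 0 < q.natDegree) : ∀ (n : ℕ) (p : A[X]), p.natDegree ≤ n →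
    ∃ (k : ℕ) (c r : A[X]), C q.leadingCoeff ^ k * p = c * q + r ∧ r.natDegree < q.natDegree := by
  intro n
  induction n with
  | zero => intro p hp; exact ⟨0, 0, p, by simp, by omega⟩
  | succ n ih =>
    intro p hp
    by_cases h : p.natDegree < q.natDegree
    · exact ⟨0, 0, p, by simp, h⟩
    push Not at h
    set p1 := C q.leadingCoeff * p - C p.leadingCoeff * X ^ (p.natDegree - q.natDegree) * q with hp1
    have h1 : p1.natDegree ≤ p.natDegree := by
      refine (natDegree_sub_le _ _).trans (max_le (natDegree_C_mul_le _ _) ?_)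
      rw [mul_assoc]
      refine (natDegree_C_mul_le _ _).trans (natDegree_mul_le.trans ?_)
      have := natDegree_X_pow_le (R := A) (p.natDegree - q.natDegree)
      omega
    have h2 : p1.coeff p.natDegree = 0 := by
      rw [hp1, coeff_sub, coeff_C_mul, mul_assoc, coeff_C_mul, coeff_X_pow_mul']
      simp only [Nat.sub_le, if_true]
      rw [Nat.sub_sub_self h]
      simp only [leadingCoeff]; ring
    have h3 : p1.natDegree ≤ n := by
      by_contra hcon
      have h4 : p1.natDegree = p.natDegree := by omega
      have h5 : p1.leadingCoeff = 0 := by rw [leadingCoeff, h4, h2]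
      rw [leadingCoeff_eq_zero] at h5
      rw [h5] at hcon; simp at hcon
    obtain ⟨k, c, r, e, hr⟩ := ih p1 h3
    refine ⟨k + 1, c + C q.leadingCoeff ^ k * (C p.leadingCoeff * X ^ (p.natDegree - q.natDegree)), r, ?_, hr⟩
    have : C q.leadingCoeff ^ (k+1) * p = C q.leadingCoeff ^ k * p1 +
      C q.leadingCoeff ^ k * (C p.leadingCoeff * X ^ (p.natDegree - q.natDegree)) * q := by
      rw [hp1]; ring
    rw [this, e]; ring

/-- `r` is a pseudo-remainder of `p` by `q`. -/
def IsPrem (p q r : A[X]) : Prop :=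
  ∃ (k : ℕ) (c : A[X]), C q.leadingCoeff ^ k * p = c * q + r

lemma sign_at_root (p : A[X]) (ps : Set A[X])
    (hcl : ∀ q ∈ ps, 0 < q.natDegree → C q.leadingCoeff ∈ ps ∧ ∃ r ∈ ps, IsPrem p q r)
    (τ : A[X] → SignType) (hτ : Rt ps τ) :
    ∃ s : SignType, ∀ (x : A →+* ℝ) (ξ : ℝ), Agr x ps ξ τ → SignType.sign (p.eval₂ x ξ) = s := by
  obtain ⟨q, hq, hd, hlc, h0⟩ := hτ
  obtain ⟨h1, r, hr, k, c, e⟩ := hcl q hq hd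
  refine ⟨τ (C q.leadingCoeff) ^ k * τ r, fun x ξ hA => ?_⟩
  have hq0 : q.eval₂ x ξ = 0 := by
    have := hA q hq; rwa [h0, sign_eq_zero_iff] at this
  have e2 := congrArg (fun f => f.eval₂ x ξ) e
  simp only [eval₂_mul, eval₂_add, eval₂_pow, hq0, mul_zero, zero_add] at e2
  have e3 := congrArg SignType.sign e2
  rw [sign_mul, sign_pow, hA _ h1, hA _ hr] at e3
  rw [← e3, ← mul_assoc, ← mul_pow]
  have : ∀ s : SignType, s ≠ 0 → s * s = 1 := by decide
  rw [this _ hlc, one_pow, one_mul]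

end Tarski
end LojQE

open scoped Topology
open Set

namespace LojQE

section Tarski2
open Polynomial
variable {A : Type} [CommRing A]

lemma JJ_isOpen (a b) : IsOpen (JJ a b) := by
  have h1 : IsOpen {t : ℝ | a < (t : WithBot ℝ)} := by
    cases a with
    | bot => simp
    | coe a => simpa using! isOpen_Ioi (a := a)
  have h2 : IsOpen {t : ℝ | (t : WithTop ℝ) < b} := by
    cases b with
    | top => simp
    | coe a => simpa using! isOpen_Iio (a := a)
  exact h1.inter h2

lemma JJ_nonempty_coe {a : WithBot ℝ} {ξ : ℝ} (h : a < (ξ : WithBot ℝ)) : (JJ a ξ).Nonempty := by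
  cases a with
  | bot => exact ⟨ξ - 1, WithBot.bot_lt_coe _, WithTop.coe_lt_coe.2 (by linarith)⟩
  | coe a => 
    have : a < ξ := WithBot.coe_lt_coe.1 h
    exact ⟨(a+ξ)/2, WithBot.coe_lt_coe.2 (by linarith), WithTop.coe_lt_coe.2 (by linarith)⟩

lemma JJ_nonempty_top (a : WithBot ℝ) : (JJ a ⊤).Nonempty := by
  cases a with
  | bot => exact ⟨0, WithBot.bot_lt_coe _, by simp⟩
  | coe a => exact ⟨a + 1, WithBot.coe_lt_coe.2 (by linarith), by simp⟩

lemma mono_of (p : A[X]) (hp : 0 < p.natDegree) (ps : Set A[X]) (hp' : derivative p ∈ ps)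
    (x : A →+* ℝ) (hx : x p.leadingCoeff ≠ 0) (a b) (hne : (JJ a b).Nonempty) (σ)
    (h : ∀ t ∈ JJ a b, Agr x ps t σ) :
    (∀ s t, s < t → Ioo s t ⊆ JJ a b → p.eval₂ x s < p.eval₂ x t) ∨
    (∀ s t, s < t → Ioo s t ⊆ JJ a b → p.eval₂ x t < p.eval₂ x s) := by
  have hd : ∀ t, deriv (fun t => p.eval₂ x t) t = (derivative p).eval₂ x t := by
    intro t
    simp only [eval₂_eq_eval_map, Polynomial.deriv, derivative_map]
  have hc : Continuous fun t => p.eval₂ x t := by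
    simp only [eval₂_eq_eval_map]; exact (p.map x).continuous
  have key : ∀ s : SignType, s = 0 ∨ s = 1 ∨ s = -1 := by decide
  rcases key (σ (derivative p)) with h0 | h0 | h0
  · exfalso
    obtain ⟨t0, ht0⟩ := hne
    have hnat : (p.map x).natDegree = p.natDegree := natDegree_map_of_leadingCoeff_ne_zero _ hx
    have : derivative (p.map x) = 0 := by
      apply Polynomial.eq_zero_of_infinite_isRoot
      refine (infinite_of_mem_nhds t0 ((JJ_isOpen a b).mem_nhds ht0)).mono fun t ht => ?_
      have := h t ht _ hp'
      rw [h0, sign_eq_zero_iff] at this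
      simpa [IsRoot, eval₂_eq_eval_map] using this
    have := Polynomial.derivative_eq_zero.1 this
    omega
  · left
    intro s t hst hJ
    refine strictMonoOn_of_deriv_pos (convex_Icc s t) hc.continuousOn ?_ (left_mem_Icc.2 hst.le) (right_mem_Icc.2 hst.le) hst
    intro u hu
    rw [interior_Icc] at hu
    rw [hd]
    have := h u (hJ hu) _ hp'
    rwa [h0, sign_eq_one_iff] at this
  · right
    intro s t hst hJ
    refine strictAntiOn_of_deriv_neg (convex_Icc s t) hc.continuousOn ?_ (left_mem_Icc.2 hst.le) (right_mem_Icc.2 hst.le) hst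
    intro u hu
    rw [interior_Icc] at hu
    rw [hd]
    have := h u (hJ hu) _ hp'
    rwa [h0, sign_eq_neg_one_iff] at this

open Classical in
lemma Agr_insert {x : A →+* ℝ} {ps : Set A[X]} {p : A[X]} (hp : p ∉ ps) {t : ℝ} {σ s} (h : Agr x ps t σ)
    (hs : SignType.sign (p.eval₂ x t) = s) : Agr x (insert p ps) t (Function.update σ p s) := by
  intro q hq
  by_cases e : q = p
  · subst e; simp [hs]
  · rw [Function.update_of_ne e]; exact h q (hq.resolve_left e)

open Classical in
lemma Rt_insert {ps : Set A[X]} {p : A[X]} (hp : p ∉ ps)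
    (hcl : ∀ q ∈ ps, 0 < q.natDegree → C q.leadingCoeff ∈ ps) {τ} (s) (h : Rt ps τ) :
    Rt (insert p ps) (Function.update τ p s) := by
  obtain ⟨q, hq, hd, h1, h2⟩ := h
  refine ⟨q, Or.inr hq, hd, ?_, ?_⟩
  · rwa [Function.update_of_ne]; rintro rfl; exact hp (hcl q hq hd)
  · rwa [Function.update_of_ne]; rintro rfl; exact hp hq

open Classical in
theorem insert_B (p : A[X]) (ps : Set A[X]) (hpp : p ∉ ps) (hp : 0 < p.natDegree) (hp' : derivative p ∈ ps)
    (hlc : C p.leadingCoeff ∈ ps)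
    (hcl : ∀ q ∈ ps, 0 < q.natDegree → C q.leadingCoeff ∈ ps ∧ ∃ r ∈ ps, IsPrem p q r) :
    ∀ (L : List (A[X] → SignType)) (sa sinf : SignType), ∃ L', ∀ (x : A →+* ℝ) (a : WithBot ℝ),
      x p.leadingCoeff ≠ 0 → LS (fun t => p.eval₂ x t) a sa → RS (fun t => p.eval₂ x t) ⊤ sinf →
      RR x ps a L → RR x (insert p ps) a L'
  | [], _, _ => ⟨[], fun _ _ _ _ _ h => h.elim⟩
  | [σ], sa, sinf => by
    have hne : C p.leadingCoeff ≠ p := by intro h; rw [← h] at hp; simp at hp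
    refine ⟨if sa = - sinf ∧ sa ≠ 0 then [Function.update σ p sa, Function.update σ p 0, Function.update σ p sinf] else
      [Function.update σ p (if sa ≠ 0 then sa else sinf)], fun x a hx hL hR h => ?_⟩
    have hc : Continuous fun t => p.eval₂ x t := by
      simp only [eval₂_eq_eval_map]; exact (p.map x).continuous
    have h' : ∀ t ∈ JJ a ⊤, Agr x ps t σ := h
    rcases sgn_interval _ hc a ⊤ (JJ_nonempty_top a) (mono_of p hp ps hp' x hx a ⊤ (JJ_nonempty_top a) σ h') sa sinf hL hR with
      ⟨h1, h2, ξ, hξ, h3, h4, h5⟩ | ⟨h1, h2⟩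
    · rw [if_pos ⟨h1, h2⟩]
      have hσ : Agr x ps ξ σ := h' ξ hξ
      refine ⟨ξ, hξ.1, fun t ht => ?_, Agr_insert hpp hσ (by simp [h3]), ?_, fun t ht => ?_⟩
      · have htJ : t ∈ JJ a ⊤ := ⟨ht.1, WithTop.coe_lt_top _⟩
        exact Agr_insert hpp (h' t htJ) (h4 t htJ (WithTop.coe_lt_coe.1 ht.2))
      · refine ⟨p, Or.inl rfl, hp, ?_, by simp⟩
        rw [Function.update_of_ne hne, ← hσ _ hlc]
        simpa using hx
      · have htJ : t ∈ JJ a ⊤ := ⟨hξ.1.trans ht.1, WithTop.coe_lt_top _⟩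
        exact Agr_insert hpp (h' t htJ) (h5 t htJ (WithBot.coe_lt_coe.1 ht.1))
    · rw [if_neg h1]
      exact fun t ht => Agr_insert hpp (h' t ht) (h2 t ht)
  | σ :: τ :: rest, sa, sinf => by
    have hne : C p.leadingCoeff ≠ p := by intro h; rw [← h] at hp; simp at hp
    by_cases hτ : Rt ps τ
    swap
    · exact ⟨[], fun x a _ _ _ h => by obtain ⟨ξ, _, _, _, h, _⟩ := h; exact (hτ h).elim⟩
    obtain ⟨s, hs⟩ := sign_at_root p ps hcl τ hτ
    obtain ⟨L', hL'⟩ := insert_B p ps hpp hp hp' hlc hcl rest s sinf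
    refine ⟨if sa = - s ∧ sa ≠ 0 then Function.update σ p sa :: Function.update σ p 0 :: Function.update σ p s ::
        Function.update τ p s :: L' else
      Function.update σ p (if sa ≠ 0 then sa else s) :: Function.update τ p s :: L', fun x a hx hL hR h => ?_⟩
    have hc : Continuous fun t => p.eval₂ x t := by
      simp only [eval₂_eq_eval_map]; exact (p.map x).continuous
    obtain ⟨ζ, haζ, h', hAτ, -, hrest⟩ := h
    have hsζ := hs x ζ hAτ
    have hrest' := hL' x ζ hx hsζ hR hrest
    have hRt := Rt_insert hpp (fun q hq hd => (hcl q hq hd).1) s hτ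
    have hAτ' := Agr_insert hpp hAτ hsζ
    have hJne := JJ_nonempty_coe haζ
    rcases sgn_interval _ hc a ζ hJne (mono_of p hp ps hp' x hx a ζ hJne σ h') sa s hL hsζ with
      ⟨h1, h2, ξ, hξ, h3, h4, h5⟩ | ⟨h1, h2⟩
    · rw [if_pos ⟨h1, h2⟩]
      have hσ : Agr x ps ξ σ := h' ξ hξ
      refine ⟨ξ, hξ.1, fun t ht => ?_, Agr_insert hpp hσ (by simp [h3]), ?_, ζ, WithBot.coe_lt_coe.2 (WithTop.coe_lt_coe.1 hξ.2), fun t ht => ?_, hAτ', hRt, hrest'⟩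
      · have htJ : t ∈ JJ a ζ := ⟨ht.1, ht.2.trans hξ.2⟩
        exact Agr_insert hpp (h' t htJ) (h4 t htJ (WithTop.coe_lt_coe.1 ht.2))
      · refine ⟨p, Or.inl rfl, hp, ?_, by simp⟩
        rw [Function.update_of_ne hne, ← hσ _ hlc]
        simpa using hx
      · have htJ : t ∈ JJ a ζ := ⟨hξ.1.trans ht.1, ht.2⟩
        exact Agr_insert hpp (h' t htJ) (h5 t htJ (WithBot.coe_lt_coe.1 ht.1))
    · rw [if_neg h1]
      exact ⟨ζ, haζ, fun t ht => Agr_insert hpp (h' t ht) (h2 t ht), hAτ', hRt, hrest'⟩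

open Classical in
theorem insert_A (p : A[X]) (ps : Set A[X]) (hpp : p ∉ ps) (he : p.eraseLead ∈ ps)
    (hcl : ∀ q ∈ ps, 0 < q.natDegree → C q.leadingCoeff ∈ ps) :
    ∀ (L : List (A[X] → SignType)), ∃ L', ∀ (x : A →+* ℝ) (a : WithBot ℝ),
      x p.leadingCoeff = 0 → RR x ps a L → RR x (insert p ps) a L' := by
  have hev : ∀ (x : A →+* ℝ) t, x p.leadingCoeff = 0 → p.eval₂ x t = p.eraseLead.eval₂ x t := by
    intro x t h
    have := congrArg (fun q => q.eval₂ x t) (eraseLead_add_C_mul_X_pow p)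
    simp only [eval₂_add, eval₂_mul, eval₂_C, h, zero_mul, add_zero] at this
    exact this.symm
  have hA : ∀ (x : A →+* ℝ) t σ, x p.leadingCoeff = 0 → Agr x ps t σ →
      Agr x (insert p ps) t (Function.update σ p (σ p.eraseLead)) := by
    intro x t σ h h'
    exact Agr_insert hpp h' (by rw [hev x t h]; exact h' _ he)
  intro L
  refine ⟨L.map (fun σ => Function.update σ p (σ p.eraseLead)), fun x a hx => ?_⟩
  suffices H : ∀ (n : ℕ) (L : List (A[X] → SignType)) (a : WithBot ℝ), L.length ≤ n → RR x ps a L →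
      RR x (insert p ps) a (L.map (fun σ => Function.update σ p (σ p.eraseLead))) from H _ L a le_rfl
  intro n
  induction n with
  | zero => intro L a hl h; have : L = [] := by simpa using hl
            subst this; exact h.elim
  | succ n ih =>
    intro L a hl h
    match L, h, hl with
    | [], h, _ => exact h.elim
    | [σ], h, _ => exact fun t ht => hA x t σ hx (h t ht)
    | σ :: τ :: rest, ⟨ξ, h1, h2, h3, h4, h5⟩, hl =>
      exact ⟨ξ, h1, fun t ht => hA x t σ hx (h2 t ht), hA x ξ τ hx h3, Rt_insert hpp hcl _ h4,
        ih rest ξ (by simp at hl; omega) h5⟩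

lemma sign_infty (p : ℝ[X]) (hp : 0 < p.natDegree) :
    RS (fun t => p.eval t) ⊤ (SignType.sign p.leadingCoeff) := by
  have hp0 : p.leadingCoeff ≠ 0 := by rw [Ne, leadingCoeff_eq_zero]; rintro rfl; simp at hp
  have hdeg : 0 < p.degree := natDegree_pos_iff_degree_pos.1 hp
  refine ⟨by simpa using hp0, fun M => ?_⟩
  rcases lt_or_gt_of_ne hp0 with h | h
  · have := p.tendsto_atBot_of_leadingCoeff_nonpos hdeg h.le
    obtain ⟨t, ht, ht'⟩ := ((this.eventually_lt_atBot 0).and (Filter.eventually_gt_atTop M)).exists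
    exact ⟨t, ht', by rw [sign_neg h, sign_neg ht]⟩
  · have := p.tendsto_atTop_of_leadingCoeff_nonneg hdeg h.le
    obtain ⟨t, ht, ht'⟩ := ((this.eventually_gt_atTop 0).and (Filter.eventually_gt_atTop M)).exists
    exact ⟨t, ht', by rw [sign_pos h, sign_pos ht]⟩

lemma sign_neg_infty (p : ℝ[X]) (hp : 0 < p.natDegree) :
    LS (fun t => p.eval t) ⊥ ((-1) ^ p.natDegree * SignType.sign p.leadingCoeff) := by
  have h1 : (p.comp (-X)).natDegree = p.natDegree := by simp [natDegree_comp]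
  have h2 : (p.comp (-X)).leadingCoeff = (-1) ^ p.natDegree * p.leadingCoeff := by
    rw [leadingCoeff_comp (by simp)]; simp [mul_comm]
  obtain ⟨h3, h4⟩ := sign_infty (p.comp (-X)) (by omega)
  have h5 : SignType.sign (p.comp (-X)).leadingCoeff = (-1) ^ p.natDegree * SignType.sign p.leadingCoeff := by
    rw [h2, sign_mul, sign_pow, Left.sign_neg, sign_one]
  refine ⟨h5 ▸ h3, fun M => ?_⟩
  obtain ⟨t, ht, ht'⟩ := h4 (-M)
  refine ⟨-t, by linarith, ?_⟩
  rw [← h5, ← ht']; simp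

open Classical in
/-- one-polynomial insertion -/
theorem insert_one (p : A[X]) (ps : Set A[X]) (hpp : p ∉ ps) (hp : 0 < p.natDegree) (hp' : derivative p ∈ ps)
    (hlc : C p.leadingCoeff ∈ ps) (he : p.eraseLead ∈ ps)
    (hcl : ∀ q ∈ ps, 0 < q.natDegree → C q.leadingCoeff ∈ ps ∧ ∃ r ∈ ps, IsPrem p q r)
    (L : List (A[X] → SignType)) (s : SignType) : ∃ L', ∀ (x : A →+* ℝ), SignType.sign (x p.leadingCoeff) = s →
      RR x ps ⊥ L → RR x (insert p ps) ⊥ L' := by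
  by_cases hs : s = 0
  · obtain ⟨L', h⟩ := insert_A p ps hpp he (fun q hq hd => (hcl q hq hd).1) L
    exact ⟨L', fun x hx => h x ⊥ (by rwa [hs, sign_eq_zero_iff] at hx)⟩
  · obtain ⟨L', h⟩ := insert_B p ps hpp hp hp' hlc hcl L ((-1) ^ p.natDegree * s) s
    refine ⟨L', fun x hx => ?_⟩
    have hx0 : x p.leadingCoeff ≠ 0 := by intro h0; rw [h0, sign_zero] at hx; exact hs hx.symm
    have hnat : (p.map x).natDegree = p.natDegree := natDegree_map_of_leadingCoeff_ne_zero _ hx0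
    have hl : (p.map x).leadingCoeff = x p.leadingCoeff := leadingCoeff_map_of_leadingCoeff_ne_zero _ hx0
    refine h x ⊥ hx0 ?_ ?_
    · have := sign_neg_infty (p.map x) (by omega)
      rw [hnat, hl, hx] at this
      simpa only [eval₂_eq_eval_map] using this
    · have := sign_infty (p.map x) (by omega)
      rw [hl, hx] at this
      simpa only [eval₂_eq_eval_map] using this


lemma RR_mem (x : A →+* ℝ) (ps : Set A[X]) : ∀ (L) (a : WithBot ℝ), RR x ps a L →
    ∀ t ∈ JJ a ⊤, ∃ τ ∈ L, Agr x ps t τ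
  | [], _, h => h.elim
  | [σ], a, h => fun t ht => ⟨σ, by simp, h t ht⟩
  | σ :: τ :: rest, a, ⟨ξ, h1, h2, h3, _, h5⟩ => fun t ht => by
    rcases lt_trichotomy t ξ with h | h | h
    · exact ⟨σ, by simp, h2 t ⟨ht.1, WithTop.coe_lt_coe.2 h⟩⟩
    · exact ⟨τ, by simp, h ▸ h3⟩
    · obtain ⟨τ', h6, h7⟩ := RR_mem x ps rest ξ h5 t ⟨WithBot.coe_lt_coe.2 h, ht.2⟩
      exact ⟨τ', by simp [h6], h7⟩

lemma RR_exists (x : A →+* ℝ) (ps : Set A[X]) : ∀ (L) (a : WithBot ℝ), RR x ps a L →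
    ∀ τ ∈ L, ∃ t, Agr x ps t τ
  | [], _, h => h.elim
  | [σ], a, h => fun τ hτ => by
    obtain ⟨t, ht⟩ := JJ_nonempty_top a
    simp only [List.mem_singleton] at hτ
    exact ⟨t, hτ ▸ h t ht⟩
  | σ :: τ :: rest, a, ⟨ξ, h1, h2, h3, _, h5⟩ => fun τ' hτ => by
    simp only [List.mem_cons] at hτ
    rcases hτ with h | h | h
    · obtain ⟨t, ht⟩ := JJ_nonempty_coe h1
      exact ⟨t, h ▸ h2 t ht⟩
    · exact ⟨ξ, h ▸ h3⟩
    · exact RR_exists x ps rest ξ h5 τ' h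

open Classical in
lemma closure_exists (P : Finset A[X]) : ∃ P' : Finset A[X], P ⊆ P' ∧
    (∀ p ∈ P', 0 < p.natDegree → derivative p ∈ P' ∧ p.eraseLead ∈ P' ∧ C p.leadingCoeff ∈ P') ∧
    (∀ p ∈ P', ∀ q ∈ P', 0 < q.natDegree → q.natDegree ≤ p.natDegree →
      ∃ r ∈ P', r.natDegree < q.natDegree ∧ IsPrem p q r) := by
  have hpr : ∀ p q : A[X], ∃ r, 0 < q.natDegree → r.natDegree < q.natDegree ∧ IsPrem p q r := by
    intro p q
    by_cases h : 0 < q.natDegree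
    · obtain ⟨k, c, r, e, hr⟩ := prem_exists q h _ p le_rfl
      exact ⟨r, fun _ => ⟨hr, k, c, e⟩⟩
    · exact ⟨0, fun h' => (h h').elim⟩
  choose pr hpr using hpr
  let un : A[X] → Finset A[X] := fun p => {derivative p, p.eraseLead, C p.leadingCoeff}
  have hun : ∀ p, 0 < p.natDegree → ∀ r ∈ un p, r.natDegree < p.natDegree := by
    intro p hp r hr
    simp only [un, Finset.mem_insert, Finset.mem_singleton] at hr
    rcases hr with rfl | rfl | rfl
    · exact natDegree_derivative_lt hp.ne'
    · have := eraseLead_natDegree_le p; omega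
    · simpa using hp
  obtain ⟨D, hD⟩ : ∃ D, ∀ p ∈ P, p.natDegree < D :=
    ⟨P.sup natDegree + 1, fun p hp => Nat.lt_succ_of_le (Finset.le_sup (f := natDegree) hp)⟩
  have key : ∀ k, ∃ P' : Finset A[X], P ⊆ P' ∧ (∀ p ∈ P', p.natDegree < D) ∧
    (∀ p ∈ P', 0 < p.natDegree → ∀ r ∈ un p, r ∈ P' ∨ r.natDegree + k + 1 < D) ∧
    (∀ p ∈ P', ∀ q ∈ P', 0 < q.natDegree → q.natDegree ≤ p.natDegree → pr p q ∈ P' ∨ (pr p q).natDegree + k + 1 < D) := by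
    intro k
    induction k with
    | zero =>
      refine ⟨P, subset_rfl, hD, fun p hp h0 r hr => Or.inr ?_, fun p hp q hq h0 _ => Or.inr ?_⟩
      · have := hun p h0 r hr; have := hD p hp; omega
      · have := (hpr p q h0).1; have := hD q hq; omega
    | succ k ih =>
      obtain ⟨P', hP, hdeg, h1, h2⟩ := ih
      let Pn := P' ∪ (P'.filter (fun p => 0 < p.natDegree)).biUnion un ∪
        ((P' ×ˢ P').filter (fun pq => 0 < pq.2.natDegree ∧ pq.2.natDegree ≤ pq.1.natDegree)).image (fun pq => pr pq.1 pq.2)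
      have hold : P' ⊆ Pn := fun p hp => by simp [Pn, hp]
      have hnew : ∀ p ∈ Pn, p ∈ P' ∨ p.natDegree + k + 1 < D := by
        intro p hp
        simp only [Pn, Finset.mem_union, Finset.mem_biUnion, Finset.mem_filter, Finset.mem_image, Finset.mem_product, Prod.exists] at hp
        rcases hp with (hp | ⟨q, ⟨hq, hq0⟩, hqp⟩) | ⟨q, q', ⟨⟨hq, hq'⟩, h0, h0'⟩, rfl⟩
        · exact Or.inl hp
        · exact h1 q hq hq0 p hqp
        · exact h2 q hq q' hq' h0 h0'
      refine ⟨Pn, hP.trans hold, ?_, ?_, ?_⟩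
      · intro p hp
        rcases hnew p hp with h | h
        · exact hdeg p h
        · omega
      · intro p hp h0 r hr
        rcases hnew p hp with h | h
        · left
          simp only [Pn, Finset.mem_union, Finset.mem_biUnion, Finset.mem_filter]
          exact Or.inl (Or.inr ⟨p, ⟨h, h0⟩, hr⟩)
        · right; have := hun p h0 r hr; omega
      · intro p hp q hq h0 hle
        have hlt := (hpr p q h0).1
        rcases hnew p hp with h | h
        · rcases hnew q hq with h' | h'
          · left
            simp only [Pn, Finset.mem_union, Finset.mem_image, Finset.mem_filter, Finset.mem_product, Prod.exists]
            exact Or.inr ⟨p, q, ⟨⟨h, h'⟩, h0, hle⟩, rfl⟩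
          · right; omega
        · right; omega
  obtain ⟨P', hP, -, h1, h2⟩ := key D
  refine ⟨P', hP, fun p hp h0 => ?_, fun p hp q hq h0 hle => ?_⟩
  · have h := fun r hr => (h1 p hp h0 r hr).resolve_right (by omega)
    exact ⟨h _ (by simp [un]), h _ (by simp [un]), h _ (by simp [un])⟩
  · exact ⟨pr p q, (h2 p hp q hq h0 hle).resolve_right (by omega), hpr p q h0⟩

open Classical in
/-- One-variable elimination (Tarski). -/
theorem tarski (P : Finset A[X]) : ∃ Q : Finset A, ∀ x x' : A →+* ℝ,
    (∀ a ∈ Q, SignType.sign (x a) = SignType.sign (x' a)) →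
    ∀ σ : A[X] → SignType, (∃ t : ℝ, ∀ p ∈ P, SignType.sign (p.eval₂ x t) = σ p) →
      ∃ t : ℝ, ∀ p ∈ P, SignType.sign (p.eval₂ x' t) = σ p := by
  obtain ⟨P', hP, h1, h2⟩ := closure_exists P
  let Q : Finset A := (P'.filter (fun p => p.natDegree = 0)).image (fun p => p.coeff 0)
  have hQ0 : ∀ p ∈ P', p.natDegree = 0 → p.coeff 0 ∈ Q := fun p hp h0 =>
    Finset.mem_image.2 ⟨p, Finset.mem_filter.2 ⟨hp, h0⟩, rfl⟩
  have hQ : ∀ p ∈ P', 0 < p.natDegree → p.leadingCoeff ∈ Q := fun p hp h0 => by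
    simpa using hQ0 _ (h1 p hp h0).2.2 (natDegree_C _)
  refine ⟨Q, fun x x' hxx => ?_⟩
  have main : ∀ S : Finset A[X], S ⊆ P' → (∀ p ∈ S, ∀ q ∈ P', q.natDegree < p.natDegree → q ∈ S) →
      ∃ L, RR x (S : Set A[X]) ⊥ L ∧ RR x' (S : Set A[X]) ⊥ L := by
    intro S
    induction S using Finset.induction_on_max_value (fun p : A[X] => p.natDegree) with
    | empty => exact fun _ _ => ⟨[fun _ => 0], fun t _ p hp => by simp at hp, fun t _ p hp => by simp at hp⟩
    | insert p s hps hmax ih =>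
      intro hS hdc
      have hpP : p ∈ P' := hS (Finset.mem_insert_self _ _)
      have hsP : s ⊆ P' := (Finset.subset_insert _ _).trans hS
      by_cases h0 : p.natDegree = 0
      · have hall : ∀ q ∈ insert p s, q.natDegree = 0 := by
          intro q hq
          rcases Finset.mem_insert.1 hq with rfl | hq
          · exact h0
          · have := hmax q hq; omega
        have hev : ∀ (y : A →+* ℝ) (t : ℝ), ∀ q ∈ insert p s, q.eval₂ y t = y (q.coeff 0) := by
          intro y t q hq
          conv_lhs => rw [eq_C_of_natDegree_eq_zero (hall q hq)]
          simp
        refine ⟨[fun q => SignType.sign (x (q.coeff 0))], fun t _ q hq => ?_, fun t _ q hq => ?_⟩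
        · rw [hev x t q hq]
        · rw [hev x' t q hq]; exact (hxx _ (hQ0 q (hS hq) (hall q hq))).symm
      · have hpos : 0 < p.natDegree := Nat.pos_of_ne_zero h0
        have hlow : ∀ q ∈ P', q.natDegree < p.natDegree → q ∈ s := by
          intro q hq hlt
          rcases Finset.mem_insert.1 (hdc p (Finset.mem_insert_self _ _) q hq hlt) with rfl | h
          · omega
          · exact h
        obtain ⟨L, hL, hL'⟩ := ih hsP (by
          intro q hq r hr hlt
          exact hlow r hr (hlt.trans_le (hmax q hq)))
        obtain ⟨d1, d2, d3⟩ := h1 p hpP hpos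
        obtain ⟨L', hL2⟩ := insert_one p (s : Set A[X]) (by exact_mod_cast hps) hpos
          (hlow _ d1 (natDegree_derivative_lt h0)) (hlow _ d3 (by simpa using hpos))
          (hlow _ d2 (by have := eraseLead_natDegree_le p; omega))
          (fun q hq hq0 => ⟨hlow _ (h1 q (hsP hq) hq0).2.2 (by simpa using hpos), by
            obtain ⟨r, hr, hlt, hp⟩ := h2 p hpP q (hsP hq) hq0 (hmax q hq)
            exact ⟨r, hlow r hr (hlt.trans_le (hmax q hq)), hp⟩⟩) L (SignType.sign (x p.leadingCoeff))
        refine ⟨L', ?_, ?_⟩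
        · rw [Finset.coe_insert]; exact hL2 x rfl hL
        · rw [Finset.coe_insert]; exact hL2 x' (hxx _ (hQ p hpP hpos)).symm hL'
  obtain ⟨L, hL, hL'⟩ := main P' subset_rfl (fun _ _ q hq _ => hq)
  rintro σ ⟨t, ht⟩
  obtain ⟨τ, hτ, hA⟩ := RR_mem x _ L ⊥ hL t ⟨WithBot.bot_lt_coe _, WithTop.coe_lt_top _⟩
  obtain ⟨t', ht'⟩ := RR_exists x' _ L ⊥ hL' τ hτ
  refine ⟨t', fun p hp => ?_⟩
  rw [← ht p hp, hA p (hP hp), ht' p (hP hp)]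

end Tarski2
end LojQE

open scoped Topology
open Set

namespace LojQE
set_option linter.unusedSectionVars false
section Ext
variable {ι : Type} [Fintype ι] {E : Type} [NormedAddCommGroup E] [NormedSpace ℝ E]
  {𝔸 : Type} [NormedRing 𝔸] [NormedAlgebra ℝ 𝔸] [NormOneClass 𝔸]

/-- extension of a real power series to noncommuting arguments -/
noncomputable def ext (p : FormalMultilinearSeries ℝ E ℝ) (e : ι → E) (𝔸 : Type) [NormedRing 𝔸]
    [NormedAlgebra ℝ 𝔸] :
    FormalMultilinearSeries ℝ (ι → 𝔸) 𝔸 := fun n =>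
  ∑ i : Fin n → ι, p n (fun k => e (i k)) •
    (ContinuousMultilinearMap.mkPiAlgebraFin ℝ n 𝔸).compContinuousLinearMap
      (fun k => ContinuousLinearMap.proj (i k))

theorem ext_apply (p : FormalMultilinearSeries ℝ E ℝ) (e : ι → E) (n : ℕ) (w : ι → 𝔸) :
    ext p e 𝔸 n (fun _ => w) =
      ∑ i : Fin n → ι, p n (fun k => e (i k)) • (List.ofFn fun k => w (i k)).prod := by
  simp [ext]

theorem ext_norm_le (p : FormalMultilinearSeries ℝ E ℝ) (e : ι → E) {M : ℝ} (hM : ∀ i, ‖e i‖ ≤ M)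
    (hM0 : 0 ≤ M) (n : ℕ) :
    ‖ext p e 𝔸 n‖ ≤ ‖p n‖ * (Fintype.card ι * M) ^ n := by
  refine ContinuousMultilinearMap.opNorm_le_bound (by positivity) fun w => ?_
  have h1 : ∀ i : Fin n → ι, ‖p n (fun k => e (i k)) • (List.ofFn fun k => w k (i k)).prod‖
      ≤ ‖p n‖ * M ^ n * ∏ k, ‖w k‖ := by
    intro i
    rw [norm_smul]
    have a1 : ‖p n (fun k => e (i k))‖ ≤ ‖p n‖ * M ^ n := by
      refine (ContinuousMultilinearMap.le_opNorm _ _).trans ?_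
      gcongr
      calc ∏ k, ‖e (i k)‖ ≤ ∏ k : Fin n, M := Finset.prod_le_prod (fun _ _ => norm_nonneg _) (fun k _ => hM _)
        _ = M ^ n := by simp
    have a2 : ‖(List.ofFn fun k => w k (i k)).prod‖ ≤ ∏ k, ‖w k‖ := by
      refine (List.norm_prod_le _).trans ?_
      rw [List.map_ofFn, List.prod_ofFn]
      exact Finset.prod_le_prod (fun _ _ => norm_nonneg _) (fun k _ => norm_le_pi_norm (w k) (i k))
    exact mul_le_mul a1 a2 (norm_nonneg _) (by positivity)
  have h2 : ext p e 𝔸 n w = ∑ i : Fin n → ι, p n (fun k => e (i k)) • (List.ofFn fun k => w k (i k)).prod := by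
    simp [ext]
  rw [h2]
  refine (norm_sum_le_of_le _ (fun i _ => h1 i)).trans (le_of_eq ?_)
  simp [mul_pow]; ring

theorem ext_radius (p : FormalMultilinearSeries ℝ E ℝ) (hp : 0 < p.radius) (e : ι → E) :
    0 < (ext p e 𝔸).radius := by
  obtain ⟨r, hr0, hr⟩ := ENNReal.lt_iff_exists_nnreal_btwn.1 hp
  obtain ⟨C, hC, hb⟩ := p.norm_mul_pow_le_of_lt_radius hr
  have hr0' : 0 < r := by exact_mod_cast hr0
  let M : NNReal := 1 + ∑ i, ‖e i‖₊
  have hM : ∀ i, ‖e i‖ ≤ (M:ℝ) := by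
    intro i
    have := Finset.single_le_sum (f := fun i => ‖e i‖) (fun _ _ => norm_nonneg _) (Finset.mem_univ i)
    simp only [M]; push_cast; linarith
  have hM1 : 0 < M := by simp only [M]; positivity
  let r' : NNReal := r / ((Fintype.card ι + 1) * M)
  have hr' : 0 < r' := by simp only [r']; positivity
  refine lt_of_lt_of_le (by exact_mod_cast hr') ((ext p e 𝔸).le_radius_of_bound (r := r') C fun n => ?_)
  calc ‖ext p e 𝔸 n‖ * (r':ℝ) ^ n ≤ (‖p n‖ * (Fintype.card ι * M) ^ n) * (r':ℝ)^n := by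
        gcongr; exact ext_norm_le p e hM (by positivity) n
    _ ≤ (‖p n‖ * ((Fintype.card ι + 1) * M) ^ n) * (r':ℝ)^n := by
        gcongr; linarith
    _ = ‖p n‖ * r ^ n := by
        rw [mul_assoc, ← mul_pow]; congr 2
        simp only [r']; push_cast
        have : (0:ℝ) < M := by exact_mod_cast hM1
        field_simp
    _ ≤ C := hb n

theorem multi_eval (p : FormalMultilinearSeries ℝ E ℝ) (e : ι → E) (n : ℕ) (x : ι → ℝ) :
    p n (fun _ => ∑ i, x i • e i) = ∑ i : Fin n → ι, p n (fun k => e (i k)) * ∏ k, x (i k) := by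
  classical
  have := (p n).toMultilinearMap.map_sum (fun (_ : Fin n) (i : ι) => x i • e i)
  simp only [ContinuousMultilinearMap.coe_coe] at this
  rw [this]
  refine Finset.sum_congr rfl fun i _ => ?_
  rw [ContinuousMultilinearMap.map_smul_univ, smul_eq_mul, mul_comm]

variable {B : Type} [NormedAddCommGroup B] [NormedSpace ℝ B]

theorem word_eval (w : ι → B →L[ℝ] B) (ev : B →L[ℝ] ℝ) (x : ι → ℝ)
    (hw : ∀ i b, ev (w i b) = x i * ev b) : ∀ (n : ℕ) (i : Fin n → ι) (a : B),
    ev ((List.ofFn fun k => w (i k)).prod a) = (∏ k, x (i k)) * ev a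
  | 0, i, a => by simp
  | n+1, i, a => by
    rw [List.ofFn_succ, List.prod_cons, mul_apply_eq_comp, hw,
      word_eval w ev x hw n (fun k => i k.succ) a, Fin.prod_univ_succ]; ring

theorem ext_eval [CompleteSpace B] [Nontrivial B] (p : FormalMultilinearSeries ℝ E ℝ) (e : ι → E)
    (w : ι → B →L[ℝ] B) (ev : B →L[ℝ] ℝ)
    (x : ι → ℝ) (hw : ∀ i b, ev (w i b) = x i * ev b) (hp : 0 < p.radius)
    (hwr : w ∈ Metric.eball (0 : ι → B →L[ℝ] B) (ext p e (B →L[ℝ] B)).radius) (y : ℝ)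
    (hy : HasSum (fun n => p n (fun _ => ∑ i, x i • e i)) y) (a : B) :
    ev ((ext p e (B →L[ℝ] B)).sum w a) = y * ev a := by
  have h1 := (ext p e (B →L[ℝ] B)).hasSum hwr
  let Λ : (B →L[ℝ] B) →L[ℝ] ℝ := ev.comp (ContinuousLinearMap.apply ℝ B a)
  have h2 := Λ.hasSum h1
  have h3 := hy.mul_right (ev a)
  have h4 : (fun n => p n (fun _ => ∑ i, x i • e i) * ev a) =
    fun n => Λ (ext p e (B →L[ℝ] B) n fun _ => w) := by
   funext n
   rw [multi_eval, ext_apply, map_sum, Finset.sum_mul]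
   refine Finset.sum_congr rfl fun i _ => ?_
   rw [map_smul]
   simp only [Λ, ContinuousLinearMap.comp_apply, ContinuousLinearMap.apply_apply, smul_eq_mul]
   rw [word_eval w ev x hw]; ring
  rw [h4] at h3
  exact h2.unique h3
end Ext
end LojQE

open scoped Topology
open Set

namespace LojQE
set_option linter.unusedSectionVars false
set_option linter.unusedVariables false
section Shift
open BoundedContinuousFunction

abbrev BB := BoundedContinuousFunction ℕ ℝ

noncomputable def shS : BB →L[ℝ] BB :=
  LinearMap.mkContinuous
    { toFun := fun a => BoundedContinuousFunction.ofNormedAddCommGroupDiscrete (fun n => a (n+1)) ‖a‖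
        (fun n => a.norm_coe_le_norm _)
      map_add' := fun a b => by ext n; simp
      map_smul' := fun c a => by ext n; simp } 1 (fun a => by
        rw [one_mul]
        exact BoundedContinuousFunction.norm_ofNormedAddCommGroup_le _ (norm_nonneg _) (fun n => a.norm_coe_le_norm _))

noncomputable def shT : BB →L[ℝ] BB :=
  LinearMap.mkContinuous
    { toFun := fun a => BoundedContinuousFunction.ofNormedAddCommGroupDiscrete
        (fun n => if n = 0 then 0 else a (n-1)) ‖a‖
        (fun n => by
          split_ifs
          · simp
          · exact a.norm_coe_le_norm _)
      map_add' := fun a b => by ext n; by_cases h : n = 0 <;> simp [h]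
      map_smul' := fun c a => by ext n; by_cases h : n = 0 <;> simp [h] } 1 (fun a => by
        rw [one_mul]
        refine BoundedContinuousFunction.norm_ofNormedAddCommGroup_le _ (norm_nonneg _) (fun n => ?_)
        split_ifs
        · simp
        · exact a.norm_coe_le_norm _)

noncomputable def vac : BB := BoundedContinuousFunction.ofNormedAddCommGroupDiscrete
        (fun n => if n = 0 then 1 else 0) 1 (fun n => by split_ifs <;> simp)

noncomputable def e0 : BB →L[ℝ] ℝ := BoundedContinuousFunction.evalCLM ℝ 0

@[simp] theorem shS_apply (a : BB) (n : ℕ) : shS a n = a (n+1) := rfl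
theorem shT_apply (a : BB) (n : ℕ) : shT a n = if n = 0 then 0 else a (n-1) := rfl
theorem vac_apply (n : ℕ) : vac n = if n = 0 then 1 else 0 := rfl
@[simp] theorem e0_apply (a : BB) : e0 a = a 0 := rfl

theorem norm_shS : ‖shS‖ ≤ 1 := LinearMap.mkContinuous_norm_le _ zero_le_one _
theorem norm_shT : ‖shT‖ ≤ 1 := LinearMap.mkContinuous_norm_le _ zero_le_one _

theorem shS_shT : shS * shT = 1 := by
  ext a n; simp [shT_apply]

theorem e0_shT (a : BB) : e0 (shT a) = 0 := by simp [shT_apply]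

theorem shS_vac : shS vac = 0 := by ext n; simp [vac_apply]
theorem e0_vac : e0 vac = 1 := by simp [vac_apply]

theorem shT_shS (a : BB) : a = shT (shS a) + e0 a • vac := by
  ext n; by_cases h : n = 0
  · simp [h, shT_apply, vac_apply]
  · simp [h, shT_apply, vac_apply, Nat.sub_add_cancel (Nat.pos_of_ne_zero h)]

instance : Nontrivial BB := ⟨vac, 0, fun h => by simpa [h] using e0_vac⟩

structure Sh (B : Type) [NormedAddCommGroup B] [NormedSpace ℝ B] where
  S : B →L[ℝ] B
  T : B →L[ℝ] B
  vac : B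
  e0 : B →L[ℝ] ℝ
  nS : ‖S‖ ≤ 1
  nT : ‖T‖ ≤ 1
  ST : S * T = 1
  e0T : ∀ a, e0 (T a) = 0
  Sv : S vac = 0
  e0v : e0 vac = 1
  TS : ∀ a, a = T (S a) + e0 a • vac

noncomputable def shBB : Sh BB := ⟨shS, shT, vac, e0, norm_shS, norm_shT, shS_shT, e0_shT, shS_vac, e0_vac, shT_shS⟩

end Shift

namespace Sh
variable {B : Type} [NormedAddCommGroup B] [NormedSpace ℝ B] [CompleteSpace B] (H : Sh B)

noncomputable def evs (s : ℝ) : B →L[ℝ] ℝ := H.e0.comp (Ring.inverse (1 - s • H.S))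

theorem isUnit_one_sub {s : ℝ} (hs : |s| < 1) : IsUnit (1 - s • H.S) :=
  isUnit_one_sub_of_norm_lt_one (by
    rw [norm_smul]
    calc ‖s‖ * ‖H.S‖ ≤ ‖s‖ * 1 := by gcongr; exact H.nS
      _ < 1 := by simpa using hs)

theorem inv_apply {s : ℝ} (hs : |s| < 1) (a : B) : Ring.inverse (1 - s • H.S) (a - s • H.S a) = a := by
  have := Ring.inverse_mul_cancel _ (H.isUnit_one_sub hs)
  simpa using congrArg (fun L : B →L[ℝ] B => L a) this

theorem evs_T {s : ℝ} (hs : |s| < 1) (a : B) : H.evs s (H.T a) = s * H.evs s a := by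
  have h := H.inv_apply hs (H.T a)
  have h2 : H.S (H.T a) = a := congrArg (fun L : B →L[ℝ] B => L a) H.ST
  rw [h2, map_sub, map_smul] at h
  have h3 := congrArg H.e0 h
  rw [H.e0T, map_sub, map_smul, sub_eq_zero] at h3
  exact h3

theorem evs_vac {s : ℝ} (hs : |s| < 1) : H.evs s H.vac = 1 := by
  have h := H.inv_apply hs H.vac
  rw [H.Sv, smul_zero, sub_zero] at h
  simp only [evs, ContinuousLinearMap.comp_apply, h, H.e0v]

theorem evs_rem {s : ℝ} (hs : |s| < 1) : ∀ (d : ℕ) (a : B), (H.S ^ d) a = 0 →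
    H.evs s a = ∑ k : Fin d, H.e0 ((H.S ^ (k:ℕ)) a) * s ^ (k:ℕ)
  | 0, a, h => by simp at h; simp [h]
  | d+1, a, h => by
    have h' : (H.S ^ d) (H.S a) = 0 := by rw [pow_succ] at h; exact h
    have ih := evs_rem hs d (H.S a) h'
    conv_lhs => rw [H.TS a]
    rw [map_add, map_smul, H.evs_vac hs, H.evs_T hs, ih, Fin.sum_univ_succ, Finset.mul_sum]
    simp only [Fin.val_zero, pow_zero, Fin.val_succ, pow_succ, mul_apply_eq_comp]
    simp only [smul_eq_mul, mul_one, one_apply_eq_self]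
    rw [add_comm]; congr 1
    exact Finset.sum_congr rfl fun k _ => by ring

theorem evs_analytic : AnalyticAt ℝ (fun s : ℝ => Ring.inverse (1 - s • H.S)) 0 := by
  have h : AnalyticAt ℝ (Ring.inverse : (B →L[ℝ] B) → (B →L[ℝ] B)) (1 - (0:ℝ) • H.S) := by
    simpa using analyticAt_inverse (𝕜 := ℝ) (1 : (B →L[ℝ] B)ˣ)
  exact h.comp (f := fun s : ℝ => 1 - s • H.S)
    (analyticAt_const.sub (analyticAt_id.smul analyticAt_const))
end Sh
end LojQE

open scoped Topology
open Set

namespace LojQE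
set_option linter.unusedSectionVars false
set_option linter.unusedVariables false
section Div
variable {B : Type} [NormedAddCommGroup B] [NormedSpace ℝ B] [CompleteSpace B] [Nontrivial B] (H : Sh B)
variable {Z : Type} [NormedAddCommGroup Z] [NormedSpace ℝ Z] [FiniteDimensional ℝ Z]

noncomputable def eb (Z : Type) [NormedAddCommGroup Z] [NormedSpace ℝ Z] [FiniteDimensional ℝ Z] :
    Option (Fin (Module.finrank ℝ Z)) → Z × ℝ
  | none => (0, 1)
  | some j => (Module.finBasis ℝ Z j, 0)

noncomputable def wop (ρ : ℝ) (z0 z : Z) : Option (Fin (Module.finrank ℝ Z)) → (B →L[ℝ] B)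
  | none => ρ • H.T
  | some j => ((Module.finBasis ℝ Z).equivFunL (z - z0) j) • 1

noncomputable def xop (ρ s : ℝ) (z0 z : Z) : Option (Fin (Module.finrank ℝ Z)) → ℝ
  | none => ρ * s
  | some j => ((Module.finBasis ℝ Z).equivFunL (z - z0) j)

noncomputable def Fop (p : FormalMultilinearSeries ℝ (Z × ℝ) ℝ) (ρ : ℝ) (z0 z : Z) : B →L[ℝ] B :=
  (ext p (eb Z) (B →L[ℝ] B)).sum (wop H ρ z0 z)

theorem xop_sum (ρ s : ℝ) (z0 z : Z) : ∑ i, xop ρ s z0 z i • eb Z i = (z - z0, ρ * s) := by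
  rw [Fintype.sum_option]
  simp only [xop, eb]
  have h1 := (Module.finBasis ℝ Z).sum_equivFun (z - z0)
  ext
  · simpa [Prod.fst_sum] using h1
  · simp [Prod.snd_sum]

theorem wop_ev {ρ s : ℝ} (hs : |s| < 1) (z0 z : Z) (i) (b : B) :
    H.evs s (wop H ρ z0 z i b) = xop ρ s z0 z i * H.evs s b := by
  cases i with
  | none => simp only [wop, xop, smul_apply, map_smul, H.evs_T hs, smul_eq_mul]; ring
  | some j => simp [wop, xop]

theorem wop_z0_norm {ρ : ℝ} (hρ : 0 < ρ) (z0 : Z) : ‖wop H ρ z0 z0‖ ≤ ρ := by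
  rw [pi_norm_le_iff_of_nonneg hρ.le]
  intro i
  cases i with
  | none =>
    simp only [wop, norm_smul]
    calc ‖ρ‖ * ‖H.T‖ ≤ ‖ρ‖ * 1 := by gcongr; exact H.nT
      _ = ρ := by simp [abs_of_pos hρ]
  | some j => simp [wop, hρ.le]

theorem wop_analytic (ρ : ℝ) (z0 z : Z) : AnalyticAt ℝ (wop H ρ z0) z := by
  rw [analyticAt_pi_iff]
  intro i
  cases i with
  | none => exact analyticAt_const
  | some j =>
    refine AnalyticAt.smul (f := fun z => (Module.finBasis ℝ Z).equivFunL (z - z0) j)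
      (g := fun _ => (1 : B →L[ℝ] B)) ?_ analyticAt_const
    have h1 : AnalyticAt ℝ ((Module.finBasis ℝ Z).equivFunL : Z → (Fin (Module.finrank ℝ Z) → ℝ)) (z - z0) :=
      ContinuousLinearEquiv.analyticAt _ _
    have h2 := h1.comp (f := fun z : Z => z - z0) (analyticAt_id.sub analyticAt_const)
    exact (analyticAt_pi_iff.1 h2) j

theorem Fop_props {f : Z × ℝ → ℝ} {p : FormalMultilinearSeries ℝ (Z × ℝ) ℝ} {z0 : Z}
    (hf : HasFPowerSeriesAt f p (z0, 0)) : ∃ ρ0 > 0, ∀ ρ, 0 < ρ → ρ < ρ0 →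
      AnalyticAt ℝ (Fop H p ρ z0) z0 ∧
      (∀ᶠ z in 𝓝 z0, ∀ s, |s| < 1 → ∀ a, H.evs s (Fop H p ρ z0 z a) = f (z, ρ * s) * H.evs s a) ∧
      HasSum (fun n => (p n (fun _ => ((0:Z), (1:ℝ))) * ρ ^ n) • H.T ^ n) (Fop H p ρ z0 z0) := by
  obtain ⟨r, hr⟩ := hf
  have hpr : 0 < p.radius := hr.r_pos.trans_le hr.r_le
  have her := ext_radius (𝔸 := B →L[ℝ] B) p hpr (eb Z)
  obtain ⟨r1, h10, h11⟩ := ENNReal.lt_iff_exists_nnreal_btwn.1 (lt_min hr.r_pos her)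
  have h10' : (0:ℝ) < r1 := by exact_mod_cast h10
  refine ⟨r1, h10', fun ρ hρ hρ1 => ?_⟩
  have hball0 : wop H ρ z0 z0 ∈ Metric.eball (0 : Option (Fin (Module.finrank ℝ Z)) → B →L[ℝ] B) (ext p (eb Z) (B →L[ℝ] B)).radius := by
    refine Metric.eball_subset_eball (h11.le.trans (min_le_right _ _)) ?_
    rw [Metric.eball_coe]
    simp only [Metric.mem_ball, dist_zero_right]
    exact (wop_z0_norm H hρ z0).trans_lt hρ1
  have hcont : ContinuousAt (wop H ρ z0) z0 := (wop_analytic H ρ z0 z0).continuousAt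
  have hball : ∀ᶠ z in 𝓝 z0, wop H ρ z0 z ∈
      Metric.eball (0 : Option (Fin (Module.finrank ℝ Z)) → B →L[ℝ] B) (ext p (eb Z) (B →L[ℝ] B)).radius :=
    hcont (Metric.isOpen_eball.mem_nhds hball0)
  refine ⟨?_, ?_, ?_⟩
  · have h1 := ((ext p (eb Z) (B →L[ℝ] B)).hasFPowerSeriesOnBall her).analyticAt_of_mem hball0
    exact h1.comp (wop_analytic H ρ z0 z0)
  · filter_upwards [hball, Metric.ball_mem_nhds z0 h10'] with z hz hz2 s hs a
    refine ext_eval p (eb Z) _ (H.evs s) (xop ρ s z0 z) (wop_ev H hs z0 z) hpr hz _ ?_ a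
    rw [xop_sum]
    have := hr.hasSum (y := (z - z0, ρ * s)) ?_
    · simpa using this
    · refine Metric.eball_subset_eball (h11.le.trans (min_le_left _ _)) ?_
      rw [Metric.eball_coe]
      simp only [Metric.mem_ball, dist_zero_right, Prod.norm_def]
      refine max_lt (by simpa [dist_eq_norm] using hz2) ?_
      rw [Real.norm_eq_abs, abs_mul, abs_of_pos hρ]
      nlinarith [abs_nonneg s]
  · have h1 := (ext p (eb Z) (B →L[ℝ] B)).hasSum hball0
    suffices e : (fun n => (p n (fun _ => ((0:Z), (1:ℝ))) * ρ ^ n) • H.T ^ n) =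
        fun n => ext p (eb Z) (B →L[ℝ] B) n fun _ => wop H ρ z0 z0 by
      rw [e]; exact h1
    funext n
    rw [ext_apply, Finset.sum_eq_single (fun _ => none)]
    · simp only [wop, eb, List.ofFn_const, List.prod_replicate, smul_pow, smul_smul]
    · intro i _ hi
      obtain ⟨k, hk⟩ : ∃ k, i k ≠ none := by
        by_contra hcon; push Not at hcon; exact hi (funext hcon)
      obtain ⟨j, hj⟩ := Option.ne_none_iff_exists'.1 hk
      rw [List.prod_eq_zero, smul_zero]
      rw [List.mem_ofFn]
      exact ⟨k, by simp [hj, wop]⟩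
    · simp

theorem unit_small {𝔸 : Type} [NormedRing 𝔸] [NormedAlgebra ℝ 𝔸] [CompleteSpace 𝔸] [NormOneClass 𝔸] {S T : 𝔸} (hST : S * T = 1)
    (hT : ‖T‖ ≤ 1) {c : ℕ → ℝ} {d : ℕ} (hc : ∀ n < d, c n = 0) (hd : c d ≠ 0) {C r : ℝ} (hr : 0 < r)
    (hb : ∀ n, |c n| * r ^ n ≤ C) : ∃ ρ0 > 0, ∀ ρ, 0 < ρ → ρ < ρ0 → ∀ F : 𝔸,
      HasSum (fun n => (c n * ρ ^ n) • T ^ n) F → IsUnit (S ^ d * F) := by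
  have hC : 0 ≤ C := (mul_nonneg (abs_nonneg _) (by positivity)).trans (hb 0)
  have hcd : 0 < |c d| := abs_pos.2 hd
  have hSd : ∀ d : ℕ, S ^ d * T ^ d = 1 := by
    intro d
    induction d with
    | zero => simp
    | succ d ih => rw [pow_succ, pow_succ', mul_assoc, ← mul_assoc S, hST, one_mul, ih]
  have hTn : ∀ n : ℕ, ‖T ^ n‖ ≤ 1 := fun n => (norm_pow_le _ _).trans (pow_le_one₀ (norm_nonneg _) hT)
  set K := C / r ^ d with hK
  have hK0 : 0 ≤ K := by positivity
  refine ⟨min (r/2) (r * |c d| / (2 * K + 1)), by positivity, fun ρ hρ hρ1 F hF => ?_⟩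
  have hρr : ρ < r / 2 := hρ1.trans_le (min_le_left _ _)
  have hρc : ρ * (2 * K + 1) < r * |c d| := by
    have := hρ1.trans_le (min_le_right _ _)
    rwa [lt_div_iff₀ (by positivity)] at this
  have h1 : HasSum (fun n => (c (n+d) * ρ ^ (n+d)) • T ^ (n + d)) F := by
    have := (hasSum_nat_add_iff' (f := fun n => (c n * ρ ^ n) • T ^ n) d).2 hF
    rwa [Finset.sum_eq_zero (fun i hi => by rw [hc i (Finset.mem_range.1 hi)]; simp), sub_zero] at this
  have h2 : HasSum (fun n => (c (n+d) * ρ ^ (n+d)) • T ^ n) (S ^ d * F) := by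
    have := h1.mul_left (S ^ d)
    suffices e : (fun n => (c (n+d) * ρ ^ (n+d)) • T ^ n) = fun n => S ^ d * (c (n + d) * ρ ^ (n + d)) • T ^ (n + d) by
      rw [e]; exact this
    funext n
    rw [mul_smul_comm, add_comm n d, pow_add T, ← mul_assoc, hSd, one_mul]
  have h3 : HasSum (fun n => (c (n+1+d) * ρ ^ (n+1+d)) • T ^ (n+1)) (S ^ d * F - (c d * ρ ^ d) • 1) := by
    have := (hasSum_nat_add_iff' (f := fun n => (c (n+d) * ρ ^ (n+d)) • T ^ n) 1).2 h2
    simpa using this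
  have h4 : ‖S ^ d * F - (c d * ρ ^ d) • (1 : 𝔸)‖ ≤ ρ ^ d * K * (ρ / r) * 2 := by
    have hg : HasSum (fun n : ℕ => ρ ^ d * K * (ρ/r) * (1/2:ℝ) ^ n) (ρ ^ d * K * (ρ / r) * 2) := by
      exact hasSum_geometric_two.mul_left _
    rw [← h3.tsum_eq]
    refine tsum_of_norm_bounded hg fun n => ?_
    rw [norm_smul]
    have e1 : ‖c (n+1+d) * ρ ^ (n+1+d)‖ ≤ ρ ^ d * K * (ρ/r) * (1/2:ℝ) ^ n := by
      rw [norm_mul, Real.norm_eq_abs, Real.norm_of_nonneg (by positivity)]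
      have e2 : |c (n+1+d)| ≤ C / r ^ (n+1+d) := by
        rw [le_div_iff₀ (by positivity)]; exact hb _
      have e3 : (ρ / r) ^ n ≤ (1/2) ^ n := by
        apply pow_le_pow_left₀ (by positivity)
        rw [div_le_iff₀ hr]; linarith
      calc |c (n+1+d)| * ρ ^ (n+1+d) ≤ C / r ^ (n+1+d) * ρ ^ (n+1+d) := by gcongr
        _ = ρ ^ d * K * (ρ/r) * (ρ/r) ^ n := by
            rw [hK, div_pow, pow_add, pow_add, pow_add, pow_add]; field_simp
        _ ≤ _ := by gcongr
    calc _ ≤ ρ ^ d * K * (ρ/r) * (1/2:ℝ) ^ n * 1 := mul_le_mul e1 (hTn _) (norm_nonneg _) (by positivity)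
      _ = _ := mul_one _
  have hcd' : c d * ρ ^ d ≠ 0 := mul_ne_zero hd (by positivity)
  have h5 : IsUnit (1 - (-(c d * ρ ^ d)⁻¹) • (S ^ d * F - (c d * ρ ^ d) • (1 : 𝔸))) := by
    refine isUnit_one_sub_of_norm_lt_one ?_
    rw [norm_smul, norm_neg, norm_inv, norm_mul, Real.norm_eq_abs, Real.norm_of_nonneg (by positivity)]
    rw [inv_mul_lt_iff₀ (by positivity), mul_one]
    refine h4.trans_lt ?_
    have : ρ / r * (2 * K) < |c d| := by
      rw [div_mul_eq_mul_div, div_lt_iff₀ hr]; nlinarith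
    calc ρ ^ d * K * (ρ / r) * 2 = ρ ^ d * (ρ / r * (2 * K)) := by ring
      _ < ρ ^ d * |c d| := by gcongr
      _ = _ := by ring
  have h6 : S ^ d * F = (c d * ρ ^ d) • (1 - (-(c d * ρ ^ d)⁻¹) • (S ^ d * F - (c d * ρ ^ d) • (1 : 𝔸))) := by
    rw [neg_smul, sub_neg_eq_add, smul_add, smul_smul, mul_inv_cancel₀ hcd', one_smul]; abel
  rw [h6]
  exact h5.smul (Units.mk0 _ hcd')
end Div
end LojQE

open scoped Topology
open Set

namespace LojQE
set_option linter.unusedSectionVars false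
set_option linter.unusedVariables false
section Div
variable {Z : Type} [NormedAddCommGroup Z] [NormedSpace ℝ Z] [FiniteDimensional ℝ Z]

theorem ana_apply {X F G : Type} [NormedAddCommGroup X] [NormedSpace ℝ X] [NormedAddCommGroup F] [NormedSpace ℝ F]
    [NormedAddCommGroup G] [NormedSpace ℝ G] {L : X → F →L[ℝ] G} {v : X → F} {x : X}
    (hL : AnalyticAt ℝ L x) (hv : AnalyticAt ℝ v x) : AnalyticAt ℝ (fun y => L y (v y)) x := by
  have h1 := ContinuousLinearMap.analyticAt_bilinear (𝕜 := ℝ) (ContinuousLinearMap.id ℝ (F →L[ℝ] G)) (L x, v x)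
  exact h1.comp (f := fun y => (L y, v y)) (hL.prod hv)

theorem wdiv_fin {B : Type} [NormedAddCommGroup B] [NormedSpace ℝ B] [CompleteSpace B] [Nontrivial B] (K : Sh B)
    (d : ℕ) {ρ : ℝ} (hρ : 0 < ρ) {z0 : Z} {h f : Z × ℝ → ℝ} {HH FF : Z → B →L[ℝ] B}
    (a1 : AnalyticAt ℝ HH z0)
    (b1 : ∀ᶠ z in 𝓝 z0, ∀ s, |s| < 1 → ∀ a, K.evs s (HH z a) = h (z, ρ * s) * K.evs s a)
    (a2 : AnalyticAt ℝ FF z0)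
    (b2 : ∀ᶠ z in 𝓝 z0, ∀ s, |s| < 1 → ∀ a, K.evs s (FF z a) = f (z, ρ * s) * K.evs s a)
    (hU : IsUnit (K.S ^ d * HH z0)) : ∃ (q : Z × ℝ → ℝ) (r : Fin d → Z → ℝ),
        AnalyticAt ℝ q (z0, 0) ∧ (∀ k, AnalyticAt ℝ (r k) z0) ∧
        ∀ᶠ w in 𝓝 (z0, (0:ℝ)), f w = q w * h w + ∑ k : Fin d, r k w.1 * w.2 ^ (k:ℕ) := by
  have hL : AnalyticAt ℝ (fun z => K.S ^ d * HH z) z0 := analyticAt_const.mul a1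
  have hLi : AnalyticAt ℝ (fun z => Ring.inverse (K.S ^ d * HH z)) z0 := by
    obtain ⟨U, hU'⟩ := hU
    refine AnalyticAt.comp (g := Ring.inverse) (f := fun z => K.S ^ d * HH z) ?_ hL
    have := analyticAt_inverse (𝕜 := ℝ) U
    rwa [hU'] at this
  have hLu : ∀ᶠ z in 𝓝 z0, IsUnit (K.S ^ d * HH z) :=
    hL.continuousAt (Units.isOpen.mem_nhds hU)
  let qv : Z → B := fun z => Ring.inverse (K.S ^ d * HH z) ((K.S ^ d) (FF z K.vac))
  have hF1 : AnalyticAt ℝ (fun z => FF z K.vac) z0 := ana_apply a2 analyticAt_const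
  have hq : AnalyticAt ℝ qv z0 := ana_apply hLi (ana_apply analyticAt_const hF1)
  let rv : Z → B := fun z => FF z K.vac - HH z (qv z)
  have hr : AnalyticAt ℝ rv z0 := hF1.sub (ana_apply a1 hq)
  refine ⟨fun w => K.evs (w.2 / ρ) (qv w.1), fun k z => K.e0 ((K.S ^ (k:ℕ)) (rv z)) / ρ ^ (k:ℕ), ?_, ?_, ?_⟩
  · have h1 : AnalyticAt ℝ (fun w : Z × ℝ => Ring.inverse (1 - (w.2 / ρ) • K.S)) (z0, 0) := by
      have h2 : AnalyticAt ℝ (fun w : Z × ℝ => w.2 / ρ) (z0, 0) := analyticAt_snd.div_const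
      refine AnalyticAt.comp (g := fun s : ℝ => Ring.inverse (1 - s • K.S)) (f := fun w : Z × ℝ => w.2 / ρ) ?_ h2
      simpa using K.evs_analytic
    have h3 : AnalyticAt ℝ (fun w : Z × ℝ => qv w.1) (z0, 0) :=
      AnalyticAt.comp (g := qv) (f := fun w : Z × ℝ => w.1) hq analyticAt_fst
    have h4 := ana_apply (analyticAt_const (v := K.e0)) (ana_apply h1 h3)
    exact h4
  · intro k
    exact (ana_apply analyticAt_const (ana_apply analyticAt_const hr)).div_const
  · have hs : ∀ᶠ w in 𝓝 (z0, (0:ℝ)), |w.2 / ρ| < 1 := by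
      have : ContinuousAt (fun w : Z × ℝ => |w.2 / ρ|) (z0, 0) := by fun_prop
      refine this.eventually_lt continuousAt_const ?_
      simp
    have hfst : Filter.Tendsto Prod.fst (𝓝 (z0, (0:ℝ))) (𝓝 z0) := continuousAt_fst
    filter_upwards [hs, hfst.eventually b1, hfst.eventually b2, hfst.eventually hLu] with w hs h1 h2 hu
    have e1 := h2 _ hs K.vac
    rw [K.evs_vac hs, mul_one, mul_div_cancel₀ _ hρ.ne'] at e1
    have e2 := h1 _ hs (qv w.1)
    rw [mul_div_cancel₀ _ hρ.ne'] at e2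
    have e3 : (K.S ^ d) (rv w.1) = 0 := by
      simp only [rv, map_sub, qv]
      have := Ring.mul_inverse_cancel _ hu
      have := congrArg (fun L : B →L[ℝ] B => L ((K.S ^ d) (FF w.1 K.vac))) this
      simp only [mul_apply_eq_comp, one_apply_eq_self] at this
      rw [this, sub_self]
    have e4 := K.evs_rem hs d _ e3
    have e5 : K.evs (w.2 / ρ) (rv w.1) = K.evs (w.2/ρ) (FF w.1 K.vac) - K.evs (w.2/ρ) (HH w.1 (qv w.1)) := by
      simp only [rv, map_sub]
    rw [e1, e2, e4] at e5
    have e6 : ∑ k : Fin d, K.e0 ((K.S ^ (k:ℕ)) (rv w.1)) / ρ ^ (k:ℕ) * w.2 ^ (k:ℕ) =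
       ∑ k : Fin d, K.e0 ((K.S ^ (k:ℕ)) (rv w.1)) * (w.2 / ρ) ^ (k:ℕ) :=
      Finset.sum_congr rfl fun k _ => by rw [div_pow]; ring
    have e7 : (w.1, w.2) = w := rfl
    rw [e7] at e5
    simp only [e6, e5]; ring

theorem wdiv (z0 : Z) (h : Z × ℝ → ℝ) (hh : AnalyticAt ℝ h (z0, 0))
    (hne : ¬ ∀ᶠ t in 𝓝 (0:ℝ), h (z0, t) = 0) :
    ∃ d : ℕ, (∃ u : ℝ → ℝ, AnalyticAt ℝ u 0 ∧ ∀ t, h (z0, t) = t ^ d * u t) ∧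
      ∀ f : Z × ℝ → ℝ, AnalyticAt ℝ f (z0, 0) → ∃ (q : Z × ℝ → ℝ) (r : Fin d → Z → ℝ),
        AnalyticAt ℝ q (z0, 0) ∧ (∀ k, AnalyticAt ℝ (r k) z0) ∧
        ∀ᶠ w in 𝓝 (z0, (0:ℝ)), f w = q w * h w + ∑ k : Fin d, r k w.1 * w.2 ^ (k:ℕ) := by
  obtain ⟨p, hp⟩ := hh
  have hp1 : HasFPowerSeriesAt (fun w => h (w + (z0, 0))) p (0 : Z × ℝ) := by
    have := hp.comp_sub (-(z0, (0:ℝ)))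
    have e0 : (z0, (0:ℝ)) + -(z0, (0:ℝ)) = 0 := by simp
    rw [e0] at this
    refine this.congr (Filter.Eventually.of_forall fun t => ?_)
    simp only [sub_neg_eq_add]
  have hp2 : HasFPowerSeriesAt (fun t => h (z0, t))
      (p.compContinuousLinearMap (ContinuousLinearMap.inr ℝ Z ℝ)) 0 := by
    have := HasFPowerSeriesAt.compContinuousLinearMap (u := ContinuousLinearMap.inr ℝ Z ℝ) (x := 0)
      (f := fun w => h (w + (z0, 0))) (pf := p) (by rw [map_zero]; exact hp1)
    refine this.congr (Filter.Eventually.of_forall fun t => ?_)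
    simp
  set p1 := p.compContinuousLinearMap (ContinuousLinearMap.inr ℝ Z ℝ) with hp1def
  have hp10 : p1 ≠ 0 := fun h0 => hne (hp2.locally_zero_iff.2 h0)
  let c : ℕ → ℝ := fun n => p n (fun _ => ((0:Z), (1:ℝ)))
  have hcp : ∀ n, p1.coeff n = c n := by
    intro n; simp only [hp1def, FormalMultilinearSeries.coeff, FormalMultilinearSeries.compContinuousLinearMap_apply, c]
    congr 1
  set d := p1.order with hd
  have hc : ∀ n < d, c n = 0 := fun n hn => by
    rw [← hcp, FormalMultilinearSeries.coeff_eq_zero, FormalMultilinearSeries.apply_eq_zero_of_lt_order hn]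
  have hcd : c d ≠ 0 := by
    rw [← hcp, Ne, FormalMultilinearSeries.coeff_eq_zero]
    exact FormalMultilinearSeries.apply_order_ne_zero hp10
  refine ⟨d, ⟨_, ⟨_, hp2.has_fpower_series_iterate_dslope_fslope d⟩, fun t => ?_⟩, ?_⟩
  · have := hp2.eq_pow_order_mul_iterate_dslope t
    simpa using this
  intro f ⟨pf, hpf⟩
  obtain ⟨ρ1, hρ1, H1⟩ := Fop_props shBB hp
  obtain ⟨ρ2, hρ2, H2⟩ := Fop_props shBB hpf
  obtain ⟨r, hr0, hr⟩ := ENNReal.lt_iff_exists_nnreal_btwn.1 hp.radius_pos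
  obtain ⟨C, hC, hb⟩ := p.norm_mul_pow_le_of_lt_radius hr
  have hr0' : (0:ℝ) < r := by exact_mod_cast hr0
  have hcb : ∀ n, |c n| * (r:ℝ) ^ n ≤ C := by
    intro n
    refine le_trans ?_ (hb n)
    gcongr
    refine ((p n).le_opNorm _).trans (le_of_eq ?_)
    simp [Prod.norm_def]
  obtain ⟨ρ3, hρ3, H3⟩ := unit_small (S := shBB.S) (T := shBB.T) shBB.ST shBB.nT hc hcd hr0' hcb
  obtain ⟨ρ, hρ, hlt⟩ := exists_between (lt_min hρ1 (lt_min hρ2 hρ3))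
  obtain ⟨a1, b1, c1⟩ := H1 ρ hρ (hlt.trans_le (min_le_left _ _))
  obtain ⟨a2, b2, c2⟩ := H2 ρ hρ (hlt.trans_le ((min_le_right _ _).trans (min_le_left _ _)))
  have hU := H3 ρ hρ (hlt.trans_le ((min_le_right _ _).trans (min_le_right _ _))) _ c1
  generalize hHH : Fop shBB p ρ z0 = HH at a1 b1 hU
  generalize hFF : Fop shBB pf ρ z0 = FF at a2 b2
  clear c1 c2 H1 H2 H3 hHH hFF
  exact wdiv_fin shBB d hρ a1 b1 a2 b2 hU
end Div
end LojQE

open scoped Topology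
open Set

namespace LojQE
set_option linter.unusedSectionVars false
set_option linter.unusedVariables false
section Prep
open Polynomial in
theorem poly_order {P : ℝ[X]} (hP : P ≠ 0) {d : ℕ} (hd : P.natDegree ≤ d) {g : ℝ → ℝ}
    (hg : ContinuousAt g 0) (h : ∀ᶠ t in 𝓝 (0:ℝ), P.eval t = t ^ d * g t) : g 0 ≠ 0 := by
  intro hg0
  obtain ⟨R, hR, hnd⟩ := Polynomial.exists_eq_pow_rootMultiplicity_mul_and_not_dvd P hP 0
  set e := P.rootMultiplicity 0
  have hR0 : R.eval 0 ≠ 0 := fun h0 => hnd (Polynomial.dvd_iff_isRoot.2 h0)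
  have hRn : R ≠ 0 := by rintro rfl; simp at hR0
  have hed : e ≤ d := by
    rw [hR, natDegree_mul (pow_ne_zero _ (X_sub_C_ne_zero 0)) hRn] at hd
    simp at hd; omega
  have h1 : ∀ᶠ t in 𝓝[≠] (0:ℝ), R.eval t = t ^ (d - e) * g t := by
    filter_upwards [h.filter_mono nhdsWithin_le_nhds, self_mem_nhdsWithin] with t ht ht0
    have ht0' : t ≠ 0 := ht0
    rw [hR] at ht
    simp only [eval_mul, eval_pow, eval_sub, eval_X, eval_C, sub_zero] at ht
    have : t ^ d = t ^ e * t ^ (d - e) := by rw [← pow_add]; congr 1; omega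
    rw [this, mul_assoc] at ht
    exact mul_left_cancel₀ (pow_ne_zero e ht0') ht
  have h2 : Filter.Tendsto (fun t => R.eval t) (𝓝[≠] 0) (𝓝 (R.eval 0)) :=
    R.continuous.continuousAt.tendsto.mono_left nhdsWithin_le_nhds
  have h3 : Filter.Tendsto (fun t => t ^ (d-e) * g t) (𝓝[≠] 0) (𝓝 (0 ^ (d-e) * g 0)) :=
    (((continuousAt_id.pow (d-e)).mul hg).tendsto).mono_left nhdsWithin_le_nhds
  have h4 := tendsto_nhds_unique (h2.congr' h1) h3
  rw [hg0, mul_zero] at h4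
  exact hR0 h4

variable {Z : Type} [NormedAddCommGroup Z] [NormedSpace ℝ Z] [FiniteDimensional ℝ Z]

theorem wprep (z0 : Z) (h : Z × ℝ → ℝ) (hh : AnalyticAt ℝ h (z0, 0))
    (hne : ¬ ∀ᶠ t in 𝓝 (0:ℝ), h (z0, t) = 0) :
    ∃ (d : ℕ) (u : Z × ℝ → ℝ) (a : Fin (d+1) → Z → ℝ), AnalyticAt ℝ u (z0, 0) ∧ u (z0, 0) ≠ 0 ∧
      (∀ k, AnalyticAt ℝ (a k) z0) ∧
      ∀ᶠ w in 𝓝 (z0, (0:ℝ)), h w = u w * ∑ k : Fin (d+1), a k w.1 * w.2 ^ (k:ℕ) := by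
  obtain ⟨d, ⟨u, hu, hut⟩, hdiv⟩ := wdiv z0 h hh hne
  obtain ⟨q, r, hq, hr, he⟩ := hdiv (fun w => w.2 ^ d) (analyticAt_snd.pow d)
  have hline : Filter.Tendsto (fun t : ℝ => (z0, t)) (𝓝 0) (𝓝 (z0, 0)) := by
    have : Continuous (fun t : ℝ => (z0, t)) := by fun_prop
    exact this.tendsto 0
  have hq0 : q (z0, 0) ≠ 0 := by
    let P : Polynomial ℝ := Polynomial.X ^ d + -∑ k : Fin d, Polynomial.C (r k z0) * Polynomial.X ^ (k:ℕ)
    have hPm : P.Monic := by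
      apply Polynomial.monic_X_pow_add
      rw [Polynomial.degree_neg]
      refine (Polynomial.degree_sum_le _ _).trans_lt ?_
      rw [Finset.sup_lt_iff (WithBot.bot_lt_coe _)]
      intro k _
      exact (Polynomial.degree_C_mul_X_pow_le _ _).trans_lt (by exact_mod_cast k.2)
    have hdeg : P.natDegree ≤ d := by
      rw [Polynomial.natDegree_le_iff_degree_le]
      refine (Polynomial.degree_add_le _ _).trans (max_le (Polynomial.degree_X_pow_le d) ?_)
      rw [Polynomial.degree_neg]
      refine (Polynomial.degree_sum_le _ _).trans (Finset.sup_le fun k _ => ?_)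
      exact (Polynomial.degree_C_mul_X_pow_le _ _).trans (by exact_mod_cast k.2.le)
    have hc : ContinuousAt (fun t : ℝ => q (z0, t)) 0 := hq.continuousAt.tendsto.comp hline
    have := poly_order hPm.ne_zero hdeg (g := fun t => q (z0, t) * u t) (hc.mul hu.continuousAt) ?_
    · exact left_ne_zero_of_mul this
    · filter_upwards [hline.eventually he] with t ht
      simp only [P, Polynomial.eval_add, Polynomial.eval_pow, Polynomial.eval_X, Polynomial.eval_neg,
        Polynomial.eval_finset_sum, Polynomial.eval_mul, Polynomial.eval_C]
      simp only [hut] at ht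
      linear_combination ht
  refine ⟨d, fun w => (q w)⁻¹, Fin.snoc (fun k z => - r k z) (fun _ => 1), hq.inv hq0, inv_ne_zero hq0, ?_, ?_⟩
  · intro k
    refine Fin.lastCases ?_ (fun k => ?_) k
    · rw [Fin.snoc_last]; exact analyticAt_const
    · rw [Fin.snoc_castSucc (α := fun _ => Z → ℝ)]; exact (hr k).neg
  · filter_upwards [he, hq.continuousAt.eventually_ne hq0] with w hw hne
    rw [Fin.sum_univ_castSucc]
    simp only [Fin.snoc_castSucc (α := fun _ => Z → ℝ), Fin.snoc_last (α := fun _ => Z → ℝ), Fin.val_castSucc, Fin.val_last, one_mul]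
    rw [hw]
    simp only [neg_mul, Finset.sum_neg_distrib]
    field_simp
    ring
end Prep

section Dir
variable {E : Type} [NormedAddCommGroup E] [NormedSpace ℝ E]

theorem dense_ne {f : E → ℝ} {y0 : E} {R : ℝ} (hR : 0 < R) (hf : AnalyticOnNhd ℝ f (Metric.ball y0 R))
    (hne : ¬ ∀ᶠ y in 𝓝 y0, f y = 0) {O : Set E} (hO : IsOpen O) (hOn : O.Nonempty) (hOB : O ⊆ Metric.ball y0 R) :
    ∃ y ∈ O, f y ≠ 0 := by
  by_contra hcon
  push Not at hcon
  obtain ⟨y1, hy1⟩ := hOn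
  have h1 : f =ᶠ[𝓝 y1] 0 := by
    filter_upwards [hO.mem_nhds hy1] with y hy using hcon y hy
  have h2 := hf.eqOn_zero_of_preconnected_of_eventuallyEq_zero
    (convex_ball y0 R).isPreconnected (hOB hy1) h1
  exact hne (by filter_upwards [Metric.ball_mem_nhds y0 hR] with y hy using h2 hy)

theorem exists_direction [Nontrivial E] {ι : Type} [Finite ι] (f : ι → E → ℝ) (y0 : E)
    (hf : ∀ i, AnalyticAt ℝ (f i) y0) (hne : ∀ i, ¬ ∀ᶠ y in 𝓝 y0, f i y = 0) :
    ∃ e : E, e ≠ 0 ∧ ∀ i, ¬ ∀ᶠ t in 𝓝 (0:ℝ), f i (y0 + t • e) = 0 := by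
  have h1 : ∀ᶠ y in 𝓝 y0, ∀ i, AnalyticAt ℝ (f i) y :=
    Filter.eventually_all.2 fun i => (hf i).eventually_analyticAt
  obtain ⟨R, hR, hb⟩ := Metric.eventually_nhds_iff_ball.1 h1
  have hfB : ∀ i, AnalyticOnNhd ℝ (f i) (Metric.ball y0 R) := fun i y hy => hb y hy i
  have key : ∀ s : Set ι, s.Finite → ∃ O : Set E, IsOpen O ∧ O.Nonempty ∧ O ⊆ Metric.ball y0 R \ {y0} ∧
      ∀ i ∈ s, ∀ y ∈ O, f i y ≠ 0 := by
    intro s hs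
    induction s, hs using Set.Finite.induction_on with
    | empty =>
      refine ⟨Metric.ball y0 R \ {y0}, Metric.isOpen_ball.sdiff isClosed_singleton, ?_, subset_rfl, by simp⟩
      obtain ⟨v, hv⟩ := exists_ne (0 : E)
      have hv' : 0 < ‖v‖ := norm_pos_iff.2 hv
      refine ⟨y0 + (R / 2 / ‖v‖) • v, ?_, ?_⟩
      · simp [norm_smul, abs_of_pos hR, hv'.ne']; linarith
      · simp [hv, hR.ne']
    | insert ha hs ih =>
      rename_i a s
      obtain ⟨O, hO, hn, hOB, hO2⟩ := ih
      obtain ⟨y, hy, hfy⟩ := dense_ne hR (hfB a) (hne a) hO hn (hOB.trans diff_subset)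
      have hopen : IsOpen (O ∩ {y | f a y ≠ 0}) := by
        refine ContinuousOn.isOpen_inter_preimage (t := {0}ᶜ) (f := f a) ?_ hO isOpen_compl_singleton
        exact (hfB a).continuousOn.mono (hOB.trans diff_subset)
      refine ⟨_, hopen, ⟨y, hy, hfy⟩, inter_subset_left.trans hOB, ?_⟩
      intro i hi z hz
      rcases mem_insert_iff.1 hi with rfl | hi
      · exact hz.2
      · exact hO2 i hi z hz.1
  obtain ⟨O, hO, ⟨y1, hy1⟩, hOB, hO2⟩ := key univ finite_univ
  refine ⟨y1 - y0, sub_ne_zero.2 (fun h => (hOB hy1).2 h), fun i hev => ?_⟩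
  let g : ℝ → ℝ := fun t => f i (y0 + t • (y1 - y0))
  have hgA : AnalyticOnNhd ℝ g (Icc 0 1) := by
    intro t ht
    refine AnalyticAt.comp (g := f i) (f := fun t : ℝ => y0 + t • (y1 - y0)) ?_
      (analyticAt_const.add (analyticAt_id.smul analyticAt_const))
    apply hfB
    have h2 := (hOB hy1).1
    rw [mem_ball_iff_norm] at h2 ⊢
    rw [add_sub_cancel_left, norm_smul, Real.norm_eq_abs, abs_of_nonneg ht.1]
    nlinarith [norm_nonneg (y1 - y0), ht.1, ht.2]
  have h3 := hgA.eqOn_zero_of_preconnected_of_eventuallyEq_zero isPreconnected_Icc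
    (left_mem_Icc.2 zero_le_one) hev
  have h4 : g 1 = 0 := h3 (right_mem_Icc.2 zero_le_one)
  refine hO2 i (mem_univ i) y1 hy1 ?_
  simpa [g] using h4

theorem exists_split [FiniteDimensional ℝ E] (e : E) (he : e ≠ 0) :
    ∃ (E' : Submodule ℝ E) (Φ : (E' × ℝ) ≃L[ℝ] E), Module.finrank ℝ E' + 1 = Module.finrank ℝ E ∧
      ∀ v t, Φ (v, t) = v + t • e := by
  obtain ⟨φ, hφ⟩ := SeparatingDual.exists_eq_one (R := ℝ) he
  let E' : Submodule ℝ E := LinearMap.ker φ.toLinearMap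
  let Ψ : (E' × ℝ) ≃ₗ[ℝ] E :=
    { toFun := fun w => w.1 + w.2 • e
      map_add' := fun a b => by simp [add_smul]; abel
      map_smul' := fun c a => by simp [smul_add, smul_smul]
      invFun := fun x => (⟨x - φ x • e, by simp [E', hφ]⟩, φ x)
      left_inv := fun w => by
        have hw : φ w.1 = 0 := w.1.2
        ext <;> simp [hφ, hw]
      right_inv := fun x => by simp }
  refine ⟨E', Ψ.toContinuousLinearEquiv, ?_, fun v t => rfl⟩
  have := Ψ.finrank_eq
  rw [Module.finrank_prod, Module.finrank_self] at this
  exact this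
end Dir
end LojQE

open scoped Topology
open Set

namespace LojQE
set_option linter.unusedSectionVars false
set_option linter.unusedVariables false
section Good
variable {E : Type} [NormedAddCommGroup E] [NormedSpace ℝ E]

structure Good (y0 : E) (μ : (E → ℝ) → ℝ) : Prop where
  ana : ∀ (P : Type) [NormedAddCommGroup P] [NormedSpace ℝ P] (x0 : P) (F : P × E → ℝ),
    AnalyticAt ℝ F (x0, y0) → AnalyticAt ℝ (fun x => μ (fun y => F (x, y))) x0
  add : ∀ g g' : E → ℝ, AnalyticAt ℝ g y0 → AnalyticAt ℝ g' y0 → μ (fun y => g y + g' y) = μ g + μ g'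
  smul : ∀ (c : ℝ) (g : E → ℝ), AnalyticAt ℝ g y0 → μ (fun y => c * g y) = c * μ g
  congr : ∀ g g' : E → ℝ, g =ᶠ[𝓝 y0] g' → μ g = μ g'

theorem Good.zero {y0 : E} {μ : (E → ℝ) → ℝ} (h : Good y0 μ) : μ (fun _ => 0) = 0 := by
  simpa using h.smul 0 (fun _ => 0) analyticAt_const

theorem Good.sum {y0 : E} {μ : (E → ℝ) → ℝ} (h : Good y0 μ) {ι : Type} (s : Finset ι) (c : ι → ℝ)
    (g : ι → E → ℝ) (hg : ∀ i, AnalyticAt ℝ (g i) y0) :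
    μ (fun y => ∑ i ∈ s, c i * g i y) = ∑ i ∈ s, c i * μ (g i) := by
  classical
  induction s using Finset.induction_on with
  | empty => simpa using h.zero
  | insert a s ha ih =>
    simp only [Finset.sum_insert ha]
    rw [h.add (fun y => c a * g a y) (fun y => ∑ i ∈ s, c i * g i y) (analyticAt_const.mul (hg a))
      (Finset.analyticAt_fun_sum _ fun i _ => analyticAt_const.mul (hg i)), ih, h.smul _ _ (hg a)]

noncomputable def muF (y0 e : E) (k : ℕ) : (E → ℝ) → ℝ := fun g =>
  iteratedDeriv k (fun s : ℝ => g (y0 + s • e)) 0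

theorem pD_analytic {P : Type} [NormedAddCommGroup P] [NormedSpace ℝ P] {G : P × ℝ → ℝ} {w : P × ℝ}
    (hG : AnalyticAt ℝ G w) : AnalyticAt ℝ (fun w : P × ℝ => deriv (fun s => G (w.1, s)) w.2) w := by
  have h1 : AnalyticAt ℝ (fun w => fderiv ℝ G w (0, 1)) w := ana_apply hG.fderiv analyticAt_const
  refine h1.congr ?_
  filter_upwards [hG.eventually_analyticAt] with v hv
  have h2 : HasFDerivAt G (fderiv ℝ G v) v := hv.differentiableAt.hasFDerivAt
  have h3 : HasDerivAt (fun s : ℝ => (v.1, s)) ((0 : P), (1:ℝ)) v.2 :=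
    (hasDerivAt_const v.2 v.1).prodMk (hasDerivAt_id v.2)
  exact (HasFDerivAt.comp_hasDerivAt (l := G) (f := fun s : ℝ => (v.1, s)) v.2 h2 h3).deriv.symm

theorem pDk_analytic {P : Type} [NormedAddCommGroup P] [NormedSpace ℝ P] {G : P × ℝ → ℝ} {w : P × ℝ}
    (hG : AnalyticAt ℝ G w) (k : ℕ) :
    AnalyticAt ℝ (fun w : P × ℝ => iteratedDeriv k (fun s => G (w.1, s)) w.2) w := by
  induction k with
  | zero => simpa using hG
  | succ k ih =>
    simp only [iteratedDeriv_succ]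
    exact pD_analytic (G := fun w : P × ℝ => iteratedDeriv k (fun s => G (w.1, s)) w.2) ih

theorem line_analytic {g : E → ℝ} {y0 : E} (e : E) (hg : AnalyticAt ℝ g y0) :
    AnalyticAt ℝ (fun s : ℝ => g (y0 + s • e)) 0 :=
  AnalyticAt.comp (g := g) (f := fun s : ℝ => y0 + s • e) (by simpa using hg)
    (analyticAt_const.add (analyticAt_id.smul analyticAt_const))

theorem muF_good (y0 e : E) (k : ℕ) : Good y0 (muF y0 e k) where
  ana P _ _ x0 F hF := by
    have h1 : AnalyticAt ℝ (fun w : P × ℝ => F (w.1, y0 + w.2 • e)) (x0, 0) := by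
      refine AnalyticAt.comp (g := F) (f := fun w : P × ℝ => (w.1, y0 + w.2 • e)) (by simpa using hF) ?_
      exact analyticAt_fst.prod (analyticAt_const.add (analyticAt_snd.smul analyticAt_const))
    have h2 := pDk_analytic h1 k
    exact h2.comp (f := fun x : P => (x, (0:ℝ))) (analyticAt_id.prod analyticAt_const)
  add g g' hg hg' := by
    have := iteratedDeriv_add (n := k) (line_analytic e hg).contDiffAt (line_analytic e hg').contDiffAt
    exact this
  smul c g hg := by
    have := iteratedDeriv_const_mul (n := k) (x := (0:ℝ)) c (line_analytic e hg).contDiffAt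
    exact this
  congr g g' h := by
    refine Filter.EventuallyEq.iteratedDeriv_eq k ?_
    have : Filter.Tendsto (fun s : ℝ => y0 + s • e) (𝓝 0) (𝓝 y0) := by
      have : Continuous (fun s : ℝ => y0 + s • e) := by fun_prop
      simpa using this.tendsto 0
    exact this.eventually h

theorem ev_zero_of_derivs {g : ℝ → ℝ} (hg : AnalyticAt ℝ g 0) (h : ∀ k, iteratedDeriv k g 0 = 0) :
    ∀ᶠ t in 𝓝 (0:ℝ), g t = 0 := by
  have h1 := hg.hasFPowerSeriesAt
  rw [h1.locally_zero_iff]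
  ext n
  simp [h]

theorem good_separate {P : Type} [NormedAddCommGroup P] [NormedSpace ℝ P] {F : P × E → ℝ} {x0 : P} {y0 : E}
    (hF : AnalyticAt ℝ F (x0, y0)) (hne : ¬ ∀ᶠ w in 𝓝 (x0, y0), F w = 0) :
    ∃ μ, Good y0 μ ∧ ¬ ∀ᶠ x in 𝓝 x0, μ (fun y => F (x, y)) = 0 := by
  by_contra hcon
  push Not at hcon
  obtain ⟨R, hR, hb⟩ := Metric.eventually_nhds_iff_ball.1 hF.eventually_analyticAt
  have hb' : ∀ x ∈ Metric.ball x0 R, ∀ y ∈ Metric.ball y0 R, AnalyticAt ℝ F (x, y) := by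
    intro x hx y hy
    apply hb
    rw [← ball_prod_same]; exact ⟨hx, hy⟩
  apply hne
  rw [Metric.eventually_nhds_iff_ball]
  refine ⟨R, hR, ?_⟩
  rintro ⟨x, y⟩ hxy
  rw [← ball_prod_same] at hxy
  obtain ⟨hx, hy⟩ := hxy
  simp only at hx hy
  set e := y - y0 with he
  have hz : ∀ k, muF y0 e k (fun y => F (x, y)) = 0 := by
    intro k
    have hA : AnalyticOnNhd ℝ (fun x => muF y0 e k (fun y => F (x, y))) (Metric.ball x0 R) :=
      fun x hx => (muF_good y0 e k).ana P x F (hb' x hx y0 (Metric.mem_ball_self hR))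
    exact hA.eqOn_zero_of_preconnected_of_eventuallyEq_zero (convex_ball _ _).isPreconnected
      (Metric.mem_ball_self hR) (hcon _ (muF_good y0 e k)) hx
  have hgA : AnalyticOnNhd ℝ (fun s : ℝ => F (x, y0 + s • e)) (Icc 0 1) := by
    intro t ht
    refine AnalyticAt.comp (g := F) (f := fun t : ℝ => (x, y0 + t • e)) ?_
      (analyticAt_const.prod (analyticAt_const.add (analyticAt_id.smul analyticAt_const)))
    apply hb' x hx
    rw [mem_ball_iff_norm] at hy ⊢
    rw [add_sub_cancel_left, norm_smul, Real.norm_eq_abs, abs_of_nonneg ht.1]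
    nlinarith [norm_nonneg (y - y0), ht.1, ht.2]
  have h0 := ev_zero_of_derivs (hgA 0 (left_mem_Icc.2 zero_le_one)) hz
  have h3 := hgA.eqOn_zero_of_preconnected_of_eventuallyEq_zero isPreconnected_Icc
    (left_mem_Icc.2 zero_le_one) h0
  have h4 := h3 (right_mem_Icc.2 zero_le_one)
  simpa [he] using h4

theorem slice_analytic {P : Type} [NormedAddCommGroup P] [NormedSpace ℝ P] {F : P × E → ℝ} {x0 : P} {y0 : E}
    (hF : AnalyticAt ℝ F (x0, y0)) : ∀ᶠ x in 𝓝 x0, AnalyticAt ℝ (fun y => F (x, y)) y0 := by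
  have h : Filter.Tendsto (fun x : P => (x, y0)) (𝓝 x0) (𝓝 (x0, y0)) := by
    have : Continuous (fun x : P => (x, y0)) := by fun_prop
    exact this.tendsto x0
  filter_upwards [h.eventually hF.eventually_analyticAt] with x hx
  exact hx.comp (f := fun y => (x, y)) (analyticAt_const.prod analyticAt_id)

theorem slice_eventually {P : Type} [TopologicalSpace P] {p : P × E → Prop} {x0 : P} {y0 : E}
    (h : ∀ᶠ w in 𝓝 (x0, y0), p w) : ∀ᶠ x in 𝓝 x0, ∀ᶠ y in 𝓝 y0, p (x, y) := by
  rw [nhds_prod_eq] at h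
  exact h.curry

end Good
end LojQE

open scoped Topology
open Set

namespace LojQE
set_option linter.unusedSectionVars false
set_option linter.unusedVariables false
section Basic
variable {E : Type} [NormedAddCommGroup E] [NormedSpace ℝ E]

/-- `f k = ∑ i, μ i (f k) * b i` near the base point -/
def HasRep (P : Type) [NormedAddCommGroup P] [NormedSpace ℝ P] (x0 : P) (y0 : E) {κ : Type}
    (f : κ → P × E → ℝ) : Prop :=
  ∃ (n : ℕ) (μ : Fin n → (E → ℝ) → ℝ) (b : Fin n → P × E → ℝ), (∀ i, Good y0 (μ i)) ∧
    (∀ i, AnalyticAt ℝ (b i) (x0, y0)) ∧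
    ∀ k, ∀ᶠ w in 𝓝 (x0, y0), f k w = ∑ i, μ i (fun y => f k (w.1, y)) * b i w

theorem HasRep.of_fintype {P : Type} [NormedAddCommGroup P] [NormedSpace ℝ P] {x0 : P} {y0 : E} {κ : Type}
    {f : κ → P × E → ℝ} {ι : Type} [Fintype ι] (μ : ι → (E → ℝ) → ℝ) (b : ι → P × E → ℝ)
    (hμ : ∀ i, Good y0 (μ i)) (hb : ∀ i, AnalyticAt ℝ (b i) (x0, y0))
    (h : ∀ k, ∀ᶠ w in 𝓝 (x0, y0), f k w = ∑ i, μ i (fun y => f k (w.1, y)) * b i w) :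
    HasRep P x0 y0 f := by
  let e := (Fintype.equivFin ι).symm
  refine ⟨_, fun i => μ (e i), fun i => b (e i), fun i => hμ _, fun i => hb _, fun k => ?_⟩
  filter_upwards [h k] with w hw
  rw [hw]
  exact (e.sum_comp (fun i => μ i (fun y => f k (w.1, y)) * b i w)).symm

variable {P : Type} [NormedAddCommGroup P] [NormedSpace ℝ P]

theorem tendsto_fst' {x0 : P} {y0 : E} : Filter.Tendsto Prod.fst (𝓝 (x0, y0)) (𝓝 x0) := continuousAt_fst

theorem mu_analytic2 {x0 : P} {y0 : E} {μ : (E → ℝ) → ℝ} (h : Good y0 μ) {F : P × E → ℝ}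
    (hF : AnalyticAt ℝ F (x0, y0)) : AnalyticAt ℝ (fun w : P × E => μ (fun y => F (w.1, y))) (x0, y0) :=
  AnalyticAt.comp (g := fun x => μ (fun y => F (x, y))) (f := fun w : P × E => w.1)
    (h.ana P x0 F hF) analyticAt_fst

theorem rep_many {x0 : P} {y0 : E} (h1 : ∀ f : P × E → ℝ, AnalyticAt ℝ f (x0, y0) → HasRep P x0 y0 (fun _ : Unit => f))
    (d : ℕ) : ∀ (f : Fin d → P × E → ℝ), (∀ k, AnalyticAt ℝ (f k) (x0, y0)) → HasRep P x0 y0 f := by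
  induction d with
  | zero => exact fun f hf => ⟨0, fun _ => 0, fun _ => 0, fun i => i.elim0, fun i => i.elim0, fun k => k.elim0⟩
  | succ d ih =>
    intro f hf
    obtain ⟨n, μ, b, hμ, hb, hrep⟩ := ih (fun k => f k.castSucc) (fun k => hf _)
    let R : (P × E → ℝ) → P × E → ℝ := fun F w => F w - ∑ i, μ i (fun y => F (w.1, y)) * b i w
    have hRa : ∀ F, AnalyticAt ℝ F (x0, y0) → AnalyticAt ℝ (R F) (x0, y0) := fun F hF =>
      hF.sub (Finset.analyticAt_fun_sum _ fun i _ => (mu_analytic2 (hμ i) hF).mul (hb i))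
    obtain ⟨m, ν, b', hν, hb', hrep'⟩ := h1 (R (f (Fin.last d))) (hRa _ (hf _))
    have hR : ∀ k, ∀ᶠ w in 𝓝 (x0, y0), R (f k) w = ∑ j, ν j (fun y => R (f k) (w.1, y)) * b' j w := by
      intro k
      refine Fin.lastCases ?_ (fun k => ?_) k
      · exact hrep' ()
      · have h0 : ∀ᶠ w in 𝓝 (x0, y0), R (f k.castSucc) w = 0 := by
          filter_upwards [hrep k] with w hw
          exact sub_eq_zero.2 hw
        filter_upwards [h0, tendsto_fst'.eventually (slice_eventually h0)] with w hw hw2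
        rw [hw]
        symm
        refine Finset.sum_eq_zero fun j _ => ?_
        rw [(hν j).congr _ (fun _ => 0) hw2, (hν j).zero, zero_mul]
    have hlin : ∀ F, AnalyticAt ℝ F (x0, y0) → ∀ j, ∀ᶠ x in 𝓝 x0, ν j (fun y => R F (x, y)) =
        ν j (fun y => F (x, y)) - ∑ i, μ i (fun y => F (x, y)) * ν j (fun y => b i (x, y)) := by
      intro F hF j
      have hbs : ∀ᶠ x in 𝓝 x0, ∀ i, AnalyticAt ℝ (fun y => b i (x, y)) y0 :=
        Filter.eventually_all.2 fun i => slice_analytic (hb i)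
      filter_upwards [slice_analytic hF, hbs] with x hx hbx
      have e1 : (fun y => R F (x, y)) = fun y => F (x, y) + ∑ i, (-μ i (fun y => F (x, y))) * b i (x, y) := by
        funext y; simp [R, sub_eq_add_neg]
      rw [e1, (hν j).add (fun y => F (x, y)) (fun y => ∑ i, (-μ i (fun y => F (x, y))) * b i (x, y)) hx
          (Finset.analyticAt_fun_sum _ fun i _ => analyticAt_const.mul (hbx i)),
        (hν j).sum _ (fun i => -μ i (fun y => F (x, y))) (fun i y => b i (x, y)) hbx]
      simp [sub_eq_add_neg]
    refine HasRep.of_fintype (ι := Fin n ⊕ Fin m) (Sum.elim μ ν)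
      (Sum.elim (fun i w => b i w - ∑ j, ν j (fun y => b i (w.1, y)) * b' j w) b') ?_ ?_ ?_
    · rintro (i | j)
      · exact hμ i
      · exact hν j
    · rintro (i | j)
      · exact (hb i).sub (Finset.analyticAt_fun_sum _ fun j _ => (mu_analytic2 (hν j) (hb i)).mul (hb' j))
      · exact hb' j
    · intro k
      have hl : ∀ᶠ x in 𝓝 x0, ∀ j, ν j (fun y => R (f k) (x, y)) =
        ν j (fun y => f k (x, y)) - ∑ i, μ i (fun y => f k (x, y)) * ν j (fun y => b i (x, y)) :=
        Filter.eventually_all.2 fun j => hlin (f k) (hf k) j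
      filter_upwards [hR k, tendsto_fst'.eventually hl] with w hw hl
      simp only [Fintype.sum_sum_type, Sum.elim_inl, Sum.elim_inr]
      have e2 : f k w = ∑ i, μ i (fun y => f k (w.1, y)) * b i w + R (f k) w := by simp [R]
      rw [e2, hw]
      simp only [hl, mul_sub, sub_mul, Finset.sum_sub_distrib, Finset.sum_mul, Finset.mul_sum]
      rw [Finset.sum_comm (s := Finset.univ (α := Fin m))]
      simp only [mul_assoc]
      ring

theorem rep_all [FiniteDimensional ℝ E] (y0 : E) (m : ℕ) : ∀ (P : Type) [NormedAddCommGroup P] [NormedSpace ℝ P] [FiniteDimensional ℝ P],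
    Module.finrank ℝ P = m → ∀ (x0 : P) (d : ℕ) (f : Fin d → P × E → ℝ),
    (∀ k, AnalyticAt ℝ (f k) (x0, y0)) → HasRep P x0 y0 f := by
  induction m using Nat.strong_induction_on with
  | _ m ih =>
  intro P _ _ _ hm x0
  refine rep_many ?_
  intro f hf
  by_cases hz : ∀ᶠ w in 𝓝 (x0, y0), f w = 0
  · exact ⟨0, fun _ => 0, fun _ => 0, fun i => i.elim0, fun i => i.elim0, fun k => by simpa using hz⟩
  obtain ⟨μ0, hμ0, hh⟩ := good_separate hf hz
  set h : P → ℝ := fun x => μ0 (fun y => f (x, y)) with hdef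
  have hha : AnalyticAt ℝ h x0 := hμ0.ana P x0 f hf
  by_cases h0 : h x0 ≠ 0
  · refine ⟨1, fun _ => μ0, fun _ w => f w / h w.1, fun _ => hμ0, fun _ => ?_, fun _ => ?_⟩
    · exact hf.div (AnalyticAt.comp (g := h) (f := fun w : P × E => w.1) hha analyticAt_fst) h0
    · filter_upwards [tendsto_fst'.eventually (hha.continuousAt.eventually_ne h0)] with w hw
      simp only [Finset.univ_unique, Finset.sum_const, Finset.card_singleton, one_smul]
      exact (mul_div_cancel₀ _ hw).symm
  · push Not at h0
    have hnt : Nontrivial P := by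
      by_contra hcon
      rw [not_nontrivial_iff_subsingleton] at hcon
      exact hh (Filter.Eventually.of_forall fun x => by rw [Subsingleton.elim x x0]; exact h0)
    obtain ⟨e, he, hdir⟩ := exists_direction (fun _ : Unit => h) x0 (fun _ => hha) (fun _ => hh)
    obtain ⟨P', Φ, hfr, hΦ⟩ := exists_split e he
    let h' : (P' × E) × ℝ → ℝ := fun w => h (x0 + Φ (w.1.1, w.2))
    let f' : (P' × E) × ℝ → ℝ := fun w => f (x0 + Φ (w.1.1, w.2), w.1.2)
    have hΨ : ∀ w, AnalyticAt ℝ (fun w : (P' × E) × ℝ => x0 + Φ (w.1.1, w.2)) w := by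
      intro w
      refine analyticAt_const.add ?_
      exact AnalyticAt.comp (g := Φ) (f := fun w : (P' × E) × ℝ => (w.1.1, w.2)) (Φ.analyticAt _)
        ((AnalyticAt.comp (g := Prod.fst) (f := Prod.fst) analyticAt_fst analyticAt_fst).prod analyticAt_snd)
    have hΨ0 : x0 + Φ ((0 : P'), (0:ℝ)) = x0 := by rw [hΦ]; simp
    have hh' : AnalyticAt ℝ h' (((0:P'), y0), 0) :=
      AnalyticAt.comp (g := h) (f := fun w : (P' × E) × ℝ => x0 + Φ (w.1.1, w.2))
        (by simp only [hΨ0]; exact hha) (hΨ _)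
    have hf' : AnalyticAt ℝ f' (((0:P'), y0), 0) :=
      AnalyticAt.comp (g := f) (f := fun w : (P' × E) × ℝ => (x0 + Φ (w.1.1, w.2), w.1.2))
        (by simp only [hΨ0]; exact hf) ((hΨ _).prod
        (AnalyticAt.comp (g := Prod.snd) (f := Prod.fst) analyticAt_snd analyticAt_fst))
    obtain ⟨d, -, hdiv⟩ := wdiv ((0:P'), y0) h' hh' (by
      have := hdir ()
      simpa [h', hΦ] using this)
    obtain ⟨q, r, hq, hr, heq⟩ := hdiv f' hf'
    obtain ⟨n, μ, b, hμ, hb, hrep⟩ := ih (Module.finrank ℝ P') (by omega) P' rfl 0 d r hr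
    let π : P → P' := fun x => (Φ.symm (x - x0)).1
    let τ : P → ℝ := fun x => (Φ.symm (x - x0)).2
    have hsub : ∀ x, AnalyticAt ℝ (fun x => Φ.symm (x - x0)) x := fun x =>
      AnalyticAt.comp (g := Φ.symm) (f := fun x => x - x0) (Φ.symm.analyticAt _) (analyticAt_id.sub analyticAt_const)
    have hπ : ∀ x, AnalyticAt ℝ π x := fun x => AnalyticAt.comp (g := Prod.fst) analyticAt_fst (hsub x)
    have hτ : ∀ x, AnalyticAt ℝ τ x := fun x => AnalyticAt.comp (g := Prod.snd) analyticAt_snd (hsub x)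
    have hπ0 : π x0 = 0 := by simp [π]
    have hτ0 : τ x0 = 0 := by simp [τ]
    have hback : ∀ x, x0 + Φ (π x, τ x) = x := fun x => by
      show x0 + Φ (Φ.symm (x - x0)) = x
      rw [Φ.apply_symm_apply]; abel
    -- pull back map
    let pb : P × E → P' × E := fun w => (π w.1, w.2)
    have hpb : ∀ w, AnalyticAt ℝ pb w := fun w =>
      (AnalyticAt.comp (g := π) (f := fun w : P × E => w.1) (hπ _) analyticAt_fst).prod analyticAt_snd
    have hpb0 : pb (x0, y0) = (0, y0) := by simp [pb, hπ0]
    have hpbt : Filter.Tendsto pb (𝓝 (x0, y0)) (𝓝 (0, y0)) := by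
      rw [← hpb0]; exact (hpb _).continuousAt
    let pb2 : P × E → (P' × E) × ℝ := fun w => (pb w, τ w.1)
    have hpb2 : ∀ w, AnalyticAt ℝ pb2 w := fun w => (hpb w).prod
      (AnalyticAt.comp (g := τ) (f := fun w : P × E => w.1) (hτ _) analyticAt_fst)
    have hpb20 : pb2 (x0, y0) = ((0, y0), 0) := by simp [pb2, hpb0, hτ0]
    have hpbt2 : Filter.Tendsto pb2 (𝓝 (x0, y0)) (𝓝 ((0, y0), 0)) := by
      rw [← hpb20]; exact (hpb2 _).continuousAt
    let Q : P × E → ℝ := fun w => q (pb2 w)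
    have hQ : AnalyticAt ℝ Q (x0, y0) := AnalyticAt.comp (g := q) (by rw [hpb20]; exact hq) (hpb2 _)
    have hbp : ∀ i, AnalyticAt ℝ (fun w => b i (pb w)) (x0, y0) := fun i =>
      AnalyticAt.comp (g := b i) (by rw [hpb0]; exact hb i) (hpb _)
    have hrp : ∀ k, AnalyticAt ℝ (fun w => r k (pb w)) (x0, y0) := fun k =>
      AnalyticAt.comp (g := r k) (by rw [hpb0]; exact hr k) (hpb _)
    have hfeq : ∀ᶠ w in 𝓝 (x0, y0), f w = Q w * h w.1 + ∑ k : Fin d, r k (pb w) * τ w.1 ^ (k:ℕ) := by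
      filter_upwards [hpbt2.eventually heq] with w hw
      simp only [f', h', pb2, pb, hback] at hw
      exact hw
    have hmu : ∀ i, ∀ᶠ x in 𝓝 x0, μ i (fun y => f (x, y)) =
        h x * μ i (fun y => Q (x, y)) + ∑ k : Fin d, τ x ^ (k:ℕ) * μ i (fun y => r k (π x, y)) := by
      intro i
      have hrs : ∀ᶠ x in 𝓝 x0, ∀ k, AnalyticAt ℝ (fun y => r k (pb (x, y))) y0 :=
        Filter.eventually_all.2 fun k => slice_analytic (hrp k)
      filter_upwards [slice_eventually hfeq, slice_analytic hQ, hrs] with x hx hQx hrx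
      rw [(hμ i).congr _ _ hx]
      have e1 : (fun y => Q (x, y) * h x + ∑ k : Fin d, r k (pb (x, y)) * τ x ^ (k:ℕ)) =
         fun y => h x * Q (x, y) + ∑ k : Fin d, τ x ^ (k:ℕ) * r k (pb (x, y)) := by
        funext y; rw [mul_comm]; congr 1; exact Finset.sum_congr rfl fun k _ => mul_comm _ _
      rw [e1, (hμ i).add (fun y => h x * Q (x, y)) (fun y => ∑ k : Fin d, τ x ^ (k:ℕ) * r k (pb (x, y)))
        (analyticAt_const.mul hQx) (Finset.analyticAt_fun_sum _ fun k _ => analyticAt_const.mul (hrx k)),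
        (hμ i).smul _ _ hQx, (hμ i).sum _ _ _ hrx]
    have hmu' := Filter.eventually_all.2 hmu
    have hrep' : ∀ᶠ w in 𝓝 (x0, y0), ∀ k, r k (pb w) = ∑ i, μ i (fun y => r k (π w.1, y)) * b i (pb w) :=
      hpbt.eventually (Filter.eventually_all.2 hrep)
    refine HasRep.of_fintype (ι := Option (Fin n)) (fun o => o.elim μ0 μ)
      (fun o => o.elim (fun w => Q w - ∑ i, μ i (fun y => Q (w.1, y)) * b i (pb w)) (fun i w => b i (pb w))) ?_ ?_ ?_
    · rintro (_ | i)
      · exact hμ0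
      · exact hμ i
    · rintro (_ | i)
      · exact hQ.sub (Finset.analyticAt_fun_sum _ fun i _ => (mu_analytic2 (hμ i) hQ).mul (hbp i))
      · exact hbp i
    · rintro -
      filter_upwards [hfeq, hrep', tendsto_fst'.eventually hmu'] with w h1 h2 h3
      simp only [Fintype.sum_option, Option.elim]
      have h4 : μ0 (fun y => f (w.1, y)) = h w.1 := rfl
      rw [h4, h1]
      simp only [h2, h3, add_mul, Finset.sum_add_distrib, Finset.sum_mul, mul_sub, Finset.mul_sum]
      rw [Finset.sum_comm (s := Finset.univ (α := Fin d))]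
      have e5 : ∀ i, ∀ k : Fin d, μ i (fun y => r k (π w.1, y)) * b i (pb w) * τ w.1 ^ (k:ℕ) =
        τ w.1 ^ (k:ℕ) * μ i (fun y => r k (π w.1, y)) * b i (pb w) := fun i k => by ring
      simp only [e5, mul_assoc]
      ring

theorem basic_lemma [FiniteDimensional ℝ E] [FiniteDimensional ℝ P] (x0 : P) (y0 : E) (f : P × E → ℝ)
    (hf : AnalyticAt ℝ f (x0, y0)) :
    ∃ (n : ℕ) (a : Fin n → P → ℝ) (b : Fin n → P × E → ℝ), (∀ i, AnalyticAt ℝ (a i) x0) ∧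
      (∀ i, AnalyticAt ℝ (b i) (x0, y0)) ∧
      (∀ᶠ w in 𝓝 (x0, y0), f w = ∑ i, a i w.1 * b i w) ∧
      ∀ v : Fin n → ℝ, (∀ᶠ y in 𝓝 y0, ∑ i, v i * b i (x0, y) = 0) → v = 0 := by
  classical
  have hex : HasRep P x0 y0 (fun _ : Unit => f) := by
    obtain ⟨n, μ, b, h1, h2, h3⟩ := rep_all y0 _ P rfl x0 1 (fun _ => f) (fun _ => hf)
    exact ⟨n, μ, b, h1, h2, fun _ => h3 0⟩
  unfold HasRep at hex
  set n := Nat.find hex with hn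
  obtain ⟨μ, b, hμ, hb, hrep⟩ := Nat.find_spec hex
  have hrep := hrep ()
  have hbs : ∀ᶠ x in 𝓝 x0, ∀ i, AnalyticAt ℝ (fun y => b i (x, y)) y0 :=
    Filter.eventually_all.2 fun i => slice_analytic (hb i)
  let A : Fin n → P → ℝ := fun i x => μ i (fun y => f (x, y))
  have hA : ∀ i, AnalyticAt ℝ (A i) x0 := fun i => (hμ i).ana P x0 f hf
  have hdelta : ∀ i j, μ j (fun y => b i (x0, y)) = if i = j then 1 else 0 := by
    intro i j
    by_contra hcon
    -- coefficient functions
    let c : Fin n → P → ℝ := fun l x => (if l = j then 1 else 0) - μ j (fun y => b l (x, y))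
    have hc : ∀ l, AnalyticAt ℝ (c l) x0 := fun l => analyticAt_const.sub ((hμ j).ana P x0 _ (hb l))
    have hci : c i x0 ≠ 0 := sub_ne_zero.2 (Ne.symm hcon)
    have hrel : ∀ᶠ x in 𝓝 x0, ∑ l, c l x * A l x = 0 := by
      filter_upwards [slice_eventually hrep, hbs] with x hx hbx
      have e1 := (hμ j).congr _ _ hx
      simp only at e1
      rw [(hμ j).sum _ (fun i => μ i (fun y => f (x, y))) (fun i y => b i (x, y)) hbx] at e1
      simp only [c, sub_mul, Finset.sum_sub_distrib, ite_mul, one_mul, zero_mul, Finset.sum_ite_eq', Finset.mem_univ, if_true]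
      simp only [A]
      rw [e1, sub_eq_zero]
      exact Finset.sum_congr rfl fun l _ => mul_comm _ _
    have hcard : Fintype.card {l : Fin n // l ≠ i} < n := by
      have := Fintype.card_subtype_lt (p := fun l : Fin n => l ≠ i) (x := i) (by simp)
      simpa using this
    let ε := (Fintype.equivFin {l : Fin n // l ≠ i}).symm
    refine Nat.find_min hex (m := Fintype.card {l : Fin n // l ≠ i}) hcard
      ⟨fun k => μ (ε k).1, fun k w => b (ε k).1 w - c (ε k).1 w.1 / c i w.1 * b i w, fun k => hμ _, fun k => ?_, fun _ => ?_⟩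
    · refine (hb _).sub (AnalyticAt.mul ?_ (hb i))
      exact AnalyticAt.comp (g := fun x => c (ε k).1 x / c i x) (f := fun w : P × E => w.1)
        ((hc _).div (hc i) hci) analyticAt_fst
    · filter_upwards [hrep, tendsto_fst'.eventually hrel,
        tendsto_fst'.eventually ((hc i).continuousAt.eventually_ne hci)] with w h1 h2 h3
      rw [h1]
      rw [ε.sum_comp (fun l : {l : Fin n // l ≠ i} => μ l.1 (fun y => f (w.1, y)) * (b l.1 w - c l.1 w.1 / c i w.1 * b i w))]
      have e1 : ∀ g : Fin n → ℝ, ∑ l, g l = g i + ∑ l : {l : Fin n // l ≠ i}, g l.1 := fun g =>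
        Fintype.sum_eq_add_sum_subtype_ne g i
      rw [e1] at h2 ⊢
      have e2 : ∑ l : {l : Fin n // l ≠ i}, μ l.1 (fun y => f (w.1, y)) * (b l.1 w - c l.1 w.1 / c i w.1 * b i w) =
        ∑ l : {l : Fin n // l ≠ i}, μ l.1 (fun y => f (w.1, y)) * b l.1 w -
         (∑ l : {l : Fin n // l ≠ i}, c l.1 w.1 * A l.1 w.1) / c i w.1 * b i w := by
        rw [Finset.sum_div, Finset.sum_mul, ← Finset.sum_sub_distrib]
        refine Finset.sum_congr rfl fun l _ => ?_
        simp only [A]; ring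
      rw [e2, eq_neg_of_add_eq_zero_right h2]
      have e3 : μ i (fun y => f (w.1, y)) = A i w.1 := rfl
      rw [e3]
      field_simp
      ring
  refine ⟨n, A, b, hA, hb, hrep, fun v hv => ?_⟩
  funext j
  have e1 := (hμ j).congr _ _ hv
  rw [(hμ j).sum _ v (fun i y => b i (x0, y)) hbs.self_of_nhds, (hμ j).zero] at e1
  simpa [hdelta] using e1
end Basic
end LojQE

open scoped Topology
open Set

namespace LojQE
set_option linter.unusedSectionVars false
set_option linter.unusedVariables false
section Terms

/-- Restricted division. -/
noncomputable def dv (p : ℝ × ℝ) : ℝ := {p : ℝ × ℝ | |p.1| ≤ |p.2|}.indicator (fun p => p.1 / p.2) p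

/-- Terms built from linear functionals, restricted analytic functions and restricted division. -/
inductive Tm {P : Type} [NormedAddCommGroup P] [NormedSpace ℝ P] : (P → ℝ) → Prop
  | const (c : ℝ) : Tm (fun _ => c)
  | lin (l : P →L[ℝ] ℝ) : Tm (fun x => l x)
  | add (s t : P → ℝ) (hs : Tm s) (ht : Tm t) : Tm (fun x => s x + t x)
  | mul (s t : P → ℝ) (hs : Tm s) (ht : Tm t) : Tm (fun x => s x * t x)
  | an (k : ℕ) (f : (Fin k → ℝ) → ℝ) (c : Fin k → ℝ) (ρ : ℝ)
      (hf : AnalyticOnNhd ℝ f (Metric.closedBall c ρ)) (g : Fin k → P → ℝ) (hg : ∀ i, Tm (g i)) :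
      Tm (fun x => (Metric.closedBall c ρ).indicator f (fun i => g i x))
  | div (s t : P → ℝ) (hs : Tm s) (ht : Tm t) : Tm (fun x => dv (s x, t x))

/-- Definable sets (quantifier free). -/
inductive Df {P : Type} [NormedAddCommGroup P] [NormedSpace ℝ P] : Set P → Prop
  | pos (t : P → ℝ) (ht : Tm t) : Df {x | 0 < t x}
  | compl (S : Set P) (hS : Df S) : Df Sᶜ
  | inter (S T : Set P) (hS : Df S) (hT : Df T) : Df (S ∩ T)

variable {P : Type} [NormedAddCommGroup P] [NormedSpace ℝ P]
variable {Q : Type} [NormedAddCommGroup Q] [NormedSpace ℝ Q]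

theorem Tm.neg {t : P → ℝ} (ht : Tm t) : Tm (fun x => - t x) := by
  have := Tm.mul _ _ (Tm.const (-1)) ht
  simpa using this

theorem Tm.sub {s t : P → ℝ} (hs : Tm s) (ht : Tm t) : Tm (fun x => s x - t x) := by
  have := Tm.add _ _ hs ht.neg
  simpa [sub_eq_add_neg] using this

theorem Tm.sum {ι : Type} (u : Finset ι) (t : ι → P → ℝ) (ht : ∀ i, Tm (t i)) : Tm (fun x => ∑ i ∈ u, t i x) := by
  classical
  induction u using Finset.induction_on with
  | empty => simpa using Tm.const 0
  | insert a s ha ih =>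
    simp only [Finset.sum_insert ha]
    exact Tm.add _ _ (ht a) ih

theorem Tm.comp {t : Q → ℝ} (ht : Tm t) (φ : P → Q) (hφ : ∀ l : Q →L[ℝ] ℝ, Tm (fun x => l (φ x))) :
    Tm (fun x => t (φ x)) := by
  induction ht with
  | const c => exact Tm.const c
  | lin l => exact hφ l
  | add s t hs ht ihs iht => exact Tm.add _ _ ihs iht
  | mul s t hs ht ihs iht => exact Tm.mul _ _ ihs iht
  | an k f c ρ hf g hg ih => exact Tm.an k f c ρ hf _ ih
  | div s t hs ht ihs iht => exact Tm.div _ _ ihs iht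

theorem Df.preimage {S : Set Q} (hS : Df S) (φ : P → Q) (hφ : ∀ l : Q →L[ℝ] ℝ, Tm (fun x => l (φ x))) :
    Df (φ ⁻¹' S) := by
  induction hS with
  | pos t ht => exact Df.pos _ (ht.comp φ hφ)
  | compl S hS ih => exact Df.compl _ ih
  | inter S T hS hT ih1 ih2 => exact Df.inter _ _ ih1 ih2

theorem Df.preimage_lin {S : Set Q} (hS : Df S) (φ : P →L[ℝ] Q) : Df (φ ⁻¹' S) :=
  hS.preimage φ fun l => Tm.lin (l.comp φ)

theorem Df.congr {S T : Set P} (hS : Df S) (h : ∀ x, x ∈ T ↔ x ∈ S) : Df T := by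
  have : T = S := Set.ext h
  rw [this]; exact hS

theorem Df.union {S T : Set P} (hS : Df S) (hT : Df T) : Df (S ∪ T) := by
  have := Df.compl _ (Df.inter _ _ (Df.compl _ hS) (Df.compl _ hT))
  rwa [← Set.compl_union, compl_compl] at this

theorem Df.univ : Df (Set.univ : Set P) := by
  refine Df.congr (Df.pos _ (Tm.const 1)) fun x => by simp

theorem Df.empty : Df (∅ : Set P) := by
  refine Df.congr (Df.pos _ (Tm.const 0)) fun x => by simp

theorem Df.const (p : Prop) : Df {x : P | p} := by
  by_cases h : p
  · exact Df.univ.congr (by simp [h])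
  · exact Df.empty.congr (by simp [h])

theorem Df.and {p q : P → Prop} (hS : Df {x | p x}) (hT : Df {x | q x}) : Df {x | p x ∧ q x} := Df.inter _ _ hS hT
theorem Df.or {p q : P → Prop} (hS : Df {x | p x}) (hT : Df {x | q x}) : Df {x | p x ∨ q x} := Df.union hS hT
theorem Df.not {p : P → Prop} (hS : Df {x | p x}) : Df {x | ¬ p x} := Df.compl _ hS

theorem Df.exists_finset {ι : Type} (u : Finset ι) (p : ι → P → Prop) (h : ∀ i ∈ u, Df {x | p i x}) :
    Df {x | ∃ i ∈ u, p i x} := by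
  classical
  induction u using Finset.induction_on with
  | empty => exact Df.empty.congr (by simp)
  | insert a s ha ih =>
    refine ((h a (by simp)).or (ih fun i hi => h i (by simp [hi]))).congr fun x => by simp

theorem Df.exists_fin {ι : Type} [Finite ι] (p : ι → P → Prop) (h : ∀ i, Df {x | p i x}) : Df {x | ∃ i, p i x} := by
  have := Fintype.ofFinite ι
  exact (Df.exists_finset Finset.univ p fun i _ => h i).congr fun x => by simp

theorem Df.forall_fin {ι : Type} [Finite ι] (p : ι → P → Prop) (h : ∀ i, Df {x | p i x}) : Df {x | ∀ i, p i x} := by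
  exact (Df.not (Df.exists_fin _ fun i => (h i).not)).congr fun x => by simp

theorem Tm.lt {s t : P → ℝ} (hs : Tm s) (ht : Tm t) : Df {x | s x < t x} :=
  (Df.pos _ (ht.sub hs)).congr fun x => by simp

theorem Tm.le {s t : P → ℝ} (hs : Tm s) (ht : Tm t) : Df {x | s x ≤ t x} :=
  (ht.lt hs).not.congr fun x => by simp

theorem Tm.eq {s t : P → ℝ} (hs : Tm s) (ht : Tm t) : Df {x | s x = t x} :=
  ((hs.le ht).and (ht.le hs)).congr fun x => by simp [le_antisymm_iff]

theorem Tm.abs_le {s t : P → ℝ} (hs : Tm s) (ht : Tm t) : Df {x | |s x| ≤ |t x|} :=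
  (Tm.le (Tm.mul _ _ hs hs) (Tm.mul _ _ ht ht)).congr fun x => by
    simp only [Set.mem_ofPred_eq]; rw [← sq_le_sq, sq, sq]

theorem Tm.sign {t : P → ℝ} (ht : Tm t) (σ : SignType) : Df {x | SignType.sign (t x) = σ} := by
  rcases σ with _ | _ | _
  · exact (ht.eq (Tm.const 0)).congr fun x => sign_eq_zero_iff
  · exact (ht.lt (Tm.const 0)).congr fun x => sign_eq_neg_one_iff
  · exact ((Tm.const 0).lt ht).congr fun x => sign_eq_one_iff

variable [FiniteDimensional ℝ P]

theorem Df.nhds_basis (x0 : P) {W : Set P} (hW : W ∈ 𝓝 x0) : ∃ U ∈ 𝓝 x0, U ⊆ W ∧ Df U := by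
  let φ : P ≃L[ℝ] (Fin (Module.finrank ℝ P) → ℝ) := ContinuousLinearEquiv.ofFinrankEq (by simp)
  have hlin : ∀ i, Tm (fun x => φ x i) := fun i =>
    Tm.lin ((ContinuousLinearMap.proj (R := ℝ) (φ := fun _ : Fin (Module.finrank ℝ P) => ℝ) i).comp
      (φ : P →L[ℝ] (Fin (Module.finrank ℝ P) → ℝ)))
  have h1 : φ.symm ⁻¹' W ∈ 𝓝 (φ x0) := φ.symm.continuous.continuousAt.preimage_mem_nhds (by simpa using hW)
  obtain ⟨ρ, hρ, hsub⟩ := Metric.nhds_basis_closedBall.mem_iff.1 h1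
  refine ⟨φ ⁻¹' Metric.closedBall (φ x0) ρ, φ.continuous.continuousAt.preimage_mem_nhds (Metric.closedBall_mem_nhds _ hρ), ?_, ?_⟩
  · intro x hx
    have := hsub hx
    simpa using this
  · have hc : ∀ i, Tm (fun x => φ x i - φ x0 i) := fun i =>
      (hlin i).sub (Tm.const _)
    refine (Df.forall_fin (fun i x => |φ x i - φ x0 i| ≤ |ρ|) fun i => (hc i).abs_le (Tm.const ρ)).congr fun x => ?_
    simp only [mem_preimage, Metric.mem_closedBall, dist_pi_le_iff hρ.le, Real.dist_eq, abs_of_pos hρ, Set.mem_ofPred_eq]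

theorem Tm.of_analyticAt {f : P → ℝ} {x0 : P} (hf : AnalyticAt ℝ f x0) : ∃ t : P → ℝ, Tm t ∧ ∀ᶠ x in 𝓝 x0, t x = f x := by
  let φ : P ≃L[ℝ] (Fin (Module.finrank ℝ P) → ℝ) := ContinuousLinearEquiv.ofFinrankEq (by simp)
  have hlin : ∀ i, Tm (fun x => φ x i) := fun i =>
    Tm.lin ((ContinuousLinearMap.proj (R := ℝ) (φ := fun _ : Fin (Module.finrank ℝ P) => ℝ) i).comp
      (φ : P →L[ℝ] (Fin (Module.finrank ℝ P) → ℝ)))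
  have h1 : AnalyticAt ℝ (fun v => f (φ.symm v)) (φ x0) :=
    AnalyticAt.comp (g := f) (f := φ.symm) (by simpa using hf) (φ.symm.analyticAt _)
  obtain ⟨ρ, hρ, hsub⟩ := Metric.nhds_basis_closedBall.mem_iff.1 h1.eventually_analyticAt
  refine ⟨_, Tm.an _ (fun v => f (φ.symm v)) (φ x0) ρ (fun v hv => hsub hv) (fun i x => φ x i) hlin, ?_⟩
  filter_upwards [φ.continuous.continuousAt.preimage_mem_nhds (Metric.closedBall_mem_nhds _ hρ)] with x hx
  show (Metric.closedBall (φ x0) ρ).indicator (fun v => f (φ.symm v)) (φ x) = f x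
  rw [Set.indicator_of_mem (by exact hx)]
  simp

end Terms
end LojQE

open scoped Topology
open Set

namespace LojQE
set_option linter.unusedSectionVars false
set_option linter.unusedVariables false
section QELocal

/-- Local quantifier elimination at a point. -/
def QEat {P : Type} [NormedAddCommGroup P] [NormedSpace ℝ P] {E : Type} [NormedAddCommGroup E] [NormedSpace ℝ E]
    (x0 : P) (y0 : E) {ι : Type} (f : ι → P × E → ℝ) : Prop :=
  ∀ W0 ∈ 𝓝 (x0, y0), ∃ W ∈ 𝓝 (x0, y0), W ⊆ W0 ∧
    ∀ σ : ι → SignType, Df {x | ∃ y, (x, y) ∈ W ∧ ∀ i, SignType.sign (f i (x, y)) = σ i}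

variable {P : Type} [NormedAddCommGroup P] [NormedSpace ℝ P] [FiniteDimensional ℝ P]
variable {E : Type} [NormedAddCommGroup E] [NormedSpace ℝ E] [FiniteDimensional ℝ E]

theorem qe_zero [Subsingleton E] (x0 : P) (y0 : E) {ι : Type} [Finite ι] (f : ι → P × E → ℝ)
    (hf : ∀ i, AnalyticAt ℝ (f i) (x0, y0)) : QEat x0 y0 f := by
  intro W0 hW0
  have hmk : ∀ x, AnalyticAt ℝ (fun x : P => (x, y0)) x := fun x => analyticAt_id.prod analyticAt_const
  choose t ht hte using fun i => Tm.of_analyticAt (AnalyticAt.comp (g := f i) (f := fun x : P => (x, y0)) (hf i) (hmk x0))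
  obtain ⟨U, hU, hUs, hUd⟩ := Df.nhds_basis x0 (Filter.inter_mem
    ((hmk x0).continuousAt.preimage_mem_nhds hW0) (Filter.eventually_all.2 hte))
  refine ⟨Prod.fst ⁻¹' U, continuousAt_fst.preimage_mem_nhds hU, ?_, fun σ => ?_⟩
  · rintro ⟨x, y⟩ hx
    rw [Subsingleton.elim y y0]
    exact (hUs hx).1
  · refine (Df.and (p := fun x => x ∈ U) hUd (Df.forall_fin (fun i x => SignType.sign (t i x) = σ i) fun i => (ht i).sign _)).congr fun x => ?_
    constructor
    · rintro ⟨y, hy, h⟩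
      refine ⟨hy, fun i => ?_⟩
      rw [(hUs hy).2 i, ← h i, Subsingleton.elim y y0]; rfl
    · rintro ⟨hx, h⟩
      refine ⟨y0, hx, fun i => ?_⟩
      rw [← h i, (hUs hx).2 i]; rfl

theorem eval_analytic {κ : Type} [Finite κ] {Z : Type} [NormedAddCommGroup Z] [NormedSpace ℝ Z] (a : κ → Z → ℝ) (z0 : Z)
    (ha : ∀ k, AnalyticAt ℝ (a k) z0) (q : MvPolynomial κ ℝ) :
    AnalyticAt ℝ (fun z => MvPolynomial.eval (fun k => a k z) q) z0 := by
  induction q using MvPolynomial.induction_on with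
  | C c => simpa using analyticAt_const
  | add p q hp hq => simp only [map_add]; exact hp.add hq
  | mul_X p k hp => simp only [map_mul, MvPolynomial.eval_X]; exact hp.mul (ha k)

theorem qe_good [Nontrivial E] (ih : ∀ (E' : Type) [NormedAddCommGroup E'] [NormedSpace ℝ E'] [FiniteDimensional ℝ E'],
      Module.finrank ℝ E' < Module.finrank ℝ E → ∀ (ι : Type) [Finite ι] (x0 : P) (y0 : E') (f : ι → P × E' → ℝ),
      (∀ i, AnalyticAt ℝ (f i) (x0, y0)) → QEat x0 y0 f)
    (x0 : P) (y0 : E) {ι : Type} [Finite ι] (f : ι → P × E → ℝ)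
    (hf : ∀ i, AnalyticAt ℝ (f i) (x0, y0)) (hne : ∀ i, ¬ ∀ᶠ y in 𝓝 y0, f i (x0, y) = 0) : QEat x0 y0 f := by
  classical
  have := Fintype.ofFinite ι
  intro W0 hW0
  obtain ⟨e, he, hdir⟩ := exists_direction (fun i y => f i (x0, y)) y0
    (fun i => AnalyticAt.comp (g := f i) (f := fun y : E => (x0, y)) (hf i) (analyticAt_const.prod analyticAt_id)) hne
  obtain ⟨E', Φ, hfr, hΦ⟩ := exists_split e he
  let Ψ : (P × E') × ℝ → P × E := fun w => (w.1.1, y0 + Φ (w.1.2, w.2))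
  have hΨ : ∀ w, AnalyticAt ℝ Ψ w := by
    intro w
    refine AnalyticAt.prod ?_ (analyticAt_const.add ?_)
    · exact AnalyticAt.comp (g := Prod.fst) (f := Prod.fst) analyticAt_fst analyticAt_fst
    · exact AnalyticAt.comp (g := Φ) (f := fun w : (P × E') × ℝ => (w.1.2, w.2)) (Φ.analyticAt _)
        ((AnalyticAt.comp (g := Prod.snd) (f := Prod.fst) analyticAt_snd analyticAt_fst).prod analyticAt_snd)
  let z0 : P × E' := (x0, 0)
  have hΨ0 : Ψ (z0, 0) = (x0, y0) := by simp [Ψ, z0, hΦ]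
  have hg : ∀ i, AnalyticAt ℝ (fun w => f i (Ψ w)) (z0, 0) := fun i =>
    AnalyticAt.comp (g := f i) (by rw [hΨ0]; exact hf i) (hΨ _)
  choose d u a hu hu0 ha heq using fun i => wprep z0 (fun w => f i (Ψ w)) (hg i) (by
    simpa [Ψ, z0, hΦ] using hdir i)
  let κ := Σ i, Fin (d i + 1)
  let aa : κ → P × E' → ℝ := fun k => a k.1 k.2
  have haa : ∀ k, AnalyticAt ℝ (aa k) z0 := fun k => ha _ _
  -- neighbourhood
  have hsgn : ∀ i, ∀ᶠ w in 𝓝 (z0, (0:ℝ)), SignType.sign (u i w) = SignType.sign (u i (z0, 0)) := by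
    intro i
    rcases lt_or_gt_of_ne (hu0 i) with h | h
    · filter_upwards [(hu i).continuousAt.eventually_lt continuousAt_const h] with w hw
      rw [sign_neg hw, sign_neg h]
    · filter_upwards [continuousAt_const.eventually_lt (hu i).continuousAt h] with w hw
      rw [sign_pos hw, sign_pos h]
  have hall : ∀ᶠ w in 𝓝 (z0, (0:ℝ)), Ψ w ∈ W0 ∧ ∀ i, SignType.sign (f i (Ψ w)) =
      SignType.sign (u i (z0, 0)) * SignType.sign (∑ k : Fin (d i + 1), a i k w.1 * w.2 ^ (k:ℕ)) := by
    have h1 : ∀ᶠ w in 𝓝 (z0, (0:ℝ)), Ψ w ∈ W0 := (hΨ _).continuousAt.preimage_mem_nhds (by rw [hΨ0]; exact hW0)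
    filter_upwards [h1, Filter.eventually_all.2 hsgn, Filter.eventually_all.2 heq] with w h1 h2 h3
    refine ⟨h1, fun i => ?_⟩
    rw [h3 i, sign_mul, h2 i]
  rw [nhds_prod_eq, Filter.eventually_prod_iff] at hall
  obtain ⟨pa, hpa, pb, hpb, hab⟩ := hall
  obtain ⟨δ, hδ, hδs⟩ := Metric.nhds_basis_closedBall.eventually_iff.1 hpb
  -- polynomials
  let p : ι → Polynomial (MvPolynomial κ ℝ) := fun i => ∑ k : Fin (d i + 1), Polynomial.C (MvPolynomial.X ⟨i, k⟩) * Polynomial.X ^ (k:ℕ)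
  let c : Polynomial (MvPolynomial κ ℝ) := Polynomial.C (MvPolynomial.C δ)
  obtain ⟨Q, hQ⟩ := tarski (Finset.univ.image p ∪ {Polynomial.X - c, Polynomial.X + c})
  let ev : P × E' → MvPolynomial κ ℝ →+* ℝ := fun z => MvPolynomial.eval (fun k => aa k z)
  have hevX : ∀ z k, ev z (MvPolynomial.X k) = aa k z := fun z k => MvPolynomial.eval_X k
  have hevC : ∀ z, ev z (MvPolynomial.C δ) = δ := fun z => MvPolynomial.eval_C δ
  have hev : ∀ z t i, (p i).eval₂ (ev z) t = ∑ k : Fin (d i + 1), a i k z * t ^ (k:ℕ) := by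
    intro z t i
    simp only [p, Polynomial.eval₂_finsetSum, Polynomial.eval₂_mul, Polynomial.eval₂_C, Polynomial.eval₂_X_pow]
    exact Finset.sum_congr rfl fun k _ => by rw [hevX]
  have hcm : ∀ z t, (Polynomial.X - c).eval₂ (ev z) t = t - δ := by
    intro z t; simp [c, hevC]
  have hcp : ∀ z t, (Polynomial.X + c).eval₂ (ev z) t = t + δ := by
    intro z t; simp [c, hevC]
  obtain ⟨W1, hW1, hW1s, hW1d⟩ := ih E' (by omega) Q x0 0 (fun q z => ev z q.1)
    (fun q => eval_analytic aa z0 haa q.1) {z | pa z} hpa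
  -- the property at z
  let Good1 : (ι → SignType) → P × E' → Prop := fun σ z => ∃ t : ℝ, |t| ≤ δ ∧
    ∀ i, SignType.sign (u i (z0, 0)) * SignType.sign (∑ k : Fin (d i + 1), a i k z * t ^ (k:ℕ)) = σ i
  have htr : ∀ σ z z', (∀ q : Q, SignType.sign (ev z q.1) = SignType.sign (ev z' q.1)) → Good1 σ z → Good1 σ z' := by
    rintro σ z z' hzz ⟨t, ht, hs⟩
    obtain ⟨t', ht'⟩ := hQ (ev z) (ev z') (fun q hq => hzz ⟨q, hq⟩) (fun q => SignType.sign (q.eval₂ (ev z) t)) ⟨t, fun _ _ => rfl⟩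
    refine ⟨t', ?_, fun i => ?_⟩
    · have h1 := ht' (Polynomial.X - c) (by simp)
      have h2 := ht' (Polynomial.X + c) (by simp)
      rw [hcm, hcm] at h1
      rw [hcp, hcp] at h2
      rw [abs_le] at ht ⊢
      constructor
      · by_contra hcon
        rw [sign_neg (by linarith)] at h2
        have := sign_eq_neg_one_iff.1 h2.symm
        linarith
      · by_contra hcon
        rw [sign_pos (by linarith)] at h1
        have := sign_eq_one_iff.1 h1.symm
        linarith
    · have h1 := ht' (p i) (by simp)
      rw [hev, hev] at h1
      rw [h1, hs]
  let inv : P × E → (P × E') × ℝ := fun w => ((w.1, (Φ.symm (w.2 - y0)).1), (Φ.symm (w.2 - y0)).2)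
  have hinvc : Continuous inv := by
    have : Continuous (fun w : P × E => Φ.symm (w.2 - y0)) := Φ.symm.continuous.comp (continuous_snd.sub continuous_const)
    exact (continuous_fst.prodMk (continuous_fst.comp this)).prodMk (continuous_snd.comp this)
  have hinv0 : inv (x0, y0) = (z0, 0) := by simp [inv, z0]
  have hΨinv : ∀ w, Ψ (inv w) = w := by
    rintro ⟨x, y⟩
    show (x, y0 + Φ (Φ.symm (y - y0))) = (x, y)
    rw [Φ.apply_symm_apply]; simp
  have hinvΨ : ∀ w, inv (Ψ w) = w := by
    rintro ⟨⟨x, y⟩, t⟩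
    simp [inv, Ψ]
  refine ⟨inv ⁻¹' (W1 ×ˢ Metric.closedBall 0 δ), ?_, ?_, fun σ => ?_⟩
  · refine hinvc.continuousAt.preimage_mem_nhds ?_
    rw [hinv0]
    exact prod_mem_nhds hW1 (Metric.closedBall_mem_nhds _ hδ)
  · intro w hw
    have := (hab (hW1s hw.1) (hδs hw.2)).1
    rwa [Prod.mk.eta, hΨinv] at this
  · let T : Set (Q → SignType) := {τ | ∃ z, (∀ q : Q, SignType.sign (ev z q.1) = τ q) ∧ Good1 σ z}
    refine (Df.exists_fin (fun (τ : Q → SignType) x => τ ∈ T ∧ ∃ y, (x, y) ∈ W1 ∧ ∀ q : Q, SignType.sign (ev (x, y) q.1) = τ q)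
      fun τ => (Df.const _).and (hW1d τ)).congr fun x => ?_
    constructor
    · rintro ⟨y, hw, hs⟩
      refine ⟨fun q => SignType.sign (ev (inv (x, y)).1 q.1), ⟨(inv (x, y)).1, fun q => rfl, (inv (x, y)).2, ?_, fun i => ?_⟩,
        (inv (x, y)).1.2, hw.1, fun q => rfl⟩
      · simpa using hw.2
      · have := (hab (hW1s hw.1) (hδs hw.2)).2 i
        rw [Prod.mk.eta, hΨinv, hs] at this
        exact this.symm
    · rintro ⟨τ, ⟨z, hz, hG⟩, y, hy, hq⟩
      obtain ⟨t, ht, hs⟩ := htr σ z (x, y) (fun q => by rw [hz, hq]) hG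
      have ht' : t ∈ Metric.closedBall (0:ℝ) δ := by simpa using ht
      refine ⟨y0 + Φ (y, t), ?_, fun i => ?_⟩
      · show inv (Ψ ((x, y), t)) ∈ W1 ×ˢ Metric.closedBall 0 δ
        rw [hinvΨ]
        exact ⟨hy, ht'⟩
      · have := (hab (hW1s hy) (hδs ht')).2 i
        rw [hs] at this
        exact this

end QELocal
end LojQE

open scoped Topology
open Set

namespace LojQE
set_option linter.unusedSectionVars false
set_option linter.unusedVariables false
section QEStep
variable {E : Type} [NormedAddCommGroup E] [NormedSpace ℝ E] [FiniteDimensional ℝ E]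

theorem lin_prod_tm {P : Type} [NormedAddCommGroup P] [NormedSpace ℝ P] {p : ℕ} (v : Fin p → P → ℝ) (hv : ∀ l, Tm (v l))
    (L : (P × (Fin p → ℝ)) →L[ℝ] ℝ) : Tm (fun x => L (x, fun l => v l x)) := by
  have e : (fun x => L (x, fun l => v l x)) = fun x => (L.comp (ContinuousLinearMap.inl ℝ P (Fin p → ℝ))) x +
      ∑ l, v l x * L (0, Pi.single l 1) := by
    funext x
    have h1 : (x, fun l => v l x) = ((x, 0) : P × (Fin p → ℝ)) + ∑ l, v l x • ((0, Pi.single l 1) : P × (Fin p → ℝ)) := by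
      ext1
      · simp [Prod.fst_sum]
      · simp only [Prod.snd_add, Prod.snd_sum, Prod.smul_mk, zero_add]
        funext i
        simp [Finset.sum_apply, Pi.single_apply]
    rw [h1, map_add, map_sum]
    refine congrArg₂ _ rfl (Finset.sum_congr rfl fun l _ => ?_)
    rw [map_smul, smul_eq_mul]
  rw [e]
  exact Tm.add _ _ (Tm.lin _) (Tm.sum _ _ fun l => Tm.mul _ _ (hv l) (Tm.const _))

theorem qe_step {ι : Type} [Finite ι] (y0 : E)
    (hgood : ∀ (P : Type) [NormedAddCommGroup P] [NormedSpace ℝ P] [FiniteDimensional ℝ P] (x0 : P) (f : ι → P × E → ℝ),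
      (∀ i, AnalyticAt ℝ (f i) (x0, y0)) → (∀ i, ¬ ∀ᶠ y in 𝓝 y0, f i (x0, y) = 0) → QEat x0 y0 f) (B : Finset ι) :
    ∀ (P : Type) [NormedAddCommGroup P] [NormedSpace ℝ P] [FiniteDimensional ℝ P] (x0 : P) (f : ι → P × E → ℝ),
      (∀ i, AnalyticAt ℝ (f i) (x0, y0)) → (∀ i ∉ B, ¬ ∀ᶠ y in 𝓝 y0, f i (x0, y) = 0) → QEat x0 y0 f := by
  classical
  induction B using Finset.induction_on with
  | empty => intro P _ _ _ x0 f hf hne; exact hgood P x0 f hf fun i => hne i (by simp)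
  | insert i0 B hi0 ih =>
  intro P _ _ _ x0 f hf hne W0 hW0
  obtain ⟨p, a, b, ha, hb, hrep, hind⟩ := basic_lemma x0 y0 (f i0) (hf i0)
  choose t ht hte using fun l => Tm.of_analyticAt (ha l)
  obtain ⟨U0, hU0, hU0s, hU0d⟩ := Df.nhds_basis x0 (Filter.eventually_all.2 hte)
  -- the zero case
  obtain ⟨Wz, hWz, hWzs, hWzd⟩ := ih P x0 (Function.update f i0 (fun _ => 1)) (by
    intro i
    rcases eq_or_ne i i0 with rfl | hi
    · rw [Function.update_self]; exact analyticAt_const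
    · rw [Function.update_of_ne hi]; exact hf i) (by
    intro i hi
    rcases eq_or_ne i i0 with rfl | hi'
    · rw [Function.update_self]
      intro h
      exact one_ne_zero h.self_of_nhds
    · rw [Function.update_of_ne hi']; exact hne i (by simp [hi, hi'])) (W0 ∩ {w | f i0 w = ∑ l, a l w.1 * b l w})
      (Filter.inter_mem hW0 hrep)
  let V := Fin p → ℝ
  let F : (P × (Fin p → ℝ)) × E → ℝ := fun w => ∑ l, w.1.2 l * b l (w.1.1, w.2)
  let f' : ι → (P × (Fin p → ℝ)) × E → ℝ := Function.update (fun i w => f i (w.1.1, w.2)) i0 F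
  have hpr : ∀ w, AnalyticAt ℝ (fun w : (P × (Fin p → ℝ)) × E => (w.1.1, w.2)) w := fun w =>
    (AnalyticAt.comp (g := Prod.fst) (f := Prod.fst) analyticAt_fst analyticAt_fst).prod analyticAt_snd
  have hvl : ∀ l w, AnalyticAt ℝ (fun w : (P × (Fin p → ℝ)) × E => w.1.2 l) w := fun l w =>
    AnalyticAt.comp (g := ContinuousLinearMap.proj (R := ℝ) (φ := fun _ : Fin p => ℝ) l)
      (f := fun w : (P × (Fin p → ℝ)) × E => w.1.2) (ContinuousLinearMap.analyticAt _ _)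
      (AnalyticAt.comp (g := Prod.snd) (f := Prod.fst) analyticAt_snd analyticAt_fst)
  have hF : ∀ v0, AnalyticAt ℝ F ((x0, v0), y0) := fun v0 =>
    Finset.analyticAt_fun_sum _ fun l _ => (hvl l _).mul (AnalyticAt.comp (g := b l)
      (f := fun w : (P × (Fin p → ℝ)) × E => (w.1.1, w.2)) (hb l) (hpr _))
  have hV : ∀ v0 : Fin p → ℝ, v0 ≠ 0 → ∃ W ∈ 𝓝 ((x0, v0), y0),
      W ⊆ {w | (w.1.1, w.2) ∈ W0 ∩ {w | f i0 w = ∑ l, a l w.1 * b l w}} ∧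
      ∀ σ : ι → SignType, Df {x | ∃ y, (x, y) ∈ W ∧ ∀ i, SignType.sign (f' i (x, y)) = σ i} := by
    intro v0 hv0
    refine ih (P × (Fin p → ℝ)) (x0, v0) f' ?_ ?_ _ ?_
    · intro i
      rcases eq_or_ne i i0 with rfl | hi
      · simp only [f', Function.update_self]; exact hF v0
      · simp only [f', Function.update_of_ne hi]
        exact AnalyticAt.comp (g := f i) (f := fun w : (P × (Fin p → ℝ)) × E => (w.1.1, w.2)) (hf i) (hpr _)
    · intro i hi
      rcases eq_or_ne i i0 with rfl | hi'
      · simp only [f', Function.update_self]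
        intro h
        exact hv0 (hind v0 h)
      · simp only [f', Function.update_of_ne hi']
        exact hne i (by simp [hi, hi'])
    · exact (hpr ((x0, v0), y0)).continuousAt.preimage_mem_nhds (Filter.inter_mem hW0 hrep)
  choose! WV hWV hWVs hWVd using hV
  have hbox : ∀ v0 : Fin p → ℝ, v0 ≠ 0 → ∃ N ∈ 𝓝 v0, ∃ M ∈ 𝓝 (x0, y0), ∀ v ∈ N, ∀ w ∈ M, ((w.1, v), w.2) ∈ WV v0 := by
    intro v0 hv0
    have hc : Continuous (fun q : (Fin p → ℝ) × (P × E) => (((q.2.1, q.1), q.2.2) : (P × (Fin p → ℝ)) × E)) := by fun_prop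
    have h1 : (fun q : (Fin p → ℝ) × (P × E) => (((q.2.1, q.1), q.2.2) : (P × (Fin p → ℝ)) × E)) ⁻¹' (WV v0) ∈ 𝓝 (v0, (x0, y0)) :=
      hc.continuousAt.preimage_mem_nhds (hWV v0 hv0)
    rw [nhds_prod_eq, Filter.mem_prod_iff] at h1
    obtain ⟨N, hN, M, hM, hNM⟩ := h1
    exact ⟨N, hN, M, hM, fun v hv w hw => hNM (show (v, w) ∈ N ×ˢ M from ⟨hv, hw⟩)⟩
  choose! NV hNV MV hMV hNMV using hbox
  let K : Fin p → Set (Fin p → ℝ) := fun j => Metric.closedBall 0 1 ∩ {v | v j = 1}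
  have hK : ∀ j, IsCompact (K j) := fun j => (isCompact_closedBall _ _).inter_right
    (isClosed_eq (continuous_apply j) continuous_const)
  have hKne : ∀ j, ∀ v ∈ K j, v ≠ 0 := by
    rintro j v ⟨-, hv⟩ rfl
    simp at hv
  choose s hs hsc using fun j => (hK j).elim_nhds_subcover NV (fun v hv => hNV v (hKne j v hv))
  let vv : Fin p → Fin p → P → ℝ := fun j l x => dv (t l x, t j x)
  have hvv : ∀ j l, Tm (vv j l) := fun j l => Tm.div _ _ (ht l) (ht j)
  let cs : Fin p → P → Prop := fun j x => t j x ≠ 0 ∧ ∀ l, |t l x| ≤ |t j x|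
  have hcs : ∀ j, Df {x | cs j x} := fun j =>
    (((ht j).eq (Tm.const 0)).not).and (Df.forall_fin _ fun l => (ht l).abs_le (ht j))
  have hvveq : ∀ j x, cs j x → ∀ l, vv j l x = t l x / t j x := fun j x h l =>
    Set.indicator_of_mem (s := {p : ℝ × ℝ | |p.1| ≤ |p.2|}) (a := (t l x, t j x)) (h.2 l) _
  have hvK : ∀ j x, cs j x → (fun l => vv j l x) ∈ K j := by
    intro j x h
    constructor
    · rw [mem_closedBall_zero_iff, pi_norm_le_iff_of_nonneg zero_le_one]
      intro l
      rw [hvveq j x h, Real.norm_eq_abs, abs_div]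
      exact div_le_one_of_le₀ (h.2 l) (abs_nonneg _)
    · show vv j j x = 1
      rw [hvveq j x h, div_self h.1]
  let W : Set (P × E) := {w | w.1 ∈ U0 ∧ ((∃ j, cs j w.1 ∧ ∃ v0 ∈ s j, ((w.1, fun l => vv j l w.1), w.2) ∈ WV v0) ∨
    ((∀ l, t l w.1 = 0) ∧ w ∈ Wz))}
  refine ⟨W, ?_, ?_, fun σ => ?_⟩
  · have h1 : ∀ᶠ w in 𝓝 (x0, y0), ∀ j, ∀ v0 ∈ s j, w ∈ MV v0 :=
      Filter.eventually_all.2 fun j => (Filter.eventually_all_finset (s j)).2 fun v0 hv0 =>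
        hMV v0 (hKne j v0 (hs j v0 hv0))
    filter_upwards [h1, hWz, continuousAt_fst.preimage_mem_nhds hU0] with w h1 h2 h3
    refine ⟨h3, ?_⟩
    by_cases hz : ∀ l, t l w.1 = 0
    · exact Or.inr ⟨hz, h2⟩
    left
    push Not at hz
    obtain ⟨l0, hl0⟩ := hz
    obtain ⟨j, -, hj⟩ := Finset.exists_max_image Finset.univ (fun l => |t l w.1|) ⟨l0, Finset.mem_univ _⟩
    have hcj : cs j w.1 := by
      refine ⟨fun h0 => hl0 ?_, fun l => hj l (Finset.mem_univ _)⟩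
      have := hj l0 (Finset.mem_univ _)
      simp only [h0, abs_zero] at this
      exact abs_nonpos_iff.1 this
    have := hsc j (hvK j w.1 hcj)
    simp only [mem_iUnion] at this
    obtain ⟨v0, hv0, hmem⟩ := this
    exact ⟨j, hcj, v0, hv0, hNMV v0 (hKne j v0 (hs j v0 hv0)) _ hmem w (h1 j v0 hv0)⟩
  · rintro w ⟨-, ⟨j, -, v0, hv0, hmem⟩ | ⟨-, hw⟩⟩
    · exact (hWVs v0 (hKne j v0 (hs j v0 hv0)) hmem).1
    · exact (hWzs hw).1
  · have hj : Df {x | ∃ j, cs j x ∧ ∃ v0 ∈ s j, ∃ s1 s2 : SignType, s1 * s2 = σ i0 ∧ SignType.sign (t j x) = s1 ∧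
        ((x, fun l => vv j l x) ∈ {x | ∃ y, (x, y) ∈ WV v0 ∧ ∀ i, SignType.sign (f' i (x, y)) = Function.update σ i0 s2 i})} := by
      refine Df.exists_fin _ fun j => (hcs j).and (Df.exists_finset _ _ fun v0 hv0 => Df.exists_fin _ fun s1 =>
        Df.exists_fin _ fun s2 => (Df.const _).and (((ht j).sign _).and ?_))
      exact (hWVd v0 (hKne j v0 (hs j v0 hv0)) (Function.update σ i0 s2)).preimage (fun x => (x, fun l => vv j l x))
        (lin_prod_tm _ (hvv j))
    have hzd : Df {x | σ i0 = 0 ∧ (∀ l, t l x = 0) ∧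
        x ∈ {x | ∃ y, (x, y) ∈ Wz ∧ ∀ i, SignType.sign (Function.update f i0 (fun _ => 1) i (x, y)) = Function.update σ i0 1 i}} :=
      (Df.const _).and ((Df.forall_fin _ fun l => (ht l).eq (Tm.const 0)).and (hWzd _))
    refine (Df.and (p := fun x => x ∈ U0) hU0d (hj.or hzd)).congr fun x => ?_
    have key : ∀ j, cs j x → x ∈ U0 → ∀ v0 ∈ s j, ∀ y, ((x, fun l => vv j l x), y) ∈ WV v0 →
        f i0 (x, y) = t j x * F ((x, fun l => vv j l x), y) := by
      intro j hcj hx v0 hv0 y hy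
      have h1 := (hWVs v0 (hKne j v0 (hs j v0 hv0)) hy).2
      simp only [Set.mem_ofPred_eq] at h1
      rw [h1]
      simp only [F, Finset.mul_sum]
      refine Finset.sum_congr rfl fun l _ => ?_
      rw [hvveq j x hcj, ← hU0s hx l, ← mul_assoc, mul_div_cancel₀ _ hcj.1]
    constructor
    · rintro ⟨y, ⟨hxU, ⟨j, hcj, v0, hv0, hmem⟩ | ⟨hz, hw⟩⟩, hsg⟩
      · refine ⟨hxU, Or.inl ⟨j, hcj, v0, hv0, _, SignType.sign (F ((x, fun l => vv j l x), y)), ?_, rfl, y, hmem, ?_⟩⟩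
        · rw [← sign_mul, ← key j hcj hxU v0 hv0 y hmem, hsg]
        · intro i
          rcases eq_or_ne i i0 with rfl | hi
          · simp [f']
          · simp only [f', Function.update_of_ne hi, hsg]
      · refine ⟨hxU, Or.inr ⟨?_, hz, y, hw, ?_⟩⟩
        · rw [← hsg i0, (hWzs hw).2]
          simp only [← hU0s hxU _]
          rw [Finset.sum_eq_zero fun l _ => by rw [hz l, zero_mul], sign_zero]
        · intro i
          rcases eq_or_ne i i0 with rfl | hi
          · simp
          · simp only [Function.update_of_ne hi, hsg]
    · rintro ⟨hxU, ⟨j, hcj, v0, hv0, s1, s2, h12, h1, y, hmem, hsg⟩ | ⟨h0, hz, y, hw, hsg⟩⟩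
      · refine ⟨y, ⟨hxU, Or.inl ⟨j, hcj, v0, hv0, hmem⟩⟩, fun i => ?_⟩
        have := hsg i
        rcases eq_or_ne i i0 with rfl | hi
        · simp only [f', Function.update_self] at this
          rw [key j hcj hxU v0 hv0 y hmem, sign_mul, this, h1, h12]
        · simp only [f', Function.update_of_ne hi] at this
          exact this
      · refine ⟨y, ⟨hxU, Or.inr ⟨hz, hw⟩⟩, fun i => ?_⟩
        have := hsg i
        rcases eq_or_ne i i0 with rfl | hi
        · rw [h0, (hWzs hw).2]
          simp only [← hU0s hxU _]
          rw [Finset.sum_eq_zero fun l _ => by rw [hz l, zero_mul], sign_zero]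
        · simp only [Function.update_of_ne hi] at this
          exact this

theorem qe_local (n : ℕ) : ∀ (E : Type) [NormedAddCommGroup E] [NormedSpace ℝ E] [FiniteDimensional ℝ E],
    Module.finrank ℝ E = n → ∀ (P : Type) [NormedAddCommGroup P] [NormedSpace ℝ P] [FiniteDimensional ℝ P]
      (ι : Type) [Finite ι] (x0 : P) (y0 : E) (f : ι → P × E → ℝ),
      (∀ i, AnalyticAt ℝ (f i) (x0, y0)) → QEat x0 y0 f := by
  induction n using Nat.strong_induction_on with
  | _ n ih =>
  intro E _ _ _ hn P _ _ _ ι _ x0 y0 f hf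
  rcases subsingleton_or_nontrivial E with hE | hE
  · exact qe_zero x0 y0 f hf
  · have := Fintype.ofFinite ι
    refine qe_step y0 ?_ Finset.univ P x0 f hf (by simp)
    intro P _ _ _ x0 f hf hne
    refine qe_good ?_ x0 y0 f hf hne
    intro E' _ _ _ hE' ι _ x0 y0 f hf
    exact ih _ (by omega) E' rfl P ι x0 y0 f hf

end QEStep
end LojQE

open scoped Topology
open Set

namespace LojQE
set_option linter.unusedSectionVars false
set_option linter.unusedVariables false
section SAsec

/-- Semianalyticity at a point via sign conditions. -/
def SAat {X : Type} [NormedAddCommGroup X] [NormedSpace ℝ X] (A : Set X) (x : X) : Prop :=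
  ∃ (ι : Type) (_ : Finite ι) (f : ι → X → ℝ) (T : Set (ι → SignType)), (∀ i, AnalyticAt ℝ (f i) x) ∧
    ∀ᶠ y in 𝓝 x, (y ∈ A ↔ (fun i => SignType.sign (f i y)) ∈ T)

def SA {X : Type} [NormedAddCommGroup X] [NormedSpace ℝ X] (A : Set X) : Prop := ∀ x, SAat A x

variable {X : Type} [NormedAddCommGroup X] [NormedSpace ℝ X]
variable {Y : Type} [NormedAddCommGroup Y] [NormedSpace ℝ Y]

theorem SAat.congr {A B : Set X} {x : X} (h : SAat A x) (hAB : ∀ᶠ y in 𝓝 x, (y ∈ B ↔ y ∈ A)) : SAat B x := by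
  obtain ⟨ι, hι, f, T, hf, h⟩ := h
  refine ⟨ι, hι, f, T, hf, ?_⟩
  filter_upwards [h, hAB] with y h1 h2
  rw [h2, h1]

theorem SAat.compl {A : Set X} {x : X} (h : SAat A x) : SAat Aᶜ x := by
  obtain ⟨ι, hι, f, T, hf, h⟩ := h
  refine ⟨ι, hι, f, Tᶜ, hf, ?_⟩
  filter_upwards [h] with y h1
  rw [mem_compl_iff, mem_compl_iff, h1]

theorem SAat.iInter {κ : Type} [Finite κ] {A : κ → Set X} {x : X} (h : ∀ k, SAat (A k) x) : SAat (⋂ k, A k) x := by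
  choose ι hι f T hf h using h
  refine ⟨Σ k, ι k, inferInstance, fun i => f i.1 i.2, {s | ∀ k, (fun i => s ⟨k, i⟩) ∈ T k}, fun i => hf _ _, ?_⟩
  filter_upwards [Filter.eventually_all.2 h] with y h1
  simp only [mem_iInter, h1, Set.mem_ofPred_eq]

theorem SAat.inter {A B : Set X} {x : X} (hA : SAat A x) (hB : SAat B x) : SAat (A ∩ B) x := by
  rw [Set.inter_eq_iInter]
  exact SAat.iInter (by rintro (_ | _) <;> assumption)

theorem SAat.union {A B : Set X} {x : X} (hA : SAat A x) (hB : SAat B x) : SAat (A ∪ B) x := by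
  have := (hA.compl.inter hB.compl).compl
  rwa [← Set.compl_union, compl_compl] at this

theorem SAat.sign {f : X → ℝ} {x : X} (hf : AnalyticAt ℝ f x) (T : Set SignType) : SAat {y | SignType.sign (f y) ∈ T} x :=
  ⟨Unit, inferInstance, fun _ => f, {s | s () ∈ T}, fun _ => hf, Filter.Eventually.of_forall fun y => Iff.rfl⟩

theorem SAat.pos {f : X → ℝ} {x : X} (hf : AnalyticAt ℝ f x) : SAat {y | 0 < f y} x :=
  (SAat.sign hf {1}).congr (Filter.Eventually.of_forall fun y => (sign_eq_one_iff (a := f y)).symm)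

theorem SAat.zero {f : X → ℝ} {x : X} (hf : AnalyticAt ℝ f x) : SAat {y | f y = 0} x :=
  (SAat.sign hf {0}).congr (Filter.Eventually.of_forall fun y => (sign_eq_zero_iff (a := f y)).symm)

theorem SAat.lt {f g : X → ℝ} {x : X} (hf : AnalyticAt ℝ f x) (hg : AnalyticAt ℝ g x) : SAat {y | f y < g y} x :=
  (SAat.pos (hg.sub hf)).congr (Filter.Eventually.of_forall fun y => (sub_pos (a := g y) (b := f y)).symm)

theorem SAat.le {f g : X → ℝ} {x : X} (hf : AnalyticAt ℝ f x) (hg : AnalyticAt ℝ g x) : SAat {y | f y ≤ g y} x :=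
  (SAat.lt hg hf).compl.congr (Filter.Eventually.of_forall fun y => (not_lt (a := g y) (b := f y)).symm)

theorem SAat.eq {f g : X → ℝ} {x : X} (hf : AnalyticAt ℝ f x) (hg : AnalyticAt ℝ g x) : SAat {y | f y = g y} x :=
  (SAat.zero (hf.sub hg)).congr (Filter.Eventually.of_forall fun y => (sub_eq_zero (a := f y) (b := g y)).symm)

theorem SAat.preimage {A : Set Y} {φ : X → Y} {x : X} (hA : SAat A (φ x)) (hφ : AnalyticAt ℝ φ x) : SAat (φ ⁻¹' A) x := by
  obtain ⟨ι, hι, f, T, hf, h⟩ := hA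
  exact ⟨ι, hι, fun i y => f i (φ y), T, fun i => AnalyticAt.comp (g := f i) (hf i) hφ, hφ.continuousAt.eventually h⟩

theorem SA.preimage {A : Set Y} (hA : SA A) {φ : X → Y} (hφ : ∀ x, AnalyticAt ℝ φ x) : SA (φ ⁻¹' A) :=
  fun x => (hA _).preimage (hφ x)

theorem SA.univ : SA (Set.univ : Set X) := fun x =>
  (SAat.pos (f := fun _ => 1) analyticAt_const).congr (Filter.Eventually.of_forall fun y => by simp)

theorem SA.of_semianalytic {A : Set X} (hA : Semianalytic A) : SA A := by
  intro x
  obtain ⟨U, hU, p, q, f, g, hf, hg, h⟩ := hA x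
  refine ⟨(Fin p × Fin q) × Bool, inferInstance, fun i => if i.2 then f i.1.1 i.1.2 else g i.1.1 i.1.2,
    {s | ∃ i, ∀ j, s ((i, j), true) = 0 ∧ s ((i, j), false) = 1}, ?_, ?_⟩
  · rintro ⟨⟨i, j⟩, _ | _⟩
    · simpa using hg i j x (mem_of_mem_nhds hU)
    · simpa using hf i j x (mem_of_mem_nhds hU)
  · filter_upwards [hU] with y hy
    have h1 : y ∈ A ↔ y ∈ A ∩ U := by simp [hy]
    rw [h1, h]
    simp [hy, sign_eq_zero_iff, sign_eq_one_iff]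

theorem SA.box [FiniteDimensional ℝ X] {S : Set X} (hS : Bornology.IsBounded S) : ∃ C : Set X, SA C ∧ Bornology.IsBounded C ∧ S ⊆ C := by
  let φ : X ≃L[ℝ] (Fin (Module.finrank ℝ X) → ℝ) := ContinuousLinearEquiv.ofFinrankEq (by simp)
  have hlin : ∀ i x, AnalyticAt ℝ (fun x => φ x i) x := fun i x =>
    ((ContinuousLinearMap.proj (R := ℝ) (φ := fun _ : Fin (Module.finrank ℝ X) => ℝ) i).comp
      (φ : X →L[ℝ] (Fin (Module.finrank ℝ X) → ℝ))).analyticAt x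
  have h1 : Bornology.IsBounded (φ '' S) := (φ : X →L[ℝ] (Fin (Module.finrank ℝ X) → ℝ)).lipschitz.isBounded_image hS
  obtain ⟨R, hR, hsub⟩ := h1.subset_closedBall_lt 0 0
  refine ⟨⋂ i, ({x | -R ≤ φ x i} ∩ {x | φ x i ≤ R}), fun x => SAat.iInter fun i =>
    (SAat.le analyticAt_const (hlin i x)).inter (SAat.le (hlin i x) analyticAt_const), ?_, ?_⟩
  · have h2 : Bornology.IsBounded (φ.symm '' Metric.closedBall 0 R) :=
      (φ.symm : (Fin (Module.finrank ℝ X) → ℝ) →L[ℝ] X).lipschitz.isBounded_image Metric.isBounded_closedBall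
    refine h2.subset fun x hx => ⟨φ x, ?_, by simp⟩
    rw [mem_closedBall_zero_iff, pi_norm_le_iff_of_nonneg hR.le]
    intro i
    have := mem_iInter.1 hx i
    exact abs_le.2 this
  · intro x hx
    have := hsub (mem_image_of_mem φ hx)
    rw [mem_closedBall_zero_iff, pi_norm_le_iff_of_nonneg hR.le] at this
    exact mem_iInter.2 fun i => abs_le.1 (this i)

variable {P : Type} [NormedAddCommGroup P] [NormedSpace ℝ P] [FiniteDimensional ℝ P]
variable {E : Type} [NormedAddCommGroup E] [NormedSpace ℝ E] [FiniteDimensional ℝ E]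

theorem SA.proj {A : Set (P × E)} (hA : SA A) (hb : Bornology.IsBounded A) : Df {x | ∃ y, (x, y) ∈ A} := by
  have hc : IsCompact (closure A) := Metric.isCompact_of_isClosed_isBounded isClosed_closure hb.closure
  have h1 : ∀ w : P × E, ∃ W ∈ 𝓝 w, Df {x | ∃ y, (x, y) ∈ W ∧ (x, y) ∈ A} := by
    rintro ⟨x0, y0⟩
    obtain ⟨ι, hι, f, T, hf, h⟩ := hA (x0, y0)
    obtain ⟨W, hW, hWs, hWd⟩ := qe_local _ E rfl P ι x0 y0 f hf _ h
    refine ⟨W, hW, (Df.exists_fin (fun (σ : ι → SignType) x => σ ∈ T ∧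
      ∃ y, (x, y) ∈ W ∧ ∀ i, SignType.sign (f i (x, y)) = σ i) fun σ => (Df.const _).and (hWd σ)).congr fun x => ?_⟩
    constructor
    · rintro ⟨y, hy, hyA⟩
      exact ⟨_, (hWs hy).1 hyA, y, hy, fun i => rfl⟩
    · rintro ⟨σ, hσ, y, hy, hs⟩
      refine ⟨y, hy, (hWs hy).2 ?_⟩
      have : (fun i => SignType.sign (f i (x, y))) = σ := funext hs
      rw [this]; exact hσ
  choose W hW hWd using h1
  obtain ⟨s, -, hs⟩ := hc.elim_nhds_subcover W (fun w _ => hW w)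
  refine (Df.exists_finset s (fun w x => ∃ y, (x, y) ∈ W w ∧ (x, y) ∈ A) fun w _ => hWd w).congr fun x => ?_
  constructor
  · rintro ⟨y, hy⟩
    have := hs (subset_closure hy)
    simp only [mem_iUnion] at this
    obtain ⟨w, hw, hm⟩ := this
    exact ⟨w, hw, y, hm, hy⟩
  · rintro ⟨w, hw, y, hm, hy⟩
    exact ⟨y, hy⟩

theorem df_of_subanalytic {U : Set P} (hU : Subanalytic U) (hb : Bornology.IsBounded U) : Df U := by
  have hc : IsCompact (closure U) := Metric.isCompact_of_isClosed_isBounded isClosed_closure hb.closure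
  have h1 : ∀ w : P, ∃ W ∈ 𝓝 w, Df {x | x ∈ W ∧ x ∈ U} := by
    intro w
    obtain ⟨O, hO, m, B, hB, hBc, hUO⟩ := hU w
    obtain ⟨O', hO', hOs, hOd⟩ := Df.nhds_basis w hO
    refine ⟨O', hO', (Df.and (p := fun x => x ∈ O') hOd (SA.proj (SA.of_semianalytic hB)
      (hBc.isBounded.subset subset_closure))).congr fun x => ?_⟩
    refine and_congr_right fun hx => ?_
    have h2 : x ∈ U ↔ x ∈ U ∩ O := by simp [hOs hx]
    rw [h2, hUO]
    simp [hOs hx]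
  choose W hW hWd using h1
  obtain ⟨s, -, hs⟩ := hc.elim_nhds_subcover W (fun w _ => hW w)
  refine (Df.exists_finset s (fun w x => x ∈ W w ∧ x ∈ U) fun w _ => hWd w).congr fun x => ?_
  constructor
  · intro hy
    have := hs (subset_closure hy)
    simp only [mem_iUnion] at this
    obtain ⟨w, hw, hm⟩ := this
    exact ⟨w, hw, hm, hy⟩
  · rintro ⟨w, hw, hm, hy⟩
    exact hy

end SAsec
end LojQE

open scoped Topology
open Set

namespace LojQE
set_option linter.unusedSectionVars false
set_option linter.unusedVariables false
section ResSec

/-- Simultaneous resolution of the functions `t k` over `C`. -/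
def Res {P : Type} [NormedAddCommGroup P] [NormedSpace ℝ P] (C : Set P) {κ : Type} (t : κ → P → ℝ) : Prop :=
  ∃ (E : Type) (_ : NormedAddCommGroup E) (_ : NormedSpace ℝ E) (_ : FiniteDimensional ℝ E) (D : Set (P × E))
    (τ : κ → P × E → ℝ), SA D ∧ Bornology.IsBounded D ∧ (∀ k w, AnalyticAt ℝ (τ k) w) ∧
    (∀ x, x ∈ C ↔ ∃ e, (x, e) ∈ D) ∧ ∀ x e, (x, e) ∈ D → ∀ k, t k x = τ k (x, e)

variable {P : Type} [NormedAddCommGroup P] [NormedSpace ℝ P]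

theorem isBounded_snd {E : Type} [NormedAddCommGroup E] [NormedSpace ℝ E] {D : Set (P × E)} (h : Bornology.IsBounded D) :
    Bornology.IsBounded (Prod.snd '' D) := (ContinuousLinearMap.snd ℝ P E).lipschitz.isBounded_image h

theorem res_joint {C : Set P} (hC : SA C) (hCb : Bornology.IsBounded C) {κ : Type} [Fintype κ] {t : κ → P → ℝ}
    (h : ∀ k, Res C (fun _ : Unit => t k)) : Res C t := by
  choose E i1 i2 i3 D τ hD hDb hτ hCD hDt using h
  have hev : ∀ k (w : P × (∀ k, E k)), AnalyticAt ℝ (fun w : P × (∀ k, E k) => (w.1, w.2 k)) w := fun k w =>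
    analyticAt_fst.prod (((ContinuousLinearMap.proj (R := ℝ) (φ := E) k).comp (ContinuousLinearMap.snd ℝ P (∀ k, E k))).analyticAt w)
  refine ⟨∀ k, E k, inferInstance, inferInstance, inferInstance,
    (Prod.fst ⁻¹' C) ∩ ⋂ k, (fun w : P × (∀ k, E k) => (w.1, w.2 k)) ⁻¹' (D k),
    fun k w => τ k () (w.1, w.2 k), ?_, ?_, ?_, ?_, ?_⟩
  · intro w
    exact (SA.preimage hC (fun x => analyticAt_fst) w).inter (SAat.iInter fun k => SA.preimage (hD k) (hev k) w)
  · refine (hCb.prod (Bornology.IsBounded.pi fun k => isBounded_snd (hDb k))).subset ?_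
    rintro ⟨x, e⟩ ⟨hx, he⟩
    exact ⟨hx, fun k _ => ⟨_, mem_iInter.1 he k, rfl⟩⟩
  · exact fun k w => AnalyticAt.comp (g := τ k ()) (hτ k () _) (hev k w)
  · intro x
    constructor
    · intro hx
      choose e he using fun k => (hCD k x).1 hx
      exact ⟨e, hx, mem_iInter.2 he⟩
    · rintro ⟨e, hx, -⟩
      exact hx
  · rintro x e ⟨hx, he⟩ k
    exact hDt k x (e k) (mem_iInter.1 he k) ()

theorem res_ext {C : Set P} {κ : Type} [Fintype κ] {t : κ → P → ℝ} (h : Res C t) (H : (κ → ℝ) → ℝ) (M : ℝ)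
    (hM : ∀ v, |H v| ≤ M) (hH : SA {p : (κ → ℝ) × ℝ | p.2 = H p.1}) :
    Res C (fun _ : Unit => fun x => H (fun k => t k x)) := by
  obtain ⟨E, i1, i2, i3, D, τ, hD, hDb, hτ, hCD, hDt⟩ := h
  have h1 : ∀ w, AnalyticAt ℝ (fun w : P × (E × ℝ) => (w.1, w.2.1)) w := fun w =>
    analyticAt_fst.prod (AnalyticAt.comp (g := Prod.fst) (f := Prod.snd) analyticAt_fst analyticAt_snd)
  have h2 : ∀ w, AnalyticAt ℝ (fun w : P × (E × ℝ) => w.2.2) w := fun w =>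
    AnalyticAt.comp (g := Prod.snd) (f := Prod.snd) analyticAt_snd analyticAt_snd
  have h3 : ∀ w, AnalyticAt ℝ (fun w : P × (E × ℝ) => ((fun k => τ k (w.1, w.2.1)), w.2.2)) w := fun w =>
    (AnalyticAt.pi fun k => AnalyticAt.comp (g := τ k) (hτ k _) (h1 w)).prod (h2 w)
  refine ⟨E × ℝ, inferInstance, inferInstance, inferInstance,
    (fun w : P × (E × ℝ) => (w.1, w.2.1)) ⁻¹' D ∩
      (fun w : P × (E × ℝ) => ((fun k => τ k (w.1, w.2.1)), w.2.2)) ⁻¹' {p : (κ → ℝ) × ℝ | p.2 = H p.1},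
    fun _ w => w.2.2, ?_, ?_, fun _ => h2, ?_, ?_⟩
  · exact fun w => (SA.preimage hD h1 w).inter (SA.preimage hH h3 w)
  · have hb : Bornology.IsBounded (Prod.fst '' D) := (ContinuousLinearMap.fst ℝ P E).lipschitz.isBounded_image hDb
    refine (hb.prod ((isBounded_snd hDb).prod (Metric.isBounded_closedBall (x := (0:ℝ)) (r := M)))).subset ?_
    rintro ⟨x, e, s⟩ ⟨hx, hs⟩
    refine ⟨⟨_, hx, rfl⟩, ⟨_, hx, rfl⟩, ?_⟩
    have hs : s = H (fun k => τ k (x, e)) := hs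
    simp only [mem_closedBall_zero_iff, hs]
    exact hM _
  · intro x
    rw [hCD]
    constructor
    · rintro ⟨e, he⟩
      exact ⟨(e, H (fun k => τ k (x, e))), he, rfl⟩
    · rintro ⟨⟨e, s⟩, he, -⟩
      exact ⟨e, he⟩
  · rintro x ⟨e, s⟩ ⟨hx, hs⟩ _
    have hs : s = H (fun k => τ k (x, e)) := hs
    simp only [hs]
    congr 1
    exact funext fun k => hDt x e hx k

theorem res_simple {C : Set P} (hC : SA C) (hCb : Bornology.IsBounded C) {t : P → ℝ} (ht : ∀ x, AnalyticAt ℝ t x) :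
    Res C (fun _ : Unit => t) := by
  refine ⟨Fin 0 → ℝ, inferInstance, inferInstance, inferInstance, Prod.fst ⁻¹' C, fun _ w => t w.1,
    SA.preimage hC (fun x => analyticAt_fst), ?_, ?_, ?_, ?_⟩
  · refine (hCb.prod (Metric.isBounded_closedBall (x := (0 : Fin 0 → ℝ)) (r := 1))).subset ?_
    rintro ⟨x, e⟩ hx
    refine ⟨hx, ?_⟩
    rw [Subsingleton.elim e 0]; simp
  · exact fun _ w => AnalyticAt.comp (g := t) (ht _) analyticAt_fst
  · exact fun x => ⟨fun h => ⟨0, h⟩, fun ⟨_, h⟩ => h⟩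
  · intro x e _ _; rfl

theorem res_op2 {C : Set P} (hC : SA C) (hCb : Bornology.IsBounded C) {s t : P → ℝ} (hs : Res C (fun _ : Unit => s))
    (ht : Res C (fun _ : Unit => t)) : Res C ![s, t] :=
  res_joint hC hCb (by intro k; fin_cases k <;> assumption)

theorem res_tm {t : P → ℝ} (ht : Tm t) {C : Set P} (hC : SA C) (hCb : Bornology.IsBounded C) : Res C (fun _ : Unit => t) := by
  induction ht with
  | const c => exact res_simple hC hCb fun x => analyticAt_const
  | lin l => exact res_simple hC hCb fun x => l.analyticAt x
  | add s t _ _ hs ht =>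
    obtain ⟨E, i1, i2, i3, D, τ, hD, hDb, hτ, hCD, hDt⟩ := res_op2 hC hCb hs ht
    exact ⟨E, i1, i2, i3, D, fun _ w => τ 0 w + τ 1 w, hD, hDb, fun _ w => (hτ 0 w).add (hτ 1 w), hCD, fun x e h _ => by
      have h0 := hDt x e h 0
      have h1 := hDt x e h 1
      simp only [Matrix.cons_val_zero, Matrix.cons_val_one] at h0 h1
      simp only [h0, h1]⟩
  | mul s t _ _ hs ht =>
    obtain ⟨E, i1, i2, i3, D, τ, hD, hDb, hτ, hCD, hDt⟩ := res_op2 hC hCb hs ht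
    exact ⟨E, i1, i2, i3, D, fun _ w => τ 0 w * τ 1 w, hD, hDb, fun _ w => (hτ 0 w).mul (hτ 1 w), hCD, fun x e h _ => by
      have h0 := hDt x e h 0
      have h1 := hDt x e h 1
      simp only [Matrix.cons_val_zero, Matrix.cons_val_one] at h0 h1
      simp only [h0, h1]⟩
  | an k f c ρ hf g hg ih =>
    have hbd : ∃ M, ∀ v ∈ Metric.closedBall c ρ, ‖f v‖ ≤ M :=
      (isCompact_closedBall c ρ).exists_bound_of_continuousOn hf.continuousOn
    obtain ⟨M, hM⟩ := hbd
    refine res_ext (res_joint hC hCb ih) ((Metric.closedBall c ρ).indicator f) (max M 0) ?_ ?_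
    · intro v
      by_cases hv : v ∈ Metric.closedBall c ρ
      · rw [Set.indicator_of_mem hv]; exact le_max_of_le_left (hM v hv)
      · rw [Set.indicator_of_notMem hv]; simp
    · rintro ⟨v, s⟩
      by_cases hv : v ∈ Metric.closedBall c ρ
      · -- near a point of the ball
        have hball : SAat (Metric.closedBall c ρ) v := by
          have hρ : 0 ≤ ρ := dist_nonneg.trans hv
          have hpr : ∀ i (v : Fin k → ℝ), AnalyticAt ℝ (fun v : Fin k → ℝ => v i) v := fun i v =>
            (ContinuousLinearMap.proj (R := ℝ) (φ := fun _ : Fin k => ℝ) i).analyticAt v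
          refine (SAat.iInter (A := fun i => {v : Fin k → ℝ | -ρ ≤ v i - c i} ∩ {v | v i - c i ≤ ρ}) fun i =>
            (SAat.le analyticAt_const ((hpr i v).sub analyticAt_const)).inter
            (SAat.le ((hpr i v).sub analyticAt_const) analyticAt_const)).congr (Filter.Eventually.of_forall fun v => ?_)
          rw [Metric.mem_closedBall, dist_pi_le_iff hρ, mem_iInter]
          exact forall_congr' fun i => abs_le
        have hb1 : SAat (Prod.fst ⁻¹' Metric.closedBall c ρ : Set ((Fin k → ℝ) × ℝ)) (v, s) :=
          SAat.preimage (φ := Prod.fst) (x := (v, s)) hball analyticAt_fst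
        have h1 : SAat {p : (Fin k → ℝ) × ℝ | p.2 = f p.1} (v, s) :=
          SAat.eq analyticAt_snd (AnalyticAt.comp (g := f) (f := Prod.fst) (x := (v, s)) (hf v hv) analyticAt_fst)
        have h2 : SAat {p : (Fin k → ℝ) × ℝ | p.2 = 0} (v, s) := SAat.eq analyticAt_snd analyticAt_const
        refine ((hb1.inter h1).union (hb1.compl.inter h2)).congr (Filter.Eventually.of_forall ?_)
        rintro ⟨v, s⟩
        by_cases hv : v ∈ Metric.closedBall c ρ
        · simp only [Set.mem_ofPred_eq, Set.indicator_of_mem hv, mem_union, mem_inter_iff, mem_preimage, mem_compl_iff, hv]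
          simp
        · simp only [Set.mem_ofPred_eq, Set.indicator_of_notMem hv, mem_union, mem_inter_iff, mem_preimage, mem_compl_iff, hv]
          simp
      · have h2 : SAat {p : (Fin k → ℝ) × ℝ | p.2 = 0} (v, s) := SAat.eq analyticAt_snd analyticAt_const
        refine h2.congr ?_
        have h3 : ∀ᶠ p in 𝓝 (v, s), p.1 ∉ Metric.closedBall c ρ :=
          (Metric.isClosed_closedBall.isOpen_compl.preimage continuous_fst).mem_nhds (show (v, s) ∈ Prod.fst ⁻¹' (Metric.closedBall c ρ)ᶜ from hv)
        filter_upwards [h3] with p hp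
        simp only [Set.mem_ofPred_eq, Set.indicator_of_notMem hp]
  | div s t _ _ hs ht =>
    refine res_ext (res_op2 hC hCb hs ht) (fun v => dv (v 0, v 1)) 1 ?_ ?_
    · intro v
      simp only [dv]
      by_cases hv : |v 0| ≤ |v 1|
      · rw [Set.indicator_of_mem (by exact hv), abs_div]
        exact div_le_one_of_le₀ hv (abs_nonneg _)
      · rw [Set.indicator_of_notMem (by exact hv)]; simp
    · intro w
      have hpr : ∀ i (w : (Fin 2 → ℝ) × ℝ), AnalyticAt ℝ (fun w : (Fin 2 → ℝ) × ℝ => w.1 i) w := fun i w =>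
        ((ContinuousLinearMap.proj (R := ℝ) (φ := fun _ : Fin 2 => ℝ) i).comp (ContinuousLinearMap.fst ℝ (Fin 2 → ℝ) ℝ)).analyticAt w
      have h1 : SAat {w : (Fin 2 → ℝ) × ℝ | w.1 0 ^ 2 ≤ w.1 1 ^ 2} w := SAat.le ((hpr 0 w).pow 2) ((hpr 1 w).pow 2)
      have h2 : SAat {w : (Fin 2 → ℝ) × ℝ | w.2 = 0} w := SAat.eq analyticAt_snd analyticAt_const
      have h3 : SAat {w : (Fin 2 → ℝ) × ℝ | w.1 1 = 0} w := SAat.eq (hpr 1 w) analyticAt_const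
      have h4 : SAat {w : (Fin 2 → ℝ) × ℝ | w.2 * w.1 1 = w.1 0} w := SAat.eq (analyticAt_snd.mul (hpr 1 w)) (hpr 0 w)
      refine ((h1.inter ((h3.inter h2).union (h3.compl.inter h4))).union (h1.compl.inter h2)).congr (Filter.Eventually.of_forall ?_)
      rintro ⟨v, s⟩
      simp only [mem_union, mem_inter_iff, mem_compl_iff, Set.mem_ofPred_eq, dv]
      by_cases hv : |v 0| ≤ |v 1|
      · have hv2 : v 0 ^ 2 ≤ v 1 ^ 2 := sq_le_sq.2 hv
        rw [Set.indicator_of_mem (by exact hv)]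
        by_cases h0 : v 1 = 0
        · have h00 : v 0 = 0 := by
            rw [h0, abs_zero] at hv
            exact abs_nonpos_iff.1 hv
          simp [h0, h00]
        · simp [h0, hv2, eq_div_iff h0]
      · have hv2 : ¬ v 0 ^ 2 ≤ v 1 ^ 2 := fun h => hv (sq_le_sq.1 h)
        rw [Set.indicator_of_notMem (by exact hv)]
        simp [hv2]

theorem res_df {S : Set P} (hS : Df S) {C : Set P} (hC : SA C) (hCb : Bornology.IsBounded C) :
    ∃ (E : Type) (_ : NormedAddCommGroup E) (_ : NormedSpace ℝ E) (_ : FiniteDimensional ℝ E) (D R : Set (P × E)),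
      SA D ∧ SA R ∧ Bornology.IsBounded D ∧ (∀ x, x ∈ C ↔ ∃ e, (x, e) ∈ D) ∧ ∀ x e, (x, e) ∈ D → (x ∈ S ↔ (x, e) ∈ R) := by
  induction hS with
  | pos t ht =>
    obtain ⟨E, i1, i2, i3, D, τ, hD, hDb, hτ, hCD, hDt⟩ := res_tm ht hC hCb
    refine ⟨E, i1, i2, i3, D, {w | 0 < τ () w}, hD, fun w => SAat.pos (hτ () w), hDb, hCD, fun x e h => ?_⟩
    simp only [Set.mem_ofPred_eq, hDt x e h ()]
  | compl S _ ih =>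
    obtain ⟨E, i1, i2, i3, D, R, hD, hR, hDb, hCD, hDt⟩ := ih
    exact ⟨E, i1, i2, i3, D, Rᶜ, hD, fun w => (hR w).compl, hDb, hCD, fun x e h => not_congr (hDt x e h)⟩
  | inter S T _ _ ih1 ih2 =>
    obtain ⟨E, i1, i2, i3, D, R, hD, hR, hDb, hCD, hDt⟩ := ih1
    obtain ⟨E', i1', i2', i3', D', R', hD', hR', hDb', hCD', hDt'⟩ := ih2
    have h1 : ∀ w, AnalyticAt ℝ (fun w : P × (E × E') => (w.1, w.2.1)) w := fun w =>
      analyticAt_fst.prod (AnalyticAt.comp (g := Prod.fst) (f := Prod.snd) analyticAt_fst analyticAt_snd)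
    have h2 : ∀ w, AnalyticAt ℝ (fun w : P × (E × E') => (w.1, w.2.2)) w := fun w =>
      analyticAt_fst.prod (AnalyticAt.comp (g := Prod.snd) (f := Prod.snd) analyticAt_snd analyticAt_snd)
    refine ⟨E × E', inferInstance, inferInstance, inferInstance,
      (fun w : P × (E × E') => (w.1, w.2.1)) ⁻¹' D ∩ (fun w : P × (E × E') => (w.1, w.2.2)) ⁻¹' D',
      (fun w : P × (E × E') => (w.1, w.2.1)) ⁻¹' R ∩ (fun w : P × (E × E') => (w.1, w.2.2)) ⁻¹' R',
      fun w => (SA.preimage hD h1 w).inter (SA.preimage hD' h2 w), fun w => (SA.preimage hR h1 w).inter (SA.preimage hR' h2 w), ?_, ?_, ?_⟩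
    · have hb : Bornology.IsBounded (Prod.fst '' D) := (ContinuousLinearMap.fst ℝ P E).lipschitz.isBounded_image hDb
      refine (hb.prod ((isBounded_snd hDb).prod (isBounded_snd hDb'))).subset ?_
      rintro ⟨x, e, e'⟩ ⟨hx, hx'⟩
      exact ⟨⟨_, hx, rfl⟩, ⟨_, hx, rfl⟩, ⟨_, hx', rfl⟩⟩
    · intro x
      constructor
      · intro hx
        obtain ⟨e, he⟩ := (hCD x).1 hx
        obtain ⟨e', he'⟩ := (hCD' x).1 hx
        exact ⟨(e, e'), he, he'⟩
      · rintro ⟨⟨e, e'⟩, he, -⟩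
        exact (hCD x).2 ⟨e, he⟩
    · rintro x ⟨e, e'⟩ ⟨he, he'⟩
      exact and_congr (hDt x e he) (hDt' x e' he')

theorem Df.proj [FiniteDimensional ℝ P] {E : Type} [NormedAddCommGroup E] [NormedSpace ℝ E] [FiniteDimensional ℝ E]
    {S : Set (P × E)} (hS : Df S) (hb : Bornology.IsBounded S) : Df {x | ∃ y, (x, y) ∈ S} := by
  obtain ⟨C, hC, hCb, hSC⟩ := SA.box hb
  obtain ⟨E', i1, i2, i3, D, R, hD, hR, hDb, hCD, hDt⟩ := res_df hS hC hCb
  let φ : P × (E × E') → (P × E) × E' := fun w => ((w.1, w.2.1), w.2.2)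
  have hφ : ∀ w, AnalyticAt ℝ φ w := fun w =>
    (analyticAt_fst.prod (AnalyticAt.comp (g := Prod.fst) (f := Prod.snd) analyticAt_fst analyticAt_snd)).prod
      (AnalyticAt.comp (g := Prod.snd) (f := Prod.snd) analyticAt_snd analyticAt_snd)
  have hA : SA (φ ⁻¹' (D ∩ R)) := SA.preimage (fun w => (hD w).inter (hR w)) hφ
  have hAb : Bornology.IsBounded (φ ⁻¹' (D ∩ R)) := by
    have hb : Bornology.IsBounded (Prod.fst '' D) := (ContinuousLinearMap.fst ℝ (P × E) E').lipschitz.isBounded_image hDb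
    have hb1 : Bornology.IsBounded (Prod.fst '' (Prod.fst '' D)) := (ContinuousLinearMap.fst ℝ P E).lipschitz.isBounded_image hb
    refine (hb1.prod ((isBounded_snd hb).prod (isBounded_snd hDb))).subset ?_
    rintro ⟨x, y, e⟩ ⟨hx, -⟩
    exact ⟨⟨_, ⟨_, hx, rfl⟩, rfl⟩, ⟨_, ⟨_, hx, rfl⟩, rfl⟩, ⟨_, hx, rfl⟩⟩
  refine (SA.proj hA hAb).congr fun x => ?_
  constructor
  · rintro ⟨y, hy⟩
    obtain ⟨e, he⟩ := (hCD (x, y)).1 (hSC hy)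
    exact ⟨(y, e), he, (hDt _ _ he).1 hy⟩
  · rintro ⟨⟨y, e⟩, h1, h2⟩
    exact ⟨y, (hDt (x, y) e h1).2 h2⟩

end ResSec
end LojQE

open scoped Topology
open Set

namespace LojQE
set_option linter.unusedSectionVars false
set_option linter.unusedVariables false
section PlaneSec

/-- Punctured sector filter at the origin of the plane. -/
noncomputable def Lf : Filter (ℝ × ℝ) := 𝓝[>] (0:ℝ) ×ˢ 𝓝[>] (0:ℝ)

instance : Lf.NeBot := by unfold Lf; infer_instance

theorem Lf_iff {q : ℝ × ℝ → Prop} :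
    (∀ᶠ p in Lf, q p) ↔ ∃ ε : ℝ, 0 < ε ∧ ∀ r s, 0 < r → r < ε → 0 < s → s < ε → q (r, s) := by
  have h := (nhdsGT_basis (0:ℝ)).prod_self.eventually_iff (q := q)
  rw [Lf, h]
  constructor
  · rintro ⟨ε, h1, h2⟩
    exact ⟨ε, h1, fun r s a b c d => h2 ⟨⟨a, b⟩, ⟨c, d⟩⟩⟩
  · rintro ⟨ε, h1, h2⟩
    exact ⟨ε, h1, fun p hp => h2 p.1 p.2 hp.1.1 hp.1.2 hp.2.1 hp.2.2⟩

theorem Lf_le : Lf ≤ 𝓝 ((0:ℝ), (0:ℝ)) := by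
  rw [Lf, nhds_prod_eq]
  exact Filter.prod_mono nhdsWithin_le_nhds nhdsWithin_le_nhds

theorem Lf_pos : ∀ᶠ p in Lf, 0 < p.1 ∧ 0 < p.2 :=
  Lf_iff.2 ⟨1, one_pos, fun r s a _ b _ => ⟨a, b⟩⟩

/-- The substitution `(r, σ) ↦ (r, r ^ N σ)`. -/
def ph (N : ℕ) (p : ℝ × ℝ) : ℝ × ℝ := (p.1, p.1 ^ N * p.2)

theorem ph_ph (N M : ℕ) (p : ℝ × ℝ) : ph N (ph M p) = ph (N + M) p := by
  simp only [ph, pow_add, mul_assoc]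

theorem ph_an (N : ℕ) (p : ℝ × ℝ) : AnalyticAt ℝ (ph N) p :=
  analyticAt_fst.prod ((analyticAt_fst.pow N).mul analyticAt_snd)

theorem ph_tendsto0 (N : ℕ) : Filter.Tendsto (ph N) (𝓝 ((0:ℝ), (0:ℝ))) (𝓝 ((0:ℝ), (0:ℝ))) := by
  have h := (ph_an N ((0:ℝ), (0:ℝ))).continuousAt.tendsto
  have h0 : ph N ((0:ℝ), (0:ℝ)) = (0, 0) := by simp [ph]
  rwa [h0] at h

theorem ph_tendsto (N : ℕ) : Filter.Tendsto (ph N) Lf Lf := by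
  intro S hS
  obtain ⟨ε, hε, h⟩ := Lf_iff.1 (Filter.eventually_mem_set.2 hS)
  show ∀ᶠ p in Lf, ph N p ∈ S
  refine (Lf_iff.2 ⟨min ε 1, lt_min hε one_pos, fun r s a b c d => ?_⟩)
  have hr1 : r ^ N ≤ 1 := pow_le_one₀ a.le (b.le.trans (min_le_right _ _))
  refine h r (r ^ N * s) a (b.trans_le (min_le_left _ _)) (by positivity) ?_
  calc r ^ N * s ≤ 1 * s := by gcongr
    _ < ε := by rw [one_mul]; exact d.trans_le (min_le_left _ _)

theorem div_snd {F : ℝ × ℝ → ℝ} (hF : AnalyticAt ℝ F (0, 0)) :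
    ∃ H : ℝ × ℝ → ℝ, AnalyticAt ℝ H (0, 0) ∧ ∀ᶠ p in 𝓝 ((0:ℝ), (0:ℝ)), F p = F (p.1, 0) + p.2 * H p := by
  have hne : ¬ ∀ᶠ t in 𝓝 (0:ℝ), (fun w : ℝ × ℝ => w.2) ((0:ℝ), t) = 0 := by
    intro h
    have h1 : ∀ᶠ t in 𝓝[>] (0:ℝ), t = 0 := nhdsWithin_le_nhds h
    obtain ⟨t, ht, ht'⟩ := (h1.and self_mem_nhdsWithin).exists
    exact absurd ht (ne_of_gt ht')
  obtain ⟨d, ⟨u, hu, hu'⟩, hd⟩ := wdiv (0:ℝ) (fun w : ℝ × ℝ => w.2) analyticAt_snd hne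
  obtain ⟨q, r, hq, hr, hqr⟩ := hd F hF
  have hd1 : d ≤ 1 := by
    by_contra hcon
    obtain ⟨m, rfl⟩ : ∃ m, d = m + 2 := ⟨d - 2, by omega⟩
    have h1 : ∀ᶠ t in 𝓝[>] (0:ℝ), (1:ℝ) = t * (t ^ m * u t) := by
      filter_upwards [self_mem_nhdsWithin] with t ht
      have ht0 : t ≠ 0 := ne_of_gt ht
      have := hu' t
      simp only at this
      have h2 : t * 1 = t * (t * (t ^ m * u t)) := by
        rw [mul_one]; nth_rewrite 1 [this]; ring
      exact mul_left_cancel₀ ht0 h2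
    have h2 : Filter.Tendsto (fun t : ℝ => t * (t ^ m * u t)) (𝓝[>] (0:ℝ)) (𝓝 (0 * (0 ^ m * u 0))) := by
      apply Filter.Tendsto.mono_left _ nhdsWithin_le_nhds
      exact Filter.Tendsto.mul (by exact Filter.tendsto_id) ((Filter.Tendsto.pow (by exact Filter.tendsto_id) m).mul hu.continuousAt.tendsto)
    have h3 : Filter.Tendsto (fun t : ℝ => t * (t ^ m * u t)) (𝓝[>] (0:ℝ)) (𝓝 1) :=
      tendsto_const_nhds.congr' h1
    have := tendsto_nhds_unique h2 h3
    simp at this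
  obtain ⟨R, hR⟩ : ∃ R : ℝ → ℝ, ∀ w : ℝ × ℝ, ∑ k : Fin d, r k w.1 * w.2 ^ (k:ℕ) = R w.1 := by
    interval_cases d
    · exact ⟨fun _ => 0, fun w => by simp⟩
    · exact ⟨fun z => r 0 z, fun w => by simp⟩
  simp only [hR] at hqr
  refine ⟨q, hq, ?_⟩
  have ht : Filter.Tendsto (fun p : ℝ × ℝ => (p.1, (0:ℝ))) (𝓝 ((0:ℝ), (0:ℝ))) (𝓝 ((0:ℝ), (0:ℝ))) := by
    have : Continuous (fun p : ℝ × ℝ => (p.1, (0:ℝ))) := by fun_prop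
    exact this.tendsto' _ _ rfl
  filter_upwards [hqr, ht.eventually hqr] with p h1 h2
  rw [h1, h2]; ring

theorem an_line {F : ℝ × ℝ → ℝ} (hF : AnalyticAt ℝ F (0, 0)) (e : ℝ × ℝ) : AnalyticAt ℝ (fun t : ℝ => F (t • e)) 0 := by
  have h : AnalyticAt ℝ (fun t : ℝ => t • e) 0 := analyticAt_id.smul analyticAt_const
  have h0 : (fun t : ℝ => t • e) 0 = (0, 0) := zero_smul ℝ e
  refine AnalyticAt.comp (g := F) (f := fun t : ℝ => t • e) (by simp only [zero_smul]; exact hF) h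

theorem mono1 (e : ℝ × ℝ) (m : ℕ) : ∀ F : ℝ × ℝ → ℝ, AnalyticAt ℝ F (0, 0) →
    (∃ g : ℝ → ℝ, AnalyticAt ℝ g 0 ∧ g 0 ≠ 0 ∧ ∀ᶠ t in 𝓝 (0:ℝ), F (t • e) = t ^ m * g t) →
    ∃ (l : ℕ) (G : ℝ × ℝ → ℝ), AnalyticAt ℝ G (0, 0) ∧ (¬ ∀ᶠ r in 𝓝 (0:ℝ), G (r, 0) = 0) ∧
      ∀ᶠ p in 𝓝 ((0:ℝ), (0:ℝ)), F p = p.2 ^ l * G p := by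
  induction m with
  | zero =>
    rintro F hF ⟨g, hg, hg0, hFg⟩
    refine ⟨0, F, hF, fun h => hg0 ?_, Filter.Eventually.of_forall fun p => by simp⟩
    have h1 := hFg.self_of_nhds
    have h2 := h.self_of_nhds
    simp only [zero_smul, pow_zero, one_mul] at h1
    rw [← h1]; exact h2
  | succ m ih =>
    rintro F hF ⟨g, hg, hg0, hFg⟩
    by_cases h0 : ∀ᶠ r in 𝓝 (0:ℝ), F (r, 0) = 0
    · obtain ⟨H, hH, hFH⟩ := div_snd hF
      have hfst : Filter.Tendsto (fun p : ℝ × ℝ => p.1) (𝓝 ((0:ℝ), (0:ℝ))) (𝓝 0) := continuous_fst.tendsto' _ _ rfl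
      have hFH' : ∀ᶠ p in 𝓝 ((0:ℝ), (0:ℝ)), F p = p.2 * H p := by
        filter_upwards [hFH, hfst.eventually h0] with p h1 h2
        rw [h1, h2, zero_add]
      have hline : Filter.Tendsto (fun t : ℝ => t • e) (𝓝 0) (𝓝 ((0:ℝ), (0:ℝ))) := by
        have : Continuous (fun t : ℝ => t • e) := by fun_prop
        exact this.tendsto' _ _ (zero_smul ℝ e)
      have h3 : ∀ᶠ t in 𝓝[≠] (0:ℝ), e.2 * H (t • e) = t ^ m * g t := by
        filter_upwards [nhdsWithin_le_nhds (hline.eventually hFH'), nhdsWithin_le_nhds hFg, self_mem_nhdsWithin] with t h1 h2 h3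
        rw [h2] at h1
        have h4 : t * (t ^ m * g t) = t * (e.2 * H (t • e)) := by
          simp only [Prod.smul_snd, smul_eq_mul] at h1
          linear_combination h1
        exact (mul_left_cancel₀ h3 h4).symm
      have h4 : ∀ᶠ t in 𝓝 (0:ℝ), e.2 * H (t • e) = t ^ m * g t := by
        refine (ContinuousAt.eventuallyEq_nhds_iff_eventuallyEq_nhdsNE (f := fun t => e.2 * H (t • e)) (g := fun t => t ^ m * g t) ?_ ?_).1 h3
        · exact continuousAt_const.mul (an_line hH e).continuousAt
        · exact (continuousAt_id.pow m).mul hg.continuousAt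
      have he : e.2 ≠ 0 := by
        intro he
        have hg1 := hg.continuousAt.eventually_ne hg0
        have h8 : ∀ᶠ t in 𝓝[≠] (0:ℝ), (e.2 * H (t • e) = t ^ m * g t ∧ g t ≠ 0) ∧ t ≠ 0 :=
          Filter.Eventually.and (f := 𝓝[≠] (0:ℝ)) (nhdsWithin_le_nhds (h4.and hg1)) self_mem_nhdsWithin
        obtain ⟨t, ⟨h5, h6⟩, h7⟩ := h8.exists
        rw [he, zero_mul] at h5
        exact mul_ne_zero (pow_ne_zero m h7) h6 h5.symm
      obtain ⟨l, G, hG, hG0, hHG⟩ := ih H hH ⟨fun t => e.2⁻¹ * g t, analyticAt_const.mul hg, mul_ne_zero (inv_ne_zero he) hg0, by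
        filter_upwards [h4] with t ht
        have : H (t • e) = e.2⁻¹ * (e.2 * H (t • e)) := by field_simp
        rw [this, ht]; ring⟩
      refine ⟨l + 1, G, hG, hG0, ?_⟩
      filter_upwards [hFH', hHG] with p h1 h2
      rw [h1, h2]; ring
    · exact ⟨0, F, hF, h0, Filter.Eventually.of_forall fun p => by simp⟩

theorem mono2 {F : ℝ × ℝ → ℝ} (hF : AnalyticAt ℝ F (0, 0)) (hne : ¬ ∀ᶠ p in 𝓝 ((0:ℝ), (0:ℝ)), F p = 0) :
    ∃ k : ℕ, ∀ N, k < N → ∃ (a l : ℕ) (u : ℝ × ℝ → ℝ), AnalyticAt ℝ u (0, 0) ∧ u (0, 0) ≠ 0 ∧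
      ∀ᶠ p in 𝓝 ((0:ℝ), (0:ℝ)), F (ph N p) = p.1 ^ a * p.2 ^ l * u p := by
  obtain ⟨e, -, he⟩ := exists_direction (fun _ : Unit => F) (0, 0) (fun _ => hF) (fun _ => hne)
  have he1 : ¬ ∀ᶠ t in 𝓝 (0:ℝ), F (t • e) = 0 := by
    intro h
    refine he () (h.mono fun t ht => ?_)
    rw [show ((0:ℝ), (0:ℝ)) + t • e = t • e from zero_add _]; exact ht
  obtain ⟨m, g, hg, hg0, hFg⟩ := (an_line hF e).exists_eventuallyEq_pow_smul_nonzero_iff.2 he1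
  obtain ⟨l, G, hG, hG0, hFG⟩ := mono1 e m F hF ⟨g, hg, hg0, hFg.mono fun t ht => by simpa using ht⟩
  have hGl : AnalyticAt ℝ (fun r : ℝ => G (r, 0)) 0 := by
    have h := an_line hG (1, 0)
    simpa using h
  obtain ⟨k, g, hg, hg0, hGg⟩ := hGl.exists_eventuallyEq_pow_smul_nonzero_iff.2 hG0
  obtain ⟨H, hH, hGH⟩ := div_snd hG
  refine ⟨k, fun N hN => ?_⟩
  obtain ⟨j, rfl⟩ : ∃ j, N = k + (j + 1) := ⟨N - k - 1, by omega⟩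
  have hg1 : AnalyticAt ℝ (fun p : ℝ × ℝ => g p.1) (0, 0) :=
    AnalyticAt.comp (g := g) (f := Prod.fst) (x := ((0:ℝ), (0:ℝ))) hg analyticAt_fst
  have hH1 : AnalyticAt ℝ (fun p : ℝ × ℝ => H (ph (k + (j + 1)) p)) (0, 0) :=
    AnalyticAt.comp (g := H) (f := ph (k + (j + 1))) (x := ((0:ℝ), (0:ℝ))) (by simpa [ph] using hH) (ph_an _ _)
  refine ⟨k + (k + (j + 1)) * l, l, fun p => g p.1 + p.1 ^ (j + 1) * p.2 * H (ph (k + (j + 1)) p), ?_, by simpa using hg0, ?_⟩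
  · exact hg1.add (((analyticAt_fst.pow _).mul analyticAt_snd).mul hH1)
  · have hfst : Filter.Tendsto (fun p : ℝ × ℝ => p.1) (𝓝 ((0:ℝ), (0:ℝ))) (𝓝 0) := continuous_fst.tendsto' _ _ rfl
    filter_upwards [(ph_tendsto0 (k + (j + 1))).eventually hFG, (ph_tendsto0 (k + (j + 1))).eventually hGH, hfst.eventually hGg] with p h1 h2 h3
    rw [h1, h2]
    simp only [ph, sub_zero, smul_eq_mul] at h3 ⊢
    rw [h3]
    ring

end PlaneSec
end LojQE

open scoped Topology
open Set

namespace LojQE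
set_option linter.unusedSectionVars false
set_option linter.unusedVariables false
section PlaneSec2

/-- `t` becomes analytic along the sector after substituting `ph N`. -/
def RegN (N : ℕ) (t : ℝ × ℝ → ℝ) : Prop :=
  ∃ F : ℝ × ℝ → ℝ, AnalyticAt ℝ F (0, 0) ∧ ∀ᶠ p in Lf, t (ph N p) = F p

/-- Membership in `S` is decided along the sector after substituting `ph N`. -/
def DecN (N : ℕ) (S : Set (ℝ × ℝ)) : Prop :=
  (∀ᶠ p in Lf, ph N p ∈ S) ∨ ∀ᶠ p in Lf, ph N p ∉ S

theorem an_ph {F : ℝ × ℝ → ℝ} (hF : AnalyticAt ℝ F (0, 0)) (M : ℕ) : AnalyticAt ℝ (fun p => F (ph M p)) (0, 0) :=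
  AnalyticAt.comp (g := F) (f := ph M) (x := ((0:ℝ), (0:ℝ))) (by simpa [ph] using hF) (ph_an _ _)

theorem RegN.mono {N M : ℕ} (hNM : N ≤ M) {t : ℝ × ℝ → ℝ} (h : RegN N t) : RegN M t := by
  obtain ⟨j, rfl⟩ := Nat.exists_eq_add_of_le hNM
  obtain ⟨F, hF, hFt⟩ := h
  refine ⟨fun p => F (ph j p), an_ph hF j, ?_⟩
  filter_upwards [(ph_tendsto j).eventually hFt] with p hp
  rw [← ph_ph]; exact hp

theorem DecN.mono {N M : ℕ} (hNM : N ≤ M) {S : Set (ℝ × ℝ)} (h : DecN N S) : DecN M S := by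
  obtain ⟨j, rfl⟩ := Nat.exists_eq_add_of_le hNM
  rcases h with h | h
  · left
    filter_upwards [(ph_tendsto j).eventually h] with p hp
    rw [← ph_ph]; exact hp
  · right
    filter_upwards [(ph_tendsto j).eventually h] with p hp
    rw [← ph_ph]; exact hp

theorem DecN.compl {N : ℕ} {S : Set (ℝ × ℝ)} (h : DecN N S) : DecN N Sᶜ := by
  rcases h with h | h
  · right; exact h.mono fun p hp hn => hn hp
  · left; exact h

theorem DecN.inter {N : ℕ} {S T : Set (ℝ × ℝ)} (h : DecN N S) (h' : DecN N T) : DecN N (S ∩ T) := by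
  rcases h with h | h
  · rcases h' with h' | h'
    · left; exact h.and h'
    · right; exact h'.mono fun p hp hn => hp hn.2
  · right; exact h.mono fun p hp hn => hp hn.1

theorem DecN.forall_fin {k N : ℕ} {S : Fin k → Set (ℝ × ℝ)} (h : ∀ i, DecN N (S i)) : DecN N {p | ∀ i, p ∈ S i} := by
  by_cases hh : ∀ i, ∀ᶠ p in Lf, ph N p ∈ S i
  · left; exact Filter.eventually_all.2 hh
  · obtain ⟨i, hi⟩ := not_forall.1 hh
    right
    refine ((h i).resolve_left ?_).mono fun p hp hn => hp (hn i)
    exact hi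

theorem an_mono {F : ℝ × ℝ → ℝ} (hF : AnalyticAt ℝ F (0, 0)) :
    (∀ᶠ p in Lf, F p = 0) ∨ ∃ k : ℕ, ∀ N, k < N → ∃ (a l : ℕ) (u : ℝ × ℝ → ℝ), AnalyticAt ℝ u (0, 0) ∧ u (0, 0) ≠ 0 ∧
      ∀ᶠ p in Lf, F (ph N p) = p.1 ^ a * p.2 ^ l * u p := by
  by_cases h : ∀ᶠ p in 𝓝 ((0:ℝ), (0:ℝ)), F p = 0
  · left; exact Lf_le h
  · right
    obtain ⟨k, hk⟩ := mono2 hF h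
    refine ⟨k, fun N hN => ?_⟩
    obtain ⟨a, l, u, h1, h2, h3⟩ := hk N hN
    exact ⟨a, l, u, h1, h2, Lf_le h3⟩

theorem dec_pos {t : ℝ × ℝ → ℝ} {N : ℕ} (ht : RegN N t) : ∃ M, DecN M {p | 0 < t p} := by
  obtain ⟨F, hF, hFt⟩ := ht
  rcases an_mono hF with h | ⟨k, hk⟩
  · refine ⟨N, Or.inr ?_⟩
    filter_upwards [h, hFt] with p h1 h2
    rw [h2, h1]; exact lt_irrefl _
  · obtain ⟨a, l, u, hu, hu0, hFu⟩ := hk (k + 1) (Nat.lt_succ_self k)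
    refine ⟨N + (k + 1), ?_⟩
    have h2 := (ph_tendsto (k + 1)).eventually hFt
    simp only [ph_ph] at h2
    rcases lt_or_gt_of_ne hu0 with hs | hs
    · right
      filter_upwards [Lf_le (hu.continuousAt.eventually_lt_const hs), h2, hFu, Lf_pos] with p h3 h4 h5 h6
      rw [h4, h5, not_lt]
      have := h6.1; have := h6.2
      exact mul_nonpos_of_nonneg_of_nonpos (by positivity) (by exact le_of_lt h3)
    · left
      filter_upwards [Lf_le (hu.continuousAt.eventually_const_lt hs), h2, hFu, Lf_pos] with p h3 h4 h5 h6
      rw [h4, h5]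
      have := h6.1; have := h6.2
      have h3' : 0 < u p := h3
      positivity

theorem RegN.add {s t : ℝ × ℝ → ℝ} {N : ℕ} (hs : RegN N s) (ht : RegN N t) : RegN N (fun p => s p + t p) := by
  obtain ⟨F, hF, hFs⟩ := hs
  obtain ⟨G, hG, hGt⟩ := ht
  refine ⟨fun p => F p + G p, hF.add hG, ?_⟩
  filter_upwards [hFs, hGt] with p h1 h2
  rw [h1, h2]

theorem RegN.mul {s t : ℝ × ℝ → ℝ} {N : ℕ} (hs : RegN N s) (ht : RegN N t) : RegN N (fun p => s p * t p) := by
  obtain ⟨F, hF, hFs⟩ := hs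
  obtain ⟨G, hG, hGt⟩ := ht
  refine ⟨fun p => F p * G p, hF.mul hG, ?_⟩
  filter_upwards [hFs, hGt] with p h1 h2
  rw [h1, h2]

theorem RegN.const (c : ℝ) (N : ℕ) : RegN N (fun _ => c) :=
  ⟨fun _ => c, analyticAt_const, Filter.Eventually.of_forall fun _ => rfl⟩

theorem dec_le {s t : ℝ × ℝ → ℝ} {N : ℕ} (hs : RegN N s) (ht : RegN N t) : ∃ M, DecN M {p | s p ≤ t p} := by
  obtain ⟨M, hM⟩ := dec_pos (hs.add ((RegN.const (-1) N).mul ht))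
  refine ⟨M, ?_⟩
  have h := hM.compl
  have e : {p : ℝ × ℝ | s p ≤ t p} = {p | 0 < s p + -1 * t p}ᶜ := by
    ext p
    simp only [Set.mem_ofPred_eq, mem_compl_iff, not_lt]
    constructor <;> intro h <;> linarith
  rw [e]; exact h

theorem exp_le {c C ε : ℝ} {l m : ℕ} (hc : 0 < c) (hε : 0 < ε) (h : ∀ x, 0 < x → x < ε → c * x ^ l ≤ C * x ^ m) : m ≤ l := by
  by_contra hcon
  obtain ⟨j, rfl⟩ : ∃ j, m = l + (j + 1) := ⟨m - l - 1, by omega⟩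
  have h1 : ∀ᶠ x in 𝓝[>] (0:ℝ), c ≤ C * x ^ (j + 1) := by
    filter_upwards [Ioo_mem_nhdsGT hε] with x hx
    have := h x hx.1 hx.2
    rw [pow_add] at this
    have hx0 : 0 < x ^ l := pow_pos hx.1 l
    nlinarith
  have h2 : Filter.Tendsto (fun x : ℝ => C * x ^ (j + 1)) (𝓝[>] (0:ℝ)) (𝓝 0) := by
    have : Continuous (fun x : ℝ => C * x ^ (j + 1)) := by fun_prop
    exact (this.tendsto' 0 0 (by simp)).mono_left nhdsWithin_le_nhds
  have := ge_of_tendsto h2 h1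
  linarith

theorem reg_div {s t : ℝ × ℝ → ℝ} {N : ℕ} (hs : RegN N s) (ht : RegN N t) : ∃ M, RegN M (fun p => dv (s p, t p)) := by
  obtain ⟨N1, hN1⟩ := dec_le (hs.mul hs) (ht.mul ht)
  have hs2 := hs.mono (le_max_left N N1)
  have ht2 := ht.mono (le_max_left N N1)
  have hd := hN1.mono (le_max_right N N1)
  clear hN1 hs ht
  generalize max N N1 = K at hs2 ht2 hd
  have hdv : ∀ p, ¬ s p * s p ≤ t p * t p → dv (s p, t p) = 0 := by
    intro p hp
    rw [dv, Set.indicator_of_notMem]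
    intro h
    exact hp (by have h' : |s p| ≤ |t p| := h; have := sq_le_sq.2 h'; simpa only [sq] using this)
  rcases hd with hd | hd
  swap
  · refine ⟨K, fun _ => 0, analyticAt_const, ?_⟩
    filter_upwards [hd] with p hp
    exact hdv _ hp
  obtain ⟨F, hF, hFs⟩ := hs2
  obtain ⟨G, hG, hGt⟩ := ht2
  rcases an_mono hF with h | ⟨k, hk⟩
  · refine ⟨K, fun _ => 0, analyticAt_const, ?_⟩
    filter_upwards [h, hFs] with p h1 h2
    simp only [h2, h1, dv, Set.indicator_apply, zero_div, ite_self]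
  rcases an_mono hG with h | ⟨k', hk'⟩
  · refine ⟨K, fun _ => 0, analyticAt_const, ?_⟩
    filter_upwards [h, hGt] with p h1 h2
    simp only [h2, h1, dv, Set.indicator_apply, div_zero, ite_self]
  obtain ⟨a, l, u, hu, hu0, hFu⟩ := hk (k + k' + 1) (by omega)
  obtain ⟨a', l', u', hu', hu0', hGu⟩ := hk' (k + k' + 1) (by omega)
  have hFs' := (ph_tendsto (k + k' + 1)).eventually hFs
  have hGt' := (ph_tendsto (k + k' + 1)).eventually hGt
  have hd' := (ph_tendsto (k + k' + 1)).eventually hd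
  simp only [ph_ph] at hFs' hGt' hd'
  -- comparison of the exponents
  have hcmp : ∀ᶠ p in Lf, |u (0, 0)| / 2 * (p.1 ^ a * p.2 ^ l) ≤ (|u' (0, 0)| + 1) * (p.1 ^ a' * p.2 ^ l') := by
    have e1 : ∀ᶠ p in 𝓝 ((0:ℝ), (0:ℝ)), |u (0, 0)| / 2 < |u p| :=
      hu.continuousAt.abs.eventually_const_lt (by have := abs_pos.2 hu0; linarith)
    have e2 : ∀ᶠ p in 𝓝 ((0:ℝ), (0:ℝ)), |u' p| < |u' (0, 0)| + 1 :=
      hu'.continuousAt.abs.eventually_lt_const (by linarith)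
    filter_upwards [Lf_le e1, Lf_le e2, hFs', hGt', hd', Lf_pos, hFu, hGu] with p h1 h2 h3 h4 h5 h6 h7 h8
    rw [h3, h4, h7, h8, ← sq, ← sq, sq_le_sq, abs_mul _ (u p), abs_mul _ (u' p)] at h5
    have hp1 := h6.1
    have hp2 := h6.2
    have q1 : 0 < p.1 ^ a * p.2 ^ l := by positivity
    have q2 : 0 < p.1 ^ a' * p.2 ^ l' := by positivity
    rw [abs_of_pos q1, abs_of_pos q2] at h5
    nlinarith
  obtain ⟨ε, hε, hcmp⟩ := Lf_iff.1 hcmp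
  have hupos := abs_pos.2 hu0
  have hla : l' ≤ l := by
    refine exp_le (c := |u (0, 0)| / 2 * (ε / 2) ^ a) (C := (|u' (0, 0)| + 1) * (ε / 2) ^ a') (by positivity) hε fun x hx hx' => ?_
    have := hcmp (ε / 2) x (by linarith) (by linarith) hx hx'
    simp only at this
    linarith
  have haa : a' ≤ a := by
    refine exp_le (c := |u (0, 0)| / 2 * (ε / 2) ^ l) (C := (|u' (0, 0)| + 1) * (ε / 2) ^ l') (by positivity) hε fun x hx hx' => ?_
    have := hcmp x (ε / 2) hx hx' (by linarith) (by linarith)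
    simp only at this
    linarith
  obtain ⟨i, rfl⟩ := Nat.exists_eq_add_of_le hla
  obtain ⟨j, rfl⟩ := Nat.exists_eq_add_of_le haa
  refine ⟨K + (k + k' + 1), fun p => p.1 ^ j * p.2 ^ i * (u p / u' p), ?_, ?_⟩
  · exact ((analyticAt_fst.pow j).mul (analyticAt_snd.pow i)).mul (hu.div hu' hu0')
  · filter_upwards [hFs', hGt', hd', Lf_pos, hFu, hGu, Lf_le (hu'.continuousAt.eventually_ne hu0')] with p h3 h4 h5 h6 h7 h8 h9
    rw [dv, Set.indicator_of_mem (by rw [Set.mem_ofPred_eq, ← sq_le_sq, sq, sq]; exact h5)]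
    simp only
    rw [h3, h4, h7, h8]
    have hp1 := h6.1.ne'
    have hp2 := h6.2.ne'
    field_simp
    ring

theorem common_N {k : ℕ} {p : Fin k → ℕ → Prop} (hm : ∀ i N M, N ≤ M → p i N → p i M) (h : ∀ i, ∃ N, p i N) : ∃ N, ∀ i, p i N := by
  choose N hN using h
  exact ⟨Finset.univ.sup N, fun i => hm i _ _ (Finset.le_sup (Finset.mem_univ i)) (hN i)⟩

theorem reg_tm {t : ℝ × ℝ → ℝ} (ht : Tm t) : ∃ N, RegN N t := by
  induction ht with
  | const c => exact ⟨0, RegN.const c 0⟩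
  | lin l => exact ⟨0, fun p => l (ph 0 p), an_ph (l.analyticAt _) 0, Filter.Eventually.of_forall fun _ => rfl⟩
  | add s t _ _ hs ht =>
    obtain ⟨N, hN⟩ := hs
    obtain ⟨M, hM⟩ := ht
    exact ⟨max N M, (hN.mono (le_max_left _ _)).add (hM.mono (le_max_right _ _))⟩
  | mul s t _ _ hs ht =>
    obtain ⟨N, hN⟩ := hs
    obtain ⟨M, hM⟩ := ht
    exact ⟨max N M, (hN.mono (le_max_left _ _)).mul (hM.mono (le_max_right _ _))⟩
  | div s t _ _ hs ht =>
    obtain ⟨N, hN⟩ := hs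
    obtain ⟨M, hM⟩ := ht
    exact reg_div (hN.mono (le_max_left _ _)) (hM.mono (le_max_right _ _))
  | an k f c ρ hf g hg ih =>
    by_cases hρ : 0 ≤ ρ
    swap
    · refine ⟨0, fun _ => 0, analyticAt_const, Filter.Eventually.of_forall fun p => ?_⟩
      refine Set.indicator_of_notMem ?_ _
      rw [Metric.closedBall_eq_empty.2 (not_le.1 hρ)]
      exact notMem_empty _
    obtain ⟨N, hN⟩ := common_N (p := fun i N => RegN N (g i)) (fun i N M h => RegN.mono h) ih
    obtain ⟨N1, hN1⟩ := common_N (p := fun i N => DecN N {p | g i p ≤ c i + ρ}) (fun i N M h => DecN.mono h)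
      (fun i => dec_le (hN i) (RegN.const _ N))
    obtain ⟨N2, hN2⟩ := common_N (p := fun i N => DecN N {p | c i - ρ ≤ g i p}) (fun i N M h => DecN.mono h)
      (fun i => dec_le (RegN.const _ N) (hN i))
    have hd : DecN (N + N1 + N2) {p | ∀ i, p ∈ {p | g i p ≤ c i + ρ} ∩ {p | c i - ρ ≤ g i p}} :=
      DecN.forall_fin fun i => ((hN1 i).mono (by omega)).inter ((hN2 i).mono (by omega))
    have hmem : ∀ p, (∀ i, p ∈ {p | g i p ≤ c i + ρ} ∩ {p | c i - ρ ≤ g i p}) ↔ (fun i => g i p) ∈ Metric.closedBall c ρ := by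
      intro p
      rw [Metric.mem_closedBall, dist_pi_le_iff hρ]
      refine forall_congr' fun i => ?_
      rw [Real.dist_eq, abs_le, mem_inter_iff, Set.mem_ofPred_eq, Set.mem_ofPred_eq]
      constructor
      · rintro ⟨h1, h2⟩; constructor <;> linarith
      · rintro ⟨h1, h2⟩; constructor <;> linarith
    have hN' : ∀ i, RegN (N + N1 + N2) (g i) := fun i => (hN i).mono (by omega)
    choose F hF hFg using hN'
    have hall : ∀ᶠ p in Lf, ∀ i, g i (ph (N + N1 + N2) p) = F i p := Filter.eventually_all.2 hFg
    rcases hd with hd | hd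
    · have hFan : AnalyticAt ℝ (fun p => fun i => F i p) (0, 0) := AnalyticAt.pi hF
      have hin : (fun i => F i (0, 0)) ∈ Metric.closedBall c ρ := by
        have htd : Filter.Tendsto (fun p => fun i => F i p) Lf (𝓝 (fun i => F i (0, 0))) :=
          hFan.continuousAt.tendsto.mono_left Lf_le
        refine Metric.isClosed_closedBall.mem_of_tendsto htd ?_
        filter_upwards [hd, hall] with p h1 h2
        have := (hmem _).1 h1
        simpa only [h2] using this
      refine ⟨N + N1 + N2, fun p => f (fun i => F i p), ?_, ?_⟩
      · exact AnalyticAt.comp (g := f) (f := fun p => fun i => F i p) (hf _ hin) hFan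
      · filter_upwards [hd, hall] with p h1 h2
        rw [Set.indicator_of_mem ((hmem _).1 h1)]
        simp only [h2]
    · refine ⟨N + N1 + N2, fun _ => 0, analyticAt_const, ?_⟩
      filter_upwards [hd] with p h1
      rw [Set.indicator_of_notMem fun h => h1 ((hmem _).2 h)]

theorem dec_df {S : Set (ℝ × ℝ)} (hS : Df S) : ∃ N, DecN N S := by
  induction hS with
  | pos t ht =>
    obtain ⟨N, hN⟩ := reg_tm ht
    exact dec_pos hN
  | compl S _ ih =>
    obtain ⟨N, hN⟩ := ih
    exact ⟨N, hN.compl⟩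
  | inter S T _ _ ih1 ih2 =>
    obtain ⟨N, hN⟩ := ih1
    obtain ⟨M, hM⟩ := ih2
    exact ⟨max N M, (hN.mono (le_max_left _ _)).inter (hM.mono (le_max_right _ _))⟩

end PlaneSec2
end LojQE

open scoped Topology
open Set

namespace LojQE
set_option linter.unusedSectionVars false
set_option linter.unusedVariables false
section FinalSec
variable {n : ℕ}

theorem tm_normsq {P : Type} [NormedAddCommGroup P] [NormedSpace ℝ P] (φ : P →L[ℝ] EuclideanSpace ℝ (Fin n)) :
    Tm (fun p => ‖φ p‖ ^ 2) := by
  have h : (fun p => ‖φ p‖ ^ 2) = fun p => ∑ i ∈ (Finset.univ : Finset (Fin n)), φ p i * φ p i := by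
    funext p
    rw [EuclideanSpace.real_norm_sq_eq]
    simp only [sq]
  rw [h]
  refine Tm.sum _ _ fun i => ?_
  have := Tm.lin ((EuclideanSpace.proj (𝕜 := ℝ) i).comp φ)
  exact Tm.mul _ _ this this

/-- The set of bad pairs of parameters. -/
def Bad (U V : Set (EuclideanSpace ℝ (Fin n))) : Set (ℝ × ℝ) :=
  {p | ∃ w : EuclideanSpace ℝ (Fin n) × EuclideanSpace ℝ (Fin n), 0 < p.1 ∧ p.1 < 1 ∧ 0 < p.2 ∧ p.2 < 1 ∧
    w.1 ∉ U ∧ w.1 ∈ V ∧ w.2 ∈ U ∧ w.2 ∉ V ∧ ‖w.1 - w.2‖ ≤ p.2 ∧ ∀ y, ‖y - w.1‖ < p.1 → y ∈ U ∪ V}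

theorem bad_df {U V : Set (EuclideanSpace ℝ (Fin n))} (hUb : Bornology.IsBounded U) (hVb : Bornology.IsBounded V)
    (hU : Df U) (hV : Df V) : Df (Bad U V) := by
  let E := EuclideanSpace ℝ (Fin n)
  obtain ⟨R, hR⟩ := (hUb.union hVb).exists_norm_le
  let I : Set ℝ := Icc 0 1
  have hI : Bornology.IsBounded I := Metric.isBounded_Icc 0 1
  let pr : ((ℝ × ℝ) × (E × E)) × E →L[ℝ] (ℝ × ℝ) × (E × E) := ContinuousLinearMap.fst ℝ _ _
  let B : Set ((ℝ × ℝ) × (E × E)) := {q | 0 < q.1.1 ∧ q.1.1 < 1 ∧ 0 < q.1.2 ∧ q.1.2 < 1 ∧ q.2.1 ∉ U ∧ q.2.1 ∈ V ∧ q.2.2 ∈ U ∧ q.2.2 ∉ V}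
  have hBb : Bornology.IsBounded B := by
    refine ((hI.prod hI).prod ((hUb.union hVb).prod (hUb.union hVb))).subset ?_
    rintro ⟨⟨r, s⟩, a, b⟩ ⟨h1, h2, h3, h4, h5, h6, h7, h8⟩
    exact ⟨⟨⟨h1.le, h2.le⟩, ⟨h3.le, h4.le⟩⟩, Or.inr h6, Or.inl h7⟩
  let c11 : (ℝ × ℝ) × (E × E) →L[ℝ] ℝ := (ContinuousLinearMap.fst ℝ ℝ ℝ).comp (ContinuousLinearMap.fst ℝ (ℝ × ℝ) (E × E))
  let c12 : (ℝ × ℝ) × (E × E) →L[ℝ] ℝ := (ContinuousLinearMap.snd ℝ ℝ ℝ).comp (ContinuousLinearMap.fst ℝ (ℝ × ℝ) (E × E))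
  let c21 : (ℝ × ℝ) × (E × E) →L[ℝ] E := (ContinuousLinearMap.fst ℝ E E).comp (ContinuousLinearMap.snd ℝ (ℝ × ℝ) (E × E))
  let c22 : (ℝ × ℝ) × (E × E) →L[ℝ] E := (ContinuousLinearMap.snd ℝ E E).comp (ContinuousLinearMap.snd ℝ (ℝ × ℝ) (E × E))
  have hB : Df B := by
    refine Df.and (p := fun q : (ℝ × ℝ) × (E × E) => 0 < q.1.1) (Tm.lt (Tm.const 0) (Tm.lin c11)) ?_
    refine Df.and (p := fun q : (ℝ × ℝ) × (E × E) => q.1.1 < 1) (Tm.lt (Tm.lin c11) (Tm.const 1)) ?_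
    refine Df.and (p := fun q : (ℝ × ℝ) × (E × E) => 0 < q.1.2) (Tm.lt (Tm.const 0) (Tm.lin c12)) ?_
    refine Df.and (p := fun q : (ℝ × ℝ) × (E × E) => q.1.2 < 1) (Tm.lt (Tm.lin c12) (Tm.const 1)) ?_
    refine Df.and (p := fun q : (ℝ × ℝ) × (E × E) => q.2.1 ∉ U) (Df.compl _ (hU.preimage_lin c21)) ?_
    refine Df.and (p := fun q : (ℝ × ℝ) × (E × E) => q.2.1 ∈ V) (hV.preimage_lin c21) ?_
    exact Df.and (p := fun q : (ℝ × ℝ) × (E × E) => q.2.2 ∈ U) (hU.preimage_lin c22) (Df.compl _ (hV.preimage_lin c22))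
  let sn : ((ℝ × ℝ) × (E × E)) × E →L[ℝ] E := ContinuousLinearMap.snd ℝ _ _
  let T1 : Set (((ℝ × ℝ) × (E × E)) × E) := {x | x.1 ∈ B ∧ ‖x.2 - x.1.2.1‖ ^ 2 < x.1.1.1 * x.1.1.1 ∧ x.2 ∉ U ∧ x.2 ∉ V}
  have hT1 : Df T1 := by
    refine Df.and (p := fun x : ((ℝ × ℝ) × (E × E)) × E => x.1 ∈ B) (hB.preimage_lin pr) ?_
    refine Df.and (p := fun x : ((ℝ × ℝ) × (E × E)) × E => ‖x.2 - x.1.2.1‖ ^ 2 < x.1.1.1 * x.1.1.1) ?_ ?_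
    · exact Tm.lt (tm_normsq (sn - c21.comp pr)) (Tm.mul _ _ (Tm.lin (c11.comp pr)) (Tm.lin (c11.comp pr)))
    · exact Df.and (p := fun x : ((ℝ × ℝ) × (E × E)) × E => x.2 ∉ U) (Df.compl _ (hU.preimage_lin sn)) (Df.compl _ (hV.preimage_lin sn))
  have hT1b : Bornology.IsBounded T1 := by
    refine (hBb.prod (Metric.isBounded_closedBall (x := (0 : E)) (r := R + 1))).subset ?_
    rintro ⟨q, y⟩ ⟨h1, h2, -, -⟩
    refine ⟨h1, ?_⟩
    have h3 : ‖y - q.2.1‖ < q.1.1 := by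
      refine lt_of_pow_lt_pow_left₀ 2 h1.1.le ?_
      rw [sq q.1.1]; exact h2
    have h4 := hR q.2.1 (Or.inr h1.2.2.2.2.2.1)
    rw [mem_closedBall_zero_iff]
    have h5 : ‖y‖ ≤ ‖y - q.2.1‖ + ‖q.2.1‖ := by
      simpa using norm_add_le (y - q.2.1) q.2.1
    have := h1.2.1
    show ‖y‖ ≤ R + 1
    linarith
  have hT1' := hT1.proj hT1b
  let T2 : Set ((ℝ × ℝ) × (E × E)) := {q | q ∈ B ∧ ‖q.2.1 - q.2.2‖ ^ 2 ≤ q.1.2 * q.1.2 ∧ ¬ ∃ y, (q, y) ∈ T1}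
  have hT2 : Df T2 := by
    refine Df.and (p := fun x : (ℝ × ℝ) × (E × E) => x ∈ B) hB ?_
    refine Df.and (p := fun q : (ℝ × ℝ) × (E × E) => ‖q.2.1 - q.2.2‖ ^ 2 ≤ q.1.2 * q.1.2) ?_ hT1'.not
    exact Tm.le (tm_normsq (c21 - c22)) (Tm.mul _ _ (Tm.lin c12) (Tm.lin c12))
  have hT2b : Bornology.IsBounded T2 := hBb.subset fun q hq => hq.1
  refine (hT2.proj hT2b).congr fun p => ?_
  constructor
  · rintro ⟨w, h1, h2, h3, h4, h5, h6, h7, h8, h9, h10⟩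
    refine ⟨w, ⟨h1, h2, h3, h4, h5, h6, h7, h8⟩, ?_, ?_⟩
    · rw [← sq]; exact pow_le_pow_left₀ (norm_nonneg _) h9 2
    · rintro ⟨y, -, h11, h12, h13⟩
      have h14 : ‖y - w.1‖ < p.1 := by
        refine lt_of_pow_lt_pow_left₀ 2 h1.le ?_
        rw [sq p.1]; exact h11
      rcases h10 y h14 with h | h
      · exact h12 h
      · exact h13 h
  · rintro ⟨w, hB, h9, h10⟩
    obtain ⟨h1, h2, h3, h4, h5, h6, h7, h8⟩ := id hB
    refine ⟨w, h1, h2, h3, h4, h5, h6, h7, h8, ?_, ?_⟩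
    · refine le_of_sq_le_sq ?_ h3.le
      rw [sq p.2]; exact h9
    · intro y hy
      by_contra hcon
      refine h10 ⟨y, hB, ?_, fun h => hcon (Or.inl h), fun h => hcon (Or.inr h)⟩
      rw [← sq]; exact pow_lt_pow_left₀ hy (norm_nonneg _) two_ne_zero

theorem not_all_bad {U V : Set (EuclideanSpace ℝ (Fin n))} (hUo : IsOpen U) (hVo : IsOpen V)
    (hVb : Bornology.IsBounded V) {r : ℝ} (h : ∃ᶠ s in 𝓝[>] (0:ℝ), (r, s) ∈ Bad U V) : False := by
  have hex : ∀ k : ℕ, ∃ s, 0 < s ∧ s < 1 / ((k:ℝ) + 1) ∧ (r, s) ∈ Bad U V := by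
    intro k
    have h1 : ∀ᶠ s in 𝓝[>] (0:ℝ), s ∈ Ioo (0:ℝ) (1 / ((k:ℝ) + 1)) := Ioo_mem_nhdsGT (by positivity)
    obtain ⟨s, hs, hs'⟩ := (h.and_eventually h1).exists
    exact ⟨s, hs'.1, hs'.2, hs⟩
  choose s hs0 hs1 hs using hex
  choose w h1 h2 h3 h4 h5 h6 h7 h8 h9 h10 using hs
  obtain ⟨a, -, φ, hφ, ha⟩ := tendsto_subseq_of_bounded hVb (x := fun k => (w k).1) h6
  have hs2 : Filter.Tendsto s Filter.atTop (𝓝 0) :=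
    squeeze_zero (fun k => (hs0 k).le) (fun k => (hs1 k).le) tendsto_one_div_add_atTop_nhds_zero_nat
  have hd : Filter.Tendsto (fun k => (w (φ k)).1 - (w (φ k)).2) Filter.atTop (𝓝 0) :=
    squeeze_zero_norm (fun k => h9 (φ k)) (hs2.comp hφ.tendsto_atTop)
  have hb : Filter.Tendsto (fun k => (w (φ k)).2) Filter.atTop (𝓝 a) := by
    have := ha.sub hd
    rw [sub_zero] at this
    refine this.congr fun k => ?_
    simp
  have haU : a ∈ Uᶜ := hUo.isClosed_compl.mem_of_tendsto ha (Filter.Eventually.of_forall fun k => h5 (φ k))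
  have haV : a ∈ Vᶜ := hVo.isClosed_compl.mem_of_tendsto hb (Filter.Eventually.of_forall fun k => h8 (φ k))
  have hr : 0 < r := h1 0
  obtain ⟨k, hk⟩ := (ha.eventually (Metric.ball_mem_nhds a hr)).exists
  have hk' : ‖a - (w (φ k)).1‖ < r := by
    rw [← dist_eq_norm, dist_comm]; exact hk
  rcases h10 (φ k) a hk' with h | h
  · exact haU h
  · exact haV h

theorem main_ineq (U V : Set (EuclideanSpace ℝ (Fin n)))
    (hUo : IsOpen U) (hVo : IsOpen V) (hUb : Bornology.IsBounded U) (hVb : Bornology.IsBounded V)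
    (hU : Df U) (hV : Df V) :
    ∃ (N : ℕ) (C : ℝ), 0 < N ∧ 0 < C ∧ ∀ x, Metric.infDist x (U ∪ V)ᶜ ^ N ≤ C * (Metric.infDist x Uᶜ + Metric.infDist x Vᶜ) := by
  rcases ((U ∪ V)ᶜ).eq_empty_or_nonempty with he | ⟨z, hz⟩
  · refine ⟨1, 1, one_pos, one_pos, fun x => ?_⟩
    rw [he, Metric.infDist_empty, pow_one, one_mul]
    exact add_nonneg Metric.infDist_nonneg Metric.infDist_nonneg
  obtain ⟨N, hN⟩ := dec_df (bad_df hUb hVb hU hV)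
  rcases hN with hN | hN
  · exfalso
    obtain ⟨ε, hε, h⟩ := Lf_iff.1 hN
    refine not_all_bad hUo hVo hVb (r := ε / 2) ?_
    refine Filter.Eventually.frequently ?_
    have hq : 0 < (ε / 2) ^ N := by positivity
    have hpos : 0 < (ε / 2) ^ N * ε := by positivity
    filter_upwards [Ioo_mem_nhdsGT hpos] with s hs
    have h1 := h (ε / 2) (s / (ε / 2) ^ N) (by linarith) (by linarith) (div_pos hs.1 hq) (by rw [div_lt_iff₀ hq]; linarith [hs.2])
    simp only [ph] at h1
    rwa [mul_div_cancel₀ _ hq.ne'] at h1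
  obtain ⟨ε0, hε0, h0⟩ := Lf_iff.1 hN
  obtain ⟨ε, hε, hε1, h⟩ : ∃ ε : ℝ, 0 < ε ∧ ε < 1 ∧ ∀ r s, 0 < r → r < ε → 0 < s → s < ε → ph N (r, s) ∉ Bad U V :=
    ⟨min ε0 (1/2), by positivity, by have := min_le_right ε0 (1/2); linarith,
      fun r s a b c d => h0 r s a (b.trans_le (min_le_left _ _)) c (d.trans_le (min_le_left _ _))⟩
  obtain ⟨R, hR⟩ := (hUb.union hVb).exists_norm_le
  set D : ℝ := |R| + ‖z‖ + 1 with hD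
  have hDpos : 0 < D := by positivity
  set c : ℝ := min (1/2) (ε / (2 * D)) with hc
  have hcpos : 0 < c := by positivity
  have hc1 : c ≤ 1/2 := min_le_left _ _
  have hc2 : c * D ≤ ε / 2 := by
    calc c * D ≤ ε / (2 * D) * D := by gcongr; exact min_le_right _ _
      _ = ε / 2 := by field_simp
  set σ : ℝ := ε / 2 with hσ
  have hσpos : 0 < σ := by positivity
  refine ⟨N + 1, D / (c ^ N * σ) + 2 * D ^ N, Nat.succ_pos N, by positivity, fun x => ?_⟩
  set δ := Metric.infDist x (U ∪ V)ᶜ with hδ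
  set α := Metric.infDist x Uᶜ with hα
  set β := Metric.infDist x Vᶜ with hβ
  have hα0 : 0 ≤ α := Metric.infDist_nonneg
  have hβ0 : 0 ≤ β := Metric.infDist_nonneg
  have hδ0 : 0 ≤ δ := Metric.infDist_nonneg
  have hin : ∀ y, dist y x < δ → y ∈ U ∪ V := by
    intro y hy
    by_contra hcon
    have : δ ≤ dist x y := Metric.infDist_le_dist_of_mem hcon
    rw [dist_comm] at this
    linarith
  rcases hδ0.eq_or_lt with hd | hd
  · rw [← hd, zero_pow (Nat.succ_ne_zero N)]
    positivity
  have hxin : x ∈ U ∪ V := hin x (by rw [dist_self]; exact hd)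
  have hδD : δ ≤ D := by
    have h1 : δ ≤ dist x z := Metric.infDist_le_dist_of_mem hz
    have h2 : dist x z ≤ ‖x‖ + ‖z‖ := dist_le_norm_add_norm x z
    have h3 := hR x hxin
    have h4 := le_abs_self R
    linarith
  have hpart1 : 0 ≤ D / (c ^ N * σ) * (α + β) := by positivity
  have hpart2 : 0 ≤ 2 * D ^ N * (α + β) := by positivity
  rw [add_mul]
  by_cases hcase : δ / 2 ≤ α + β
  · have : δ ^ (N + 1) ≤ 2 * D ^ N * (α + β) := by
      calc δ ^ (N + 1) = δ ^ N * δ := pow_succ _ _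
        _ ≤ D ^ N * δ := by gcongr
        _ ≤ D ^ N * (2 * (α + β)) := by gcongr; linarith
        _ = _ := by ring
    linarith
  · push Not at hcase
    obtain ⟨a, haU, ha⟩ := hUo.isClosed_compl.exists_infDist_eq_dist ⟨z, fun hh => hz (Or.inl hh)⟩ x
    obtain ⟨b, hbV, hb⟩ := hVo.isClosed_compl.exists_infDist_eq_dist ⟨z, fun hh => hz (Or.inr hh)⟩ x
    have ha' : dist a x = α := by rw [dist_comm, ← ha]
    have hb' : dist b x = β := by rw [dist_comm, ← hb]
    have haV : a ∈ V := (hin a (by linarith)).resolve_left haU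
    have hbU : b ∈ U := (hin b (by linarith)).resolve_right hbV
    have hcδ : c * δ ≤ ε / 2 := le_trans (by gcongr) hc2
    have hcδ0 : 0 < c * δ := by positivity
    have hnot := h (c * δ) σ hcδ0 (by linarith) hσpos (by linarith)
    have hkey : (c * δ) ^ N * σ < ‖a - b‖ := by
      by_contra hcon
      push Not at hcon
      refine hnot ⟨(a, b), hcδ0, by show c * δ < 1; linarith, by show 0 < (c * δ) ^ N * σ; positivity, ?_, haU, haV, hbU, hbV, hcon, ?_⟩
      · show (c * δ) ^ N * σ < 1
        have : (c * δ) ^ N ≤ 1 := pow_le_one₀ hcδ0.le (by linarith)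
        nlinarith
      · intro y hy
        refine hin y ?_
        have h1 : dist y a < c * δ := by rw [dist_eq_norm]; exact hy
        have h2 : c * δ ≤ 1 / 2 * δ := by gcongr
        have := dist_triangle y a x
        linarith
    have hab : ‖a - b‖ ≤ α + β := by
      rw [← dist_eq_norm]
      have := dist_triangle_right a b x
      linarith
    have : δ ^ (N + 1) ≤ D / (c ^ N * σ) * (α + β) := by
      calc δ ^ (N + 1) = δ * δ ^ N := pow_succ' _ _
        _ ≤ D * δ ^ N := by gcongr
        _ = D / (c ^ N * σ) * ((c * δ) ^ N * σ) := by rw [mul_pow]; field_simp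
        _ ≤ D / (c ^ N * σ) * (α + β) := by gcongr; linarith
    linarith

end FinalSec
end LojQE

/-- **Łojasiewicz-type distance inequality.**  Let `U` and `V` be two relatively compact
subanalytic open subsets of `ℝⁿ`.  Then there exist a positive integer `N` and a constant
`C > 0` such that for all `x`,
`dist(x, ℝⁿ ∖ (U ∪ V))^N ≤ C (dist(x, ℝⁿ ∖ U) + dist(x, ℝⁿ ∖ V))`. -/
theorem dist_compl_union_le {n : ℕ} (U V : Set (EuclideanSpace ℝ (Fin n)))
    (hUo : IsOpen U) (hVo : IsOpen V)
    (hUb : Bornology.IsBounded U) (hVb : Bornology.IsBounded V)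
    (hUs : Subanalytic U) (hVs : Subanalytic V) :
    ∃ (N : ℕ) (C : ℝ), 0 < N ∧ 0 < C ∧ ∀ x : EuclideanSpace ℝ (Fin n),
      Metric.infDist x (U ∪ V)ᶜ ^ N ≤ C * (Metric.infDist x Uᶜ + Metric.infDist x Vᶜ) := by
  exact LojQE.main_ineq U V hUo hVo hUb hVb (LojQE.df_of_subanalytic hUs hUb) (LojQE.df_of_subanalytic hVs hVb)
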